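/- Let a ≥ b > 0 and c > 0 with Δ < −1, where Δ := (a²+b²−c²)/(2ab); let ζ > 0 satisfy Δ = −cosh(ζ) and let θ ∈ (0,π) be the unique solution of a·sinh(θζ/π) = b·sinh((1−θ/π)ζ). There exist an absolute constant C > 0, a constant K(ζ,θ) > 0, and a constant C'(ζ,θ) < ∞ such that: (a) for every even N ≥ 2 and every n ≤ N/2 the limit f_N^{(n)}(a,b,c) := lim_{M→∞} (1/(NM)) log Z^{(n)}(𝕋_{N,M},a,b,c) exists; (b) for every ε > 0 there exists δ > 0 such that for every even N and every n with n ≤ N/2 − C·min{ζ^{−2}, (log N)²} and 1/2 − n/N ≤ δ, one has |f_N^{(n)}(a,b,c) − f(a,b,c) + K(ζ,θ)·(1 − 2n/N)| ≤ ε·(1 − 2n/N) + C'(ζ,θ)/N. -/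

import Mathlib

open MeasureTheory Filter
open scoped Real BigOperators

noncomputable section

namespace SixVertexFE

/-- Configurations on the `N × M` torus: each vertex `v` carries a horizontal edge
(from `v` to `v+(1,0)`) and a vertical edge (from `v` to `v+(0,1)`).
First component: `true` = the horizontal edge points East.
Second component: `true` = the vertical edge points North. -/
abbrev Cfg (N M : ℕ) := ((Fin N × Fin M) → Bool) × ((Fin N × Fin M) → Bool)

/-- the predecessor (`i - 1`) on the discrete circle `Fin N`. -/
def predF {N : ℕ} (i : Fin N) : Fin N := ⟨(i.1 + (N - 1)) % N, Nat.mod_lt _ i.pos⟩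

/-- number of edges incident to `v` that point towards `v`. -/
abbrev inArrows {N M : ℕ} (ω : Cfg N M) (v : Fin N × Fin M) : ℕ :=
  (if ω.1 (predF v.1, v.2) = true then 1 else 0) +
  (if ω.1 v = false then 1 else 0) +
  (if ω.2 (v.1, predF v.2) = true then 1 else 0) +
  (if ω.2 v = false then 1 else 0)

/-- the ice rule: exactly two incoming arrows at every vertex. -/
abbrev IsSixVertex {N M : ℕ} (ω : Cfg N M) : Prop := ∀ v, inArrows ω v = 2

/-- weight of a vertex: `c` if the two horizontal edges at `v` point in opposite
directions, `a` for all-East-all-North or all-West-all-South, `b` for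
all-East-all-South or all-West-all-North. -/
def vWeight (a b c : ℝ) {N M : ℕ} (ω : Cfg N M) (v : Fin N × Fin M) : ℝ :=
  if ω.1 (predF v.1, v.2) ≠ ω.1 v then c
  else if (ω.1 (predF v.1, v.2) = true ∧ ω.1 v = true ∧
            ω.2 (v.1, predF v.2) = true ∧ ω.2 v = true) ∨
          (ω.1 (predF v.1, v.2) = false ∧ ω.1 v = false ∧
            ω.2 (v.1, predF v.2) = false ∧ ω.2 v = false) then a
  else if (ω.1 (predF v.1, v.2) = true ∧ ω.1 v = true ∧
            ω.2 (v.1, predF v.2) = false ∧ ω.2 v = false) ∨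
          (ω.1 (predF v.1, v.2) = false ∧ ω.1 v = false ∧
            ω.2 (v.1, predF v.2) = true ∧ ω.2 v = true) then b
  else 0

/-- weight of a configuration. -/
def W (a b c : ℝ) {N M : ℕ} (ω : Cfg N M) : ℝ := ∏ v, vWeight a b c ω v

/-- partition function of the six-vertex model on the `N × M` torus. -/
def Z (N M : ℕ) (a b c : ℝ) : ℝ :=
  ∑ ω : Cfg N M, if IsSixVertex ω then W a b c ω else 0

/-- number of North-pointing vertical edges in row `j`. -/
abbrev RowCount {N M : ℕ} (ω : Cfg N M) (j : Fin M) : ℕ :=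
  (Finset.univ.filter fun i : Fin N => ω.2 (i, j) = true).card

/-- partition function restricted to configurations with exactly `n` up arrows per row. -/
def Zn (N M n : ℕ) (a b c : ℝ) : ℝ :=
  ∑ ω : Cfg N M, if IsSixVertex ω ∧ (∀ j, RowCount ω j = n) then W a b c ω else 0

/-- `F` is the per-site free energy of the six-vertex model with weights `a, b, c`:
the inner limit in `M` exists for every even `N ≥ 2`, and the resulting quantities
converge to `F` as `N → ∞` along even `N`. -/
def FreeEnergyIs (a b c F : ℝ) : Prop :=
  ∃ g : ℕ → ℝ,
    (∀ N : ℕ, Even N → 2 ≤ N →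
      Tendsto (fun M : ℕ => Real.log (Z N M a b c) / (M * N)) atTop (nhds (g N))) ∧
    Tendsto g (atTop ⊓ Filter.principal {N | Even N}) (nhds F)

/-- `L = f_N^{(n)}(a,b,c)`, the free energy of the six-vertex model in the sector
with `n` up arrows per row. -/
def SectorFE (N n : ℕ) (a b c L : ℝ) : Prop :=
  Tendsto (fun M : ℕ => Real.log (Zn N M n a b c) / (N * M)) atTop (nhds L)

end SixVertexFE

namespace SixVertexFE

set_option linter.all false

section mpo
open Matrix
open scoped Kronecker

variable {D D' R : Type*} [Fintype D] [DecidableEq D] [Fintype D'] [DecidableEq D'] [CommRing R]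

/-- rows of vertical arrows -/
abbrev Row (N : ℕ) := Fin N → Bool

/-- ordered product of auxiliary matrices -/
def mp (M : Bool → Bool → Matrix D D R) {N : ℕ} (η η' : Row N) : Matrix D D R :=
  (List.ofFn fun i => M (η i) (η' i)).prod

/-- transfer matrix -/
def tmat (M : Bool → Bool → Matrix D D R) (N : ℕ) : Matrix (Row N) (Row N) R :=
  fun η η' => (mp M η η').trace

lemma mp_zero (M : Bool → Bool → Matrix D D R) (η η' : Row 0) : mp M η η' = 1 := by
  simp [mp]

lemma mp_cons (M : Bool → Bool → Matrix D D R) {N : ℕ} (s s' : Bool) (η η' : Row N) :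
    mp M (Fin.cons s η : Row (N+1)) (Fin.cons s' η' : Row (N+1)) = M s s' * mp M η η' := by
  simp [mp, List.ofFn_succ]

lemma sum_row_succ {N : ℕ} {A : Type*} [AddCommMonoid A] (f : Row (N+1) → A) :
    ∑ η, f η = ∑ s, ∑ η : Row N, f (Fin.cons s η) := by
  rw [← (Fin.consEquiv (fun _ : Fin (N+1) => Bool)).sum_comp, Fintype.sum_prod_type]
  rfl

lemma row_ind {P : ∀ {N : ℕ}, Row N → Row N → Prop} (h0 : ∀ η η' : Row 0, P η η')
    (h1 : ∀ {N : ℕ} (s s' : Bool) (η η' : Row N), P η η' →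
      P (Fin.cons s η : Row (N+1)) (Fin.cons s' η' : Row (N+1))) :
    ∀ {N : ℕ} (η η' : Row N), P η η' := by
  intro N
  induction N with
  | zero => exact h0
  | succ N ih =>
    intro η η'
    have := h1 (η 0) (η' 0) (Fin.tail η) (Fin.tail η') (ih _ _)
    simpa [Fin.cons_self_tail] using this

/-- two layers -/
def kk (M : Bool → Bool → Matrix D D R) (M' : Bool → Bool → Matrix D' D' R) (s s'' : Bool) :
    Matrix (D × D') (D × D') R := ∑ s', M s s' ⊗ₖ M' s' s''

lemma mp_kk (M : Bool → Bool → Matrix D D R) (M' : Bool → Bool → Matrix D' D' R) {N : ℕ}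
    (η η'' : Row N) : ∑ η' : Row N, mp M η η' ⊗ₖ mp M' η' η'' = mp (kk M M') η η'' := by
  refine row_ind (P := fun {N} η η'' => ∑ η' : Row N, mp M η η' ⊗ₖ mp M' η' η''
    = mp (kk M M') η η'') ?_ ?_ η η''
  · intro η η'; simp [mp_zero]
  · intro N s s' η η' ih
    rw [sum_row_succ, mp_cons, ← ih, kk, Finset.sum_mul]
    refine Finset.sum_congr rfl fun t _ => ?_
    rw [Finset.mul_sum]
    refine Finset.sum_congr rfl fun τ _ => ?_
    rw [mp_cons, mp_cons, mul_kronecker_mul]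

lemma tmat_mul (M : Bool → Bool → Matrix D D R) (M' : Bool → Bool → Matrix D' D' R) (N : ℕ) :
    tmat M N * tmat M' N = tmat (kk M M') N := by
  ext η η''
  simp only [Matrix.mul_apply, tmat, ← mp_kk, trace_sum, trace_kronecker]

lemma mp_intertwine (K : Bool → Bool → Matrix D D R) (K' : Bool → Bool → Matrix D' D' R)
    (P : Matrix D' D R) (h : ∀ s s', P * K s s' = K' s s' * P) {N : ℕ} (η η' : Row N) :
    P * mp K η η' = mp K' η η' * P := by
  refine row_ind (P := fun {N} η η' => P * mp K η η' = mp K' η η' * P) ?_ ?_ η η'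
  · intro η η'; simp [mp_zero]
  · intro N s s' η η' ih
    rw [mp_cons, mp_cons, ← Matrix.mul_assoc, h, Matrix.mul_assoc, ih, Matrix.mul_assoc]

lemma tmat_conj (K : Bool → Bool → Matrix D D R) (K' : Bool → Bool → Matrix D' D' R)
    (P : Matrix D' D R) (Q : Matrix D D' R) (hQ : Q * P = 1) (hQ' : P * Q = 1)
    (h : ∀ s s', P * K s s' = K' s s' * P) (N : ℕ) :
    tmat K N = tmat K' N := by
  ext η η'
  have h1 := mp_intertwine K K' P h η η'
  have h2 : mp K η η' = Q * (mp K' η η' * P) := by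
    rw [← h1, ← Matrix.mul_assoc, hQ, Matrix.one_mul]
  simp only [tmat, h2]
  rw [trace_mul_comm, Matrix.mul_assoc, hQ', Matrix.mul_one]

lemma tmat_conj_det (K K' : Bool → Bool → Matrix D D R)
    (P : Matrix D D R) (h : ∀ s s', P * K s s' = K' s s' * P) (N : ℕ) (η η' : Row N) :
    P.det * tmat K N η η' = P.det * tmat K' N η η' := by
  have h1 := mp_intertwine K K' P h η η'
  have h2 : P.det • mp K η η' = P.adjugate * (mp K' η η' * P) := by
    rw [← h1, ← Matrix.mul_assoc, adjugate_mul, Matrix.smul_mul, Matrix.one_mul]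
  have h3 := congrArg trace h2
  rw [trace_mul_comm, Matrix.mul_assoc, mul_adjugate, Matrix.mul_smul, Matrix.mul_one] at h3
  simpa [tmat] using h3

lemma mp_blocks (A : Bool → Bool → Matrix D D R) (B : Bool → Bool → Matrix D D' R)
    (E : Bool → Bool → Matrix D' D' R) {N : ℕ} (η η' : Row N) :
    ∃ X, mp (fun s s' => fromBlocks (A s s') (B s s') 0 (E s s')) η η' =
      fromBlocks (mp A η η') X 0 (mp E η η') := by
  refine row_ind (P := fun {N} η η' => ∃ X, mp (fun s s' => fromBlocks (A s s') (B s s') 0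
    (E s s')) η η' = fromBlocks (mp A η η') X 0 (mp E η η')) ?_ ?_ η η'
  · intro η η'; exact ⟨0, by simp [mp_zero]⟩
  · rintro N s s' η η' ⟨X, ih⟩
    refine ⟨A s s' * X + B s s' * mp E η η', ?_⟩
    rw [mp_cons, mp_cons, mp_cons, ih, fromBlocks_multiply]
    simp

lemma tmat_blocks (A : Bool → Bool → Matrix D D R) (B : Bool → Bool → Matrix D D' R)
    (E : Bool → Bool → Matrix D' D' R) (N : ℕ) :
    tmat (fun s s' => fromBlocks (A s s') (B s s') 0 (E s s')) N = tmat A N + tmat E N := by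
  ext η η'
  obtain ⟨X, h⟩ := mp_blocks A B E η η'
  simp [tmat, h, trace, Fintype.sum_sum_type]

lemma mp_smul (c : R) (M : Bool → Bool → Matrix D D R) {N : ℕ} (η η' : Row N) :
    mp (fun s s' => c • M s s') η η' = c ^ N • mp M η η' := by
  refine row_ind (P := fun {N} η η' => mp (fun s s' => c • M s s') η η' = c ^ N • mp M η η')
    ?_ ?_ η η'
  · intro η η'; simp [mp_zero]
  · intro N s s' η η' ih
    rw [mp_cons, mp_cons, ih, smul_mul_smul_comm, pow_succ']

lemma tmat_smul (c : R) (M : Bool → Bool → Matrix D D R) (N : ℕ) :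
    tmat (fun s s' => c • M s s') N = c ^ N • tmat M N := by
  ext η η'; simp [tmat, mp_smul]

lemma mp_map {S : Type*} [CommRing S] (f : R →+* S) (M : Bool → Bool → Matrix D D R) {N : ℕ}
    (η η' : Row N) : mp (fun s s' => (M s s').map f) η η' = (mp M η η').map f := by
  refine row_ind (P := fun {N} η η' => mp (fun s s' => (M s s').map f) η η'
    = (mp M η η').map f) ?_ ?_ η η'
  · intro η η'; simp [mp_zero]
  · intro N s s' η η' ih
    rw [mp_cons, mp_cons, ih, Matrix.map_mul]

lemma tmat_map {S : Type*} [CommRing S] (f : R →+* S) (M : Bool → Bool → Matrix D D R) (N : ℕ) :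
    tmat (fun s s' => (M s s').map f) N = (tmat M N).map f := by
  ext η η'; simp [tmat, mp_map, trace, map_sum]

/-- six-vertex auxiliary matrices; cE/cW weights of the two `c` vertices -/
def wM (a b cE cW : R) (s s' : Bool) : Matrix Bool Bool R := fun α β =>
  if α = β then (if s = s' then (if α = s then a else b) else 0)
  else if s ≠ s' ∧ s' = α then (if α then cE else cW) else 0

/-- number of up arrows -/
def cnt {N : ℕ} (η : Row N) : ℕ := (Finset.univ.filter fun i => η i = true).card

lemma cnt_cons {N : ℕ} (s : Bool) (η : Row N) :
    cnt (Fin.cons s η : Row (N+1)) = (if s then 1 else 0) + cnt η := by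
  unfold cnt
  rw [Finset.card_filter, Finset.card_filter, Fin.sum_univ_succ]
  simp

lemma cnt_le {N : ℕ} (η : Row N) : cnt η ≤ N := by
  simpa [cnt] using Finset.card_filter_le (Finset.univ : Finset (Fin N)) _

lemma wM_ice {a b cE cW : R} {s s' α β : Bool} (h : wM a b cE cW s s' α β ≠ 0) :
    α.toNat + s.toNat = β.toNat + s'.toNat := by
  revert h; unfold wM; cases s <;> cases s' <;> cases α <;> cases β <;> simp

lemma mp_ice {a b cE cW : R} {N : ℕ} (η η' : Row N) : ∀ α β,
    mp (wM a b cE cW) η η' α β ≠ 0 → α.toNat + cnt η = β.toNat + cnt η' := by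
  refine row_ind (P := fun {N} η η' => ∀ α β,
    mp (wM a b cE cW) η η' α β ≠ 0 → α.toNat + cnt η = β.toNat + cnt η') ?_ ?_ η η'
  · intro η η' α β h
    rw [mp_zero] at h
    by_cases hab : α = β
    · subst hab; simp [cnt]
    · simp [hab] at h
  · intro N s s' η η' ih α β h
    rw [mp_cons, Matrix.mul_apply] at h
    obtain ⟨γ, -, hγ⟩ := Finset.exists_ne_zero_of_sum_ne_zero h
    have h1 := wM_ice (left_ne_zero_of_mul hγ)
    have h2 := ih γ β (right_ne_zero_of_mul hγ)
    rw [cnt_cons, cnt_cons]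
    cases s <;> cases s' <;> simp at * <;> omega

lemma tmat_ice {a b cE cW : R} {N : ℕ} {η η' : Row N} (h : tmat (wM a b cE cW) N η η' ≠ 0) :
    cnt η = cnt η' := by
  obtain ⟨γ, -, hγ⟩ := Finset.exists_ne_zero_of_sum_ne_zero
    (show ∑ γ, mp (wM a b cE cW) η η' γ γ ≠ 0 from h)
  have := mp_ice η η' γ γ hγ
  omega

/-- restriction to a sector -/
def sec {N : ℕ} (n : ℕ) (T : Matrix (Row N) (Row N) R) : Matrix (Row N) (Row N) R :=
  fun η η' => if cnt η = n ∧ cnt η' = n then T η η' else 0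

lemma sec_mul {N : ℕ} (n : ℕ) (T T' : Matrix (Row N) (Row N) R)
    (h : ∀ η η', T η η' ≠ 0 → cnt η = cnt η') : sec n T * sec n T' = sec n (T * T') := by
  ext η η''
  simp only [Matrix.mul_apply, sec]
  by_cases h1 : cnt η = n ∧ cnt η'' = n
  · rw [if_pos h1]
    refine Finset.sum_congr rfl fun τ _ => ?_
    by_cases h2 : T η τ = 0
    · simp [h2]
    · have := h _ _ h2
      rw [if_pos ⟨h1.1, by omega⟩, if_pos ⟨by omega, h1.2⟩]
  · rw [if_neg h1]
    refine Finset.sum_eq_zero fun τ _ => ?_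
    by_cases h3 : cnt η = n
    · have : cnt η'' ≠ n := fun h => h1 ⟨h3, h⟩
      simp [this]
    · simp [h3]

end mpo

section ybe
open Matrix
open scoped Kronecker
variable {R : Type*} [CommRing R]

/-- the intertwiner -/
def pY (A B c : R) : Matrix (Bool × Bool) (Bool × Bool) R := fun i j =>
  if i.1 = i.2 then (if i = j then A else 0)
  else if j.1 = j.2 then 0 else if i = j then c else B

lemma ybe_aux (a b a' b' c A B : R) (h1 : B * c + a * b' = a' * b) (h2 : B * b' + c * a = a' * A)
    (h3 : B * a + c * b' = b * A) (s s' : Bool) :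
    pY A B c * kk (wM a b c c) (wM a' b' c c) s s'
      = kk (wM a' b' c c) (wM a b c c) s s' * pY A B c := by
  cases s <;> cases s' <;> (
  ext ⟨i, j⟩ ⟨k, l⟩
  cases i <;> cases j <;> cases k <;> cases l <;>
    simp [Matrix.mul_apply, Fintype.sum_prod_type, kk, pY, wM] <;>
    first
      | done
      | linear_combination c * h1
      | linear_combination (-c) * h1
      | linear_combination c * h2
      | linear_combination (-c) * h2
      | linear_combination c * h3
      | linear_combination (-c) * h3
      | ring)

/-- spin-1 auxiliary matrices -/
def lM (a b' s o : R) (σ σ' : Bool) : Matrix (Option Bool) (Option Bool) R := fun i j =>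
  if i = j then (if σ = σ' then (match i with | none => -s | some α => if α = σ then -a else b')
    else 0)
  else if σ ≠ σ' ∧ (i = none ∧ j = some σ ∨ i = some σ' ∧ j = none) then
    (if σ then -o else o) else 0

/-- change of basis for fusion -/
def pF (g : R) : Matrix (Bool × Bool) (Unit ⊕ Option Bool) R := fun i j =>
  match j with
  | .inl _ => if i.1 = i.2 then 0 else 1
  | .inr none => if i = (true, false) then g else 0
  | .inr (some α) => if i = (α, α) then 1 else 0

/-- its inverse -/
def qF (g : R) : Matrix (Unit ⊕ Option Bool) (Bool × Bool) R := fun j i =>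
  match j with
  | .inl _ => if i = (false, true) then 1 else 0
  | .inr none => if i = (true, false) then g else if i = (false, true) then -g else 0
  | .inr (some α) => if i = (α, α) then 1 else 0

/-- upper right block -/
def bF (a b' c g : R) (σ σ' : Bool) : Matrix Unit (Option Bool) R := fun _ j =>
  match j with
  | none => if σ = true ∧ σ' = true then c ^ 2 * g else 0
  | some α => if α = σ ∧ σ ≠ σ' then (if α then c * b' else c * a) else 0

lemma fusion_aux (a b b' c g h : R) (hb : b' = a + g ^ 2 * b) (hab : a * b' = c ^ 2 - b ^ 2)
    (hg : g * h = 1) (s s' : Bool) :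
    pF g * fromBlocks (if s = s' then (a * b') • (1 : Matrix Unit Unit R) else 0)
        (bF a b' c g s s') 0 (b • lM a b' b (c * g) s s')
      = kk (wM a b c c) (wM (-b) b' c c) s s' * pF g := by
  cases s <;> cases s' <;> (
  ext ⟨i, j⟩ k
  rcases k with k | k | k
  · cases i <;> cases j <;>
      simp [Matrix.mul_apply, Fintype.sum_prod_type, Fintype.sum_sum_type, Fintype.sum_option, kk,
        pF, wM, lM, bF] <;>
      first | done | linear_combination hab | linear_combination (-1 : R) * hab | ring
  · cases i <;> cases j <;>
      simp [Matrix.mul_apply, Fintype.sum_prod_type, Fintype.sum_sum_type, Fintype.sum_option, kk,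
        pF, wM, lM, bF] <;>
      first | done | linear_combination g * hab | linear_combination (-g) * hab | ring
  · cases i <;> cases j <;> cases k <;>
      simp [Matrix.mul_apply, Fintype.sum_prod_type, Fintype.sum_sum_type, Fintype.sum_option, kk,
        pF, wM, lM, bF] <;>
      first | done | linear_combination c * hb | linear_combination (-c) * hb | ring)

lemma fusion_inv (g h : R) (hg : g * h = 1) : qF h * pF g = 1 ∧ pF g * qF h = 1 := by
  constructor
  · ext i j
    rcases i with i | i | i <;> rcases j with j | j | j <;>
    simp [Matrix.mul_apply, Fintype.sum_prod_type, pF, qF, Matrix.one_apply] <;>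
    first | done | linear_combination hg | (cases i <;> simp) | skip
    all_goals cases i <;> cases j <;> simp
  · ext ⟨i, j⟩ ⟨k, l⟩
    cases i <;> cases j <;> cases k <;> cases l <;>
    simp [Matrix.mul_apply, Fintype.sum_sum_type, Fintype.sum_option, pF, qF, Matrix.one_apply] <;>
    first | done | linear_combination hg | linear_combination (-1 : R) * hg

lemma mp_one_block (x : R) {N : ℕ} (η η' : Row N) :
    mp (fun s s' : Bool => if s = s' then x • (1 : Matrix Unit Unit R) else 0) η η' =
      if η = η' then x ^ N • (1 : Matrix Unit Unit R) else 0 := by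
  refine row_ind (P := fun {N} η η' =>
    mp (fun s s' : Bool => if s = s' then x • (1 : Matrix Unit Unit R) else 0) η η' =
      if η = η' then x ^ N • (1 : Matrix Unit Unit R) else 0) ?_ ?_ η η'
  · intro η η'; simp [mp_zero, Subsingleton.elim η η']
  · intro N s s' η η' ih
    rw [mp_cons, ih]
    by_cases h1 : s = s' <;> by_cases h2 : η = η' <;>
      simp [h1, h2, Fin.cons_inj, smul_smul, pow_succ]

lemma fusion (a b b' c g h : R) (hb : b' = a + g ^ 2 * b) (hab : a * b' = c ^ 2 - b ^ 2)
    (hg : g * h = 1) (N : ℕ) :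
    tmat (wM a b c c) N * tmat (wM (-b) b' c c) N
      = (a * b') ^ N • (1 : Matrix (Row N) (Row N) R) + b ^ N • tmat (lM a b' b (c * g)) N := by
  obtain ⟨h1, h2⟩ := fusion_inv g h hg
  rw [tmat_mul, ← tmat_conj _ _ (pF g) (qF h) h1 h2 (fusion_aux a b b' c g h hb hab hg), tmat_blocks,
    tmat_smul]
  congr 1
  ext η η'
  simp only [tmat, mp_one_block, Matrix.smul_apply, Matrix.one_apply]
  split_ifs <;> simp

lemma tmat_adj (a b c : R) [StarRing R] (N : ℕ) (η η' : Row N) :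
    tmat (wM (star b) (star a) (star c) (star c)) N η η' = star (tmat (wM a b c c) N η' η) := by
  have key : ∀ η η' : Row N, ∀ α β, mp (wM (star b) (star a) (star c) (star c)) η η' α β
      = star (mp (wM a b c c) η' η (!α) (!β)) := by
    intro η η'
    refine row_ind (P := fun {N} η η' => ∀ α β,
      mp (wM (star b) (star a) (star c) (star c)) η η' α β
      = star (mp (wM a b c c) η' η (!α) (!β))) ?_ ?_ η η'
    · intro η η' α β; cases α <;> cases β <;> simp [mp_zero]
    · intro N s s' η η' ih α β
      rw [mp_cons, mp_cons, Matrix.mul_apply, Matrix.mul_apply, star_sum,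
        ← Equiv.sum_comp Equiv.boolNot]
      refine Finset.sum_congr rfl fun γ _ => ?_
      rw [ih, star_mul, mul_comm]
      have : wM (star b) (star a) (star c) (star c) s s' α (Equiv.boolNot γ)
          = star (wM a b c c s' s (!α) γ) := by
        cases s <;> cases s' <;> cases α <;> cases γ <;> simp [wM]
      rw [this]; simp
  simp only [tmat, trace, diag, key, star_sum]
  exact Equiv.sum_comp Equiv.boolNot (fun α => star (mp (wM a b c c) η' η α α))

end ybe

section unit
open Matrix
variable {D : Type*} [Fintype D] [DecidableEq D]

lemma mp_unit (L : Bool → Bool → Matrix D D ℂ) (t : ℂ)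
    (h : ∀ σ τ α γ, ∑ β, ∑ σ', L σ σ' α β * star (L τ σ' γ β) = if σ = τ ∧ α = γ then t else 0)
    {N : ℕ} (η τ : Row N) : ∀ α γ,
    ∑ β, ∑ η', mp L η η' α β * star (mp L τ η' γ β) = if η = τ ∧ α = γ then t ^ N else 0 := by
  refine row_ind (P := fun {N} η τ => ∀ α γ,
    ∑ β, ∑ η', mp L η η' α β * star (mp L τ η' γ β) = if η = τ ∧ α = γ then t ^ N else 0)
    ?_ ?_ η τ
  · intro η τ α γ
    simp [mp_zero, Subsingleton.elim η τ, Matrix.one_apply, eq_comm]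
  · intro N s s' η τ ih α γ
    have : ∀ β, ∑ η' : Row (N+1), mp L (Fin.cons s η : Row (N+1)) η' α β *
        star (mp L (Fin.cons s' τ : Row (N+1)) η' γ β) =
        ∑ σ', ∑ κ, ∑ κ', L s σ' α κ * star (L s' σ' γ κ') *
          ∑ η', mp L η η' κ β * star (mp L τ η' κ' β) := by
      intro β
      rw [sum_row_succ]
      refine Finset.sum_congr rfl fun σ' _ => ?_
      simp only [mp_cons, Matrix.mul_apply, star_sum, Finset.sum_mul_sum, star_mul']
      simp only [Finset.mul_sum]
      rw [Finset.sum_comm]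
      refine Finset.sum_congr rfl fun κ _ => ?_
      rw [Finset.sum_comm]
      refine Finset.sum_congr rfl fun κ' _ => Finset.sum_congr rfl fun η' _ => ?_
      ring
    simp only [this]
    rw [Finset.sum_comm]
    have h2 : ∀ σ', ∑ β, ∑ κ, ∑ κ', L s σ' α κ * star (L s' σ' γ κ') *
          ∑ η', mp L η η' κ β * star (mp L τ η' κ' β) =
          if η = τ then ∑ κ, L s σ' α κ * star (L s' σ' γ κ) * t ^ N else 0 := by
      intro σ'
      rw [Finset.sum_comm]
      have : ∀ κ, ∑ β, ∑ κ', L s σ' α κ * star (L s' σ' γ κ') *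
          ∑ η', mp L η η' κ β * star (mp L τ η' κ' β) =
          if η = τ then L s σ' α κ * star (L s' σ' γ κ) * t ^ N else 0 := by
        intro κ
        rw [Finset.sum_comm]
        simp only [← Finset.mul_sum, ih]
        by_cases h : η = τ <;> simp [h]
      simp only [this]
      by_cases h : η = τ <;> simp [h]
    simp only [h2]
    by_cases h3 : η = τ
    · simp only [h3, if_true, Fin.cons_inj, and_true]
      rw [Finset.sum_comm]
      simp only [← Finset.sum_mul]
      rw [h]
      split_ifs <;> simp [pow_succ, mul_comm]
    · simp [h3, Fin.cons_inj]

end unit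

section ops
open Matrix

/-- entire functions bounded on vertical strips -/
def BE (f : ℂ → ℂ) : Prop :=
  Differentiable ℂ f ∧ ∀ R : ℝ, ∃ C : ℝ, ∀ u : ℂ, |u.re| ≤ R → ‖f u‖ ≤ C

lemma BE.const (c : ℂ) : BE fun _ => c := ⟨differentiable_const c, fun _ => ⟨‖c‖, fun _ _ => le_rfl⟩⟩

lemma BE.add {f g : ℂ → ℂ} (hf : BE f) (hg : BE g) : BE fun u => f u + g u := by
  refine ⟨hf.1.add hg.1, fun R => ?_⟩
  obtain ⟨C, hC⟩ := hf.2 R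
  obtain ⟨C', hC'⟩ := hg.2 R
  exact ⟨C + C', fun u hu => (norm_add_le _ _).trans (add_le_add (hC u hu) (hC' u hu))⟩

lemma BE.mul {f g : ℂ → ℂ} (hf : BE f) (hg : BE g) : BE fun u => f u * g u := by
  refine ⟨hf.1.mul hg.1, fun R => ?_⟩
  obtain ⟨C, hC⟩ := hf.2 R
  obtain ⟨C', hC'⟩ := hg.2 R
  refine ⟨C * C', fun u hu => ?_⟩
  rw [norm_mul]
  exact mul_le_mul (hC u hu) (hC' u hu) (norm_nonneg _) ((norm_nonneg _).trans (hC u hu))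

lemma BE.neg {f : ℂ → ℂ} (hf : BE f) : BE fun u => - f u := by
  refine ⟨hf.1.neg, fun R => ?_⟩
  obtain ⟨C, hC⟩ := hf.2 R
  exact ⟨C, fun u hu => by rw [norm_neg]; exact hC u hu⟩

lemma BE.sum {ι : Type*} (s : Finset ι) {f : ι → ℂ → ℂ} (hf : ∀ i, BE (f i)) :
    BE fun u => ∑ i ∈ s, f i u := by
  classical
  induction s using Finset.induction_on with
  | empty => simpa using BE.const 0
  | insert a s ha ih => simp only [Finset.sum_insert ha]; exact (hf a).add ih

lemma BE.sinh : BE Complex.sinh := by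
  refine ⟨Complex.differentiable_sinh, fun R => ⟨Real.exp R, fun u hu => ?_⟩⟩
  have h1 : ‖Complex.exp u‖ ≤ Real.exp R := by
    rw [Complex.norm_exp]; exact Real.exp_le_exp.2 ((le_abs_self _).trans hu)
  have h2 : ‖Complex.exp (-u)‖ ≤ Real.exp R := by
    rw [Complex.norm_exp]; exact Real.exp_le_exp.2 ((neg_le_abs _).trans hu)
  rw [Complex.sinh, norm_div]
  have := norm_sub_le (Complex.exp u) (Complex.exp (-u))
  simp only [RCLike.norm_ofNat]
  linarith

lemma BE.sub_left {f : ℂ → ℂ} (hf : BE f) (z : ℂ) : BE fun u => f (z - u) := by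
  refine ⟨hf.1.comp (differentiable_const z |>.sub differentiable_id), fun R => ?_⟩
  obtain ⟨C, hC⟩ := hf.2 (|z.re| + R)
  refine ⟨C, fun u hu => hC _ ?_⟩
  rw [Complex.sub_re]
  exact (abs_sub _ _).trans (by linarith)

lemma BE.add_right {f : ℂ → ℂ} (hf : BE f) (z : ℂ) : BE fun u => f (u + z) := by
  refine ⟨hf.1.comp (differentiable_id.add (differentiable_const z)), fun R => ?_⟩
  obtain ⟨C, hC⟩ := hf.2 (R + |z.re|)
  refine ⟨C, fun u hu => hC _ ?_⟩
  rw [Complex.add_re]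
  exact (abs_add_le _ _).trans (by linarith)

lemma BE_mp {D : Type*} [Fintype D] [DecidableEq D] (M : ℂ → Bool → Bool → Matrix D D ℂ)
    (h : ∀ s s' i j, BE fun u => M u s s' i j) {N : ℕ} (η η' : Row N) :
    ∀ i j, BE fun u => mp (M u) η η' i j := by
  refine row_ind (P := fun {N} η η' => ∀ i j, BE fun u => mp (M u) η η' i j) ?_ ?_ η η'
  · intro η η' i j; simp only [mp_zero]; exact BE.const _
  · intro N s s' η η' ih i j
    simp only [mp_cons, Matrix.mul_apply]
    exact BE.sum _ fun k => (h _ _ _ _).mul (ih _ _)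

lemma BE_tmat {D : Type*} [Fintype D] [DecidableEq D] (M : ℂ → Bool → Bool → Matrix D D ℂ)
    (h : ∀ s s' i j, BE fun u => M u s s' i j) {N : ℕ} (η η' : Row N) :
    BE fun u => tmat (M u) N η η' := BE.sum _ fun k => BE_mp M h η η' k k

/-- transfer matrix with trigonometric weights -/
def TT (ζ : ℝ) (N : ℕ) (u : ℂ) : Matrix (Row N) (Row N) ℂ :=
  tmat (wM (Complex.sinh (ζ - u)) (Complex.sinh u) (Complex.sinh ζ) (Complex.sinh ζ)) N

/-- fused transfer matrix -/
def XX (ζ : ℝ) (N : ℕ) (u : ℂ) : Matrix (Row N) (Row N) ℂ :=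
  tmat (lM (Complex.sinh (ζ - u)) (Complex.sinh (u + ζ)) (Complex.sinh u)
    (Complex.sinh ζ * (Real.sqrt (2 * Real.cosh ζ) : ℝ))) N

lemma BE_TT (ζ : ℝ) (N : ℕ) (η η' : Row N) : BE fun u => TT ζ N u η η' := by
  refine BE_tmat _ (fun s s' i j => ?_) η η'
  simp only [wM]
  split_ifs
  exacts [BE.sinh.sub_left _, BE.sinh, BE.const _, BE.const _, BE.const _, BE.const _]

lemma BE_XX (ζ : ℝ) (N : ℕ) (η η' : Row N) : BE fun u => XX ζ N u η η' := by
  refine BE_tmat _ (fun s s' i j => ?_) η η'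
  simp only [lM]
  split_ifs
  · rcases i with _ | i
    · exact BE.sinh.neg
    · dsimp only
      split_ifs
      exacts [(BE.sinh.sub_left _).neg, BE.sinh.add_right _]
  exacts [BE.const _, BE.const _, BE.const _, BE.const _]

lemma pY_det {R : Type*} [CommRing R] (A B c : R) :
    (pY A B c).det = A * A * (c * c - B * B) := by
  let e : Fin 2 ⊕ Fin 2 ≃ Bool × Bool :=
    { toFun := fun x => match x with
        | .inl 0 => (true, true) | .inl 1 => (false, false)
        | .inr 0 => (true, false) | .inr 1 => (false, true)
      invFun := fun x => match x with
        | (true, true) => .inl 0 | (false, false) => .inl 1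
        | (true, false) => .inr 0 | (false, true) => .inr 1
      left_inv := by decide
      right_inv := by decide }
  rw [← Matrix.det_submatrix_equiv_self e]
  have : (pY A B c).submatrix e e = fromBlocks !![A, 0; 0, A] 0 0 !![c, B; B, c] := by
    ext i j
    rcases i with i | i <;> rcases j with j | j <;> fin_cases i <;> fin_cases j <;>
      simp [pY, e]
  rw [this, det_fromBlocks_zero₂₁]
  simp [det_fin_two]

lemma TT_comm {ζ : ℝ} (hζ : ζ ≠ 0) (N : ℕ) (u v : ℂ) : TT ζ N u * TT ζ N v = TT ζ N v * TT ζ N u := by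
  ext η η'
  have key : ∀ u : ℂ, (pY (Complex.sinh (ζ - (u - v))) (Complex.sinh (u - v)) (Complex.sinh ζ)).det
      * ((TT ζ N u * TT ζ N v) η η' - (TT ζ N v * TT ζ N u) η η') = 0 := by
    intro u
    have := tmat_conj_det _ _ _ (ybe_aux (Complex.sinh (ζ - u)) (Complex.sinh u)
      (Complex.sinh (ζ - v)) (Complex.sinh v) (Complex.sinh ζ) (Complex.sinh (ζ - (u - v)))
      (Complex.sinh (u - v)) ?_ ?_ ?_) N η η'
    · rw [TT, TT, tmat_mul, tmat_mul, mul_sub, this, sub_self]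
    all_goals
      have h1 := Complex.cosh_sq u
      have h2 := Complex.cosh_sq v
      have h3 := Complex.cosh_sq (ζ : ℂ)
      simp only [Complex.sinh_sub, Complex.cosh_sub]
      generalize Complex.sinh u = s1 at *
      generalize Complex.sinh v = s2 at *
      generalize Complex.sinh (ζ : ℂ) = S at *
      generalize Complex.cosh u = c1 at *
      generalize Complex.cosh v = c2 at *
      generalize Complex.cosh (ζ : ℂ) = C at *
    · ring
    · linear_combination (-s1*s2*c2 + c1*s2^2) * h3 + (S*C*s1 - c1*S^2) * h2
    · linear_combination (-S*s2) * h1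
  have hB : BE fun u => (TT ζ N u * TT ζ N v) η η' - (TT ζ N v * TT ζ N u) η η' := by
    simp only [Matrix.mul_apply, sub_eq_add_neg]
    exact (BE.sum _ fun k => (BE_TT ζ N _ _).mul (BE.const _)).add
      (BE.sum _ fun k => (BE.const _).mul (BE_TT ζ N _ _)).neg
  have hd : Differentiable ℂ fun u : ℂ =>
      (pY (Complex.sinh (ζ - (u - v))) (Complex.sinh (u - v)) (Complex.sinh ζ)).det := by
    simp only [pY_det]
    fun_prop
  have hz := AnalyticOnNhd.eq_zero_or_eq_zero_of_mul_eq_zero (U := Set.univ)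
    (fun x _ => hd.analyticAt x) (fun x _ => hB.1.analyticAt x)
    (fun u _ => key u) isPreconnected_univ
  rcases hz with hz | hz
  · have := hz v trivial
    simp only [pY_det, sub_self, sub_zero, Complex.sinh_zero, mul_zero, mul_eq_zero, or_self] at this
    rw [← Complex.ofReal_sinh] at this
    exact absurd (by exact_mod_cast this) (Real.sinh_ne_zero.2 hζ)
  · exact sub_eq_zero.1 (hz u trivial)

lemma TT_fusion (ζ : ℝ) (N : ℕ) (u : ℂ) : TT ζ N u * TT ζ N (u + ζ) =
    (Complex.sinh (ζ - u) * Complex.sinh (u + ζ)) ^ N • (1 : Matrix (Row N) (Row N) ℂ)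
      + Complex.sinh u ^ N • XX ζ N u := by
  have hg0 : 0 < Real.sqrt (2 * Real.cosh ζ) := Real.sqrt_pos.2 (by have := Real.cosh_pos ζ; linarith)
  have hg2 : ((Real.sqrt (2 * Real.cosh ζ) : ℝ) : ℂ) ^ 2 = 2 * Complex.cosh ζ := by
    rw [← Complex.ofReal_pow, Real.sq_sqrt (by have := Real.cosh_pos ζ; linarith)]
    push_cast; rfl
  have := fusion (Complex.sinh (ζ - u)) (Complex.sinh u) (Complex.sinh (u + ζ)) (Complex.sinh ζ)
    ((Real.sqrt (2 * Real.cosh ζ) : ℝ) : ℂ) ((Real.sqrt (2 * Real.cosh ζ) : ℝ) : ℂ)⁻¹ ?_ ?_ ?_ N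
  · rw [XX, ← this, TT, TT]
    have e : (ζ : ℂ) - (u + ζ) = -u := by ring
    rw [e, Complex.sinh_neg]
  · rw [hg2, Complex.sinh_sub, Complex.sinh_add]; ring
  · have h1 := Complex.cosh_sq u
    have h3 := Complex.cosh_sq (ζ : ℂ)
    rw [Complex.sinh_sub, Complex.sinh_add]
    linear_combination (Complex.sinh ζ) ^ 2 * h1 - (Complex.sinh u) ^ 2 * h3
  · exact mul_inv_cancel₀ (by exact_mod_cast hg0.ne')

lemma TT_adj (ζ : ℝ) (N : ℕ) (u : ℂ) : (TT ζ N u)ᴴ = TT ζ N (ζ - star u) := by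
  ext η η'
  rw [conjTranspose_apply, TT, ← tmat_adj, TT]
  have h : ∀ z : ℂ, star (Complex.sinh z) = Complex.sinh (star z) := fun z => (Complex.sinh_conj z).symm
  have h2 : star (ζ : ℂ) = ζ := Complex.conj_ofReal ζ
  have h3 : (ζ : ℂ) - (ζ - star u) = star u := by ring
  rw [h, h, h, star_sub, h2, h3]

lemma nsq_sinh (x v : ℝ) :
    Complex.sinh (x + v * Complex.I) * star (Complex.sinh (x + v * Complex.I)) =
      ((Real.sinh x ^ 2 + Real.sin v ^ 2 : ℝ) : ℂ) := by
  have h : star (Complex.sinh (x + v * Complex.I)) = Complex.sinh (x - v * Complex.I) := by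
    rw [Complex.star_def, ← Complex.sinh_conj]; simp [sub_eq_add_neg]
  rw [h, Complex.sinh_add, Complex.sinh_sub, Complex.cosh_mul_I, Complex.sinh_mul_I]
  have h1 := Complex.cosh_sq (x : ℂ)
  have h2 := Complex.sin_sq_add_cos_sq (v : ℂ)
  push_cast
  linear_combination (Complex.sinh x ^ 2) * h2 + (-(Complex.sin v) ^ 2 * Complex.I ^ 2) * h1 - (Complex.sin v) ^ 2 * (Complex.sinh x ^ 2 + 1) * Complex.I_sq

lemma norm_sinh_sq (x v : ℝ) :
    ‖Complex.sinh (x + v * Complex.I)‖ ^ 2 = Real.sinh x ^ 2 + Real.sin v ^ 2 := by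
  have := nsq_sinh x v
  rw [Complex.star_def, Complex.mul_conj, Complex.normSq_eq_norm_sq] at this
  exact_mod_cast this

lemma XX_unit (ζ v : ℝ) : ∀ σ τ α γ, ∑ β, ∑ σ',
    lM (Complex.sinh (ζ - (-ζ / 2 + v * Complex.I))) (Complex.sinh ((-ζ / 2 + v * Complex.I) + ζ))
      (Complex.sinh (-ζ / 2 + v * Complex.I))
      (Complex.sinh ζ * (Real.sqrt (2 * Real.cosh ζ) : ℝ)) σ σ' α β *
    star (lM (Complex.sinh (ζ - (-ζ / 2 + v * Complex.I)))
      (Complex.sinh ((-ζ / 2 + v * Complex.I) + ζ))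
      (Complex.sinh (-ζ / 2 + v * Complex.I))
      (Complex.sinh ζ * (Real.sqrt (2 * Real.cosh ζ) : ℝ)) τ σ' γ β)
    = if σ = τ ∧ α = γ then ((Real.sinh (3 * ζ / 2) ^ 2 + Real.sin v ^ 2 : ℝ) : ℂ) else 0 := by
  have ha := nsq_sinh (3 * ζ / 2) (-v)
  have hb := nsq_sinh (ζ / 2) v
  have hs := nsq_sinh (-ζ / 2) v
  have e1 : (ζ : ℂ) - (-ζ / 2 + v * Complex.I) = ((3 * ζ / 2 : ℝ) : ℂ) + ((-v : ℝ) : ℂ) * Complex.I := by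
    push_cast; ring
  have e2 : (-ζ / 2 + v * Complex.I) + (ζ : ℂ) = ((ζ / 2 : ℝ) : ℂ) + (v : ℂ) * Complex.I := by
    push_cast; ring
  have e3 : (-ζ / 2 + v * Complex.I : ℂ) = ((-ζ / 2 : ℝ) : ℂ) + (v : ℂ) * Complex.I := by
    push_cast; ring
  have hrel : star (Complex.sinh ((-ζ / 2 : ℝ) + v * Complex.I)) = - Complex.sinh (((ζ / 2 : ℝ) : ℂ) + (v : ℂ) * Complex.I) := by
    rw [Complex.star_def, ← Complex.sinh_conj, ← Complex.sinh_neg]; congr 1; simp [Complex.conj_ofNat]; ring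
  have hg2 : ((Real.sqrt (2 * Real.cosh ζ) : ℝ) : ℂ) * ((Real.sqrt (2 * Real.cosh ζ) : ℝ) : ℂ) = 2 * Complex.cosh ζ := by
    rw [← Complex.ofReal_mul, Real.mul_self_sqrt (by have := Real.cosh_pos ζ; linarith)]
    push_cast; rfl
  rw [e1, e2, e3]
  have ho : star (Complex.sinh ζ * ((Real.sqrt (2 * Real.cosh ζ) : ℝ) : ℂ)) = Complex.sinh ζ * ((Real.sqrt (2 * Real.cosh ζ) : ℝ) : ℂ) := by
    rw [← Complex.ofReal_sinh, ← Complex.ofReal_mul]; exact Complex.conj_ofReal _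
  have hoo : (Complex.sinh ζ * ((Real.sqrt (2 * Real.cosh ζ) : ℝ) : ℂ)) * (Complex.sinh ζ * ((Real.sqrt (2 * Real.cosh ζ) : ℝ) : ℂ)) =
      ((Real.sinh (3 * ζ / 2) ^ 2 - Real.sinh (ζ / 2) ^ 2 : ℝ) : ℂ) := by
    have h3 : Real.sinh (3 * ζ / 2) ^ 2 - Real.sinh (ζ / 2) ^ 2 = 2 * Real.sinh ζ ^ 2 * Real.cosh ζ := by
      have e : 3 * ζ / 2 = 3 * (ζ / 2) := by ring
      have e' : ζ = 2 * (ζ / 2) := by ring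
      have q := Real.cosh_sq (ζ / 2)
      have q1 : Real.sinh ζ = 2 * Real.sinh (ζ / 2) * Real.cosh (ζ / 2) := by
        conv_lhs => rw [e', Real.sinh_two_mul]
      have q2 : Real.cosh ζ = Real.cosh (ζ / 2) ^ 2 + Real.sinh (ζ / 2) ^ 2 := by
        conv_lhs => rw [e', Real.cosh_two_mul]
      rw [e, Real.sinh_three_mul, q1, q2, mul_pow, q]; ring
    rw [h3]; push_cast
    linear_combination (Complex.sinh ζ) ^ 2 * hg2
  generalize Complex.sinh ζ * ((Real.sqrt (2 * Real.cosh ζ) : ℝ) : ℂ) = o at *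
  have hsb : Complex.sinh ((-ζ / 2 : ℝ) + v * Complex.I) = - star (Complex.sinh (((ζ / 2 : ℝ) : ℂ) + (v : ℂ) * Complex.I)) := by
    rw [← star_neg, ← hrel, star_star]
  rw [hsb]
  clear hsb hrel hs e1 e2 e3
  generalize Complex.sinh (((ζ / 2 : ℝ) : ℂ) + (v : ℂ) * Complex.I) = b at *
  generalize Complex.sinh (((3 * ζ / 2 : ℝ) : ℂ) + ((-v : ℝ) : ℂ) * Complex.I) = a at *
  simp only [Real.sin_neg, neg_sq] at ha
  push_cast at ha hb hoo ⊢
  intro σ τ α γ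
  cases σ <;> cases τ <;> rcases α with _ | α <;> rcases γ with _ | γ <;> (try cases α) <;>
    (try cases γ) <;>
    simp [lM, Fintype.sum_option, ho] <;> simp only [← Complex.star_def, ho] <;>
    first
      | done
      | linear_combination ha
      | linear_combination hb + hoo
      | ring

end ops

section eig
open Matrix
open scoped Matrix.Norms.L2Operator

lemma joint_eig {V ι : Type*} [AddCommGroup V] [Module ℂ V] [FiniteDimensional ℂ V]
    (f : ι → Module.End ℂ V) (hc : ∀ i j v, f i (f j v) = f j (f i v)) (W : Submodule ℂ V)
    (hW : W ≠ ⊥) (hinv : ∀ i, ∀ v ∈ W, f i v ∈ W) :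
    ∃ v ∈ W, v ≠ 0 ∧ ∀ i, ∃ μ : ℂ, f i v = μ • v := by
  obtain ⟨W0, ⟨hle, hne, hi⟩, hmin⟩ := (wellFounded_lt (α := Submodule ℂ V)).has_min
    {U | U ≤ W ∧ U ≠ ⊥ ∧ ∀ i, ∀ v ∈ U, f i v ∈ U} ⟨W, le_rfl, hW, hinv⟩
  obtain ⟨v, hv, hv0⟩ := (Submodule.ne_bot_iff _).1 hne
  refine ⟨v, hle hv, hv0, fun i => ?_⟩
  haveI : Nontrivial W0 := (Submodule.nontrivial_iff_ne_bot).2 hne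
  obtain ⟨μ, hμ⟩ := Module.End.exists_eigenvalue ((f i).restrict (hi i))
  obtain ⟨y, hy⟩ := hμ.exists_hasEigenvector
  have hy1 : f i y.1 = μ • y.1 := by
    have := congrArg Subtype.val hy.apply_eq_smul
    simpa using this
  have hy2 : y.1 ≠ 0 := fun h => hy.2 (Subtype.ext h)
  refine ⟨μ, ?_⟩
  have := hmin (W0 ⊓ (f i).eigenspace μ) ⟨inf_le_left.trans hle, ?_, ?_⟩
  · have h2 : W0 ⊓ (f i).eigenspace μ = W0 := eq_of_le_of_not_lt inf_le_left this
    have h3 : v ∈ W0 ⊓ (f i).eigenspace μ := h2.symm ▸ hv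
    exact Module.End.mem_eigenspace_iff.1 h3.2
  · exact (Submodule.ne_bot_iff _).2 ⟨y.1, ⟨y.2, Module.End.mem_eigenspace_iff.2 hy1⟩, hy2⟩
  · intro j w hw
    refine ⟨hi j w hw.1, Module.End.mem_eigenspace_iff.2 ?_⟩
    rw [hc, Module.End.mem_eigenspace_iff.1 hw.2, map_smul]

lemma dot_self {n : Type*} [Fintype n] (v : n → ℂ) :
    star v ⬝ᵥ v = ((∑ i, ‖v i‖ ^ 2 : ℝ) : ℂ) := by
  simp only [dotProduct, Pi.star_apply]
  push_cast
  refine Finset.sum_congr rfl fun i _ => ?_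
  rw [Complex.star_def, Complex.conj_mul']

/-- normal elements of commuting families have norming joint eigenvectors -/
lemma norm_eig {n ι : Type*} [Fintype n] [DecidableEq n] (A : ι → Matrix n n ℂ)
    (hc : ∀ i j, A i * A j = A j * A i) (i0 i1 : ι) (h1 : (A i0)ᴴ = A i1) (h0 : A i0 ≠ 0) :
    ∃ ψ : n → ℂ, star ψ ⬝ᵥ ψ = 1 ∧ ∃ Λ : ι → ℂ, (∀ i, A i *ᵥ ψ = Λ i • ψ) ∧
      (∀ i, ‖Λ i‖ ≤ ‖A i‖) ∧ ‖Λ i0‖ = ‖A i0‖ := by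
  haveI : Nontrivial (Matrix n n ℂ) := ⟨⟨_, _, h0⟩⟩
  have hn : IsStarNormal (A i0) := ⟨by
    rw [commute_iff_eq, star_eq_conjTranspose, h1]; exact hc _ _⟩
  obtain ⟨k, hk, hk2⟩ := spectrum.exists_nnnorm_eq_spectralRadius (A i0)
  rw [IsStarNormal.spectralRadius_eq_nnnorm] at hk2
  have hk3 : ‖k‖ = ‖A i0‖ := by
    have : ‖k‖₊ = ‖A i0‖₊ := by exact_mod_cast hk2
    exact congrArg NNReal.toReal this
  have hk4 : Module.End.HasEigenvalue (Matrix.toLin' (A i0)) k := by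
    rw [Module.End.hasEigenvalue_iff_mem_spectrum, Matrix.spectrum_toLin']; exact hk
  obtain ⟨v, hv, hv0, hv1⟩ := joint_eig (fun i => Matrix.toLin' (A i)) (fun i j v => by
    simp [Matrix.mulVec_mulVec, hc i j]) (Module.End.eigenspace (Matrix.toLin' (A i0)) k) hk4
    (fun i v hv => by
      rw [Module.End.mem_eigenspace_iff] at hv ⊢
      simp only [Matrix.toLin'_apply, Matrix.mulVec_mulVec] at hv ⊢
      rw [hc, ← Matrix.mulVec_mulVec, hv, Matrix.mulVec_smul])
  choose Λ hΛ using hv1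
  have hv3 : (0:ℝ) < ∑ i, ‖v i‖ ^ 2 := by
    obtain ⟨i, hi⟩ := Function.ne_iff.1 hv0
    exact Finset.sum_pos' (fun _ _ => by positivity) ⟨i, Finset.mem_univ _, by
      have := norm_pos_iff.2 hi; positivity⟩
  set r := Real.sqrt (∑ i, ‖v i‖ ^ 2) with hr
  have hr0 : 0 < r := Real.sqrt_pos.2 hv3
  refine ⟨(r : ℂ)⁻¹ • v, ?_, Λ, fun i => ?_, fun i => ?_, ?_⟩
  · rw [star_smul, smul_dotProduct, dotProduct_smul, dot_self, ← Real.sq_sqrt hv3.le, ← hr]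
    have : (r : ℂ) ≠ 0 := by exact_mod_cast hr0.ne'
    simp [Complex.star_def, Complex.conj_ofReal]
    field_simp
  · rw [Matrix.mulVec_smul, ← Matrix.toLin'_apply, hΛ, smul_comm]
  · apply spectrum.norm_le_norm_of_mem
    rw [← Matrix.spectrum_toLin', ← Module.End.hasEigenvalue_iff_mem_spectrum]
    exact Module.End.hasEigenvalue_of_hasEigenvector ⟨Module.End.mem_eigenspace_iff.2 (hΛ i), hv0⟩
  · have h5 := hΛ i0
    rw [Module.End.mem_eigenspace_iff.1 hv] at h5
    rw [← hk3, smul_left_injective ℂ hv0 h5]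

lemma unit_bound {D : Type*} [Fintype D] [DecidableEq D] (L : Bool → Bool → Matrix D D ℂ) (t : ℝ)
    (h : ∀ σ τ α γ, ∑ β, ∑ σ', L σ σ' α β * star (L τ σ' γ β) = if σ = τ ∧ α = γ then ((t ^ 2 : ℝ) : ℂ) else 0)
    (ht : 0 ≤ t) {N : ℕ} (ψ : Row N → ℂ) (hψ : star ψ ⬝ᵥ ψ = 1) :
    ‖star ψ ⬝ᵥ (tmat L N *ᵥ ψ)‖ ≤ Fintype.card D * t ^ N := by
  have hψ' : ∑ i, ‖ψ i‖ ^ 2 = 1 := by rw [dot_self] at hψ; exact_mod_cast hψ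
  let y : D → D → Row N → ℂ := fun α β η' => ∑ η, star (ψ η) * mp L η η' α β
  have h1 : star ψ ⬝ᵥ (tmat L N *ᵥ ψ) = ∑ α, ∑ η', y α α η' * ψ η' := by
    simp only [dotProduct, mulVec, Pi.star_apply, tmat, trace, diag, y, Finset.mul_sum, Finset.sum_mul]
    rw [Finset.sum_comm]
    conv_lhs => enter [2, η']; rw [Finset.sum_comm]
    rw [Finset.sum_comm]
    simp only [mul_assoc]
  have h2 : ∀ α, ∑ β, ∑ η', ‖y α β η'‖ ^ 2 = (t ^ N) ^ 2 := by
    intro α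
    have : ∑ β, ∑ η', y α β η' * star (y α β η') = ((t ^ 2 : ℝ) : ℂ) ^ N := by
      have e : ∀ β η', y α β η' * star (y α β η') = ∑ η, ∑ τ, star (ψ η) * ψ τ *
          (mp L η η' α β * star (mp L τ η' α β)) := by
        intro β η'
        simp only [y, star_sum, star_mul', star_star, Finset.sum_mul_sum]
        refine Finset.sum_congr rfl fun η _ => Finset.sum_congr rfl fun τ _ => by ring
      simp only [e]
      have e2 : ∀ β, ∑ η', ∑ η, ∑ τ, star (ψ η) * ψ τ * (mp L η η' α β * star (mp L τ η' α β)) =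
          ∑ η, ∑ τ, star (ψ η) * ψ τ * ∑ η', (mp L η η' α β * star (mp L τ η' α β)) := by
        intro β
        rw [Finset.sum_comm]
        refine Finset.sum_congr rfl fun η _ => ?_
        rw [Finset.sum_comm]
        simp only [Finset.mul_sum]
      simp only [e2]
      rw [Finset.sum_comm]
      have e3 : ∀ η, ∑ β, ∑ τ, star (ψ η) * ψ τ * ∑ η', (mp L η η' α β * star (mp L τ η' α β)) =
          star (ψ η) * ψ η * ((t ^ 2 : ℝ) : ℂ) ^ N := by
        intro η
        rw [Finset.sum_comm]
        simp only [← Finset.mul_sum, mp_unit L _ h]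
        simp
      simp only [e3, ← Finset.sum_mul]
      rw [show ∑ η, star (ψ η) * ψ η = 1 from hψ, one_mul]
    have e4 : ∀ β η', y α β η' * star (y α β η') = ((‖y α β η'‖ ^ 2 : ℝ) : ℂ) := by
      intro β η'
      rw [Complex.star_def, Complex.mul_conj']; push_cast; rfl
    simp only [e4] at this
    rw [← pow_mul, mul_comm N 2, pow_mul]
    exact_mod_cast this
  rw [h1]
  refine (norm_sum_le _ _).trans ((Finset.sum_le_card_nsmul _ _ (t ^ N) fun α _ => ?_).trans (by simp))
  have h3 : ‖∑ η', y α α η' * ψ η'‖ ≤ ∑ η', ‖y α α η'‖ * ‖ψ η'‖ := by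
    simpa only [norm_mul] using norm_sum_le Finset.univ (fun η' => y α α η' * ψ η')
  have h4 := Finset.sum_mul_sq_le_sq_mul_sq Finset.univ (fun η' => ‖y α α η'‖) (fun η' => ‖ψ η'‖)
  have h5 : ∑ η', ‖y α α η'‖ ^ 2 ≤ (t ^ N) ^ 2 := by
    rw [← h2 α]
    exact Finset.single_le_sum (f := fun β => ∑ η', ‖y α β η'‖ ^ 2)
      (fun β _ => Finset.sum_nonneg fun _ _ => by positivity) (Finset.mem_univ α)
  rw [hψ', mul_one] at h4
  exact h3.trans (abs_le_of_sq_le_sq' (h4.trans h5) (by positivity)).2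

lemma XX_bound (ζ v : ℝ) {N : ℕ} (ψ : Row N → ℂ) (hψ : star ψ ⬝ᵥ ψ = 1) :
    ‖star ψ ⬝ᵥ (XX ζ N (-ζ / 2 + v * Complex.I) *ᵥ ψ)‖ ≤ 3 * ‖Complex.sinh ((3 * ζ / 2 : ℝ) + v * Complex.I)‖ ^ N := by
  have h := unit_bound _ ‖Complex.sinh ((3 * ζ / 2 : ℝ) + v * Complex.I)‖ (by
    rw [norm_sinh_sq]; exact XX_unit ζ v) (norm_nonneg _) ψ hψ
  simpa [XX] using h

end eig

section spec
open Matrix Polynomial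
open scoped Matrix.Norms.L2Operator

lemma mp_coeff {D : Type*} [Fintype D] [DecidableEq D] (M : Bool → Bool → Matrix D D ℂ[X])
    (h : ∀ s s' i j, (M s s' i j).natDegree ≤ 1) {N : ℕ} (η η' : Row N) : ∀ i j,
    (mp M η η' i j).natDegree ≤ N ∧
    (mp M η η' i j).coeff N = mp (fun s s' => (M s s').map fun q => q.coeff 1) η η' i j := by
  refine row_ind (P := fun {N} η η' => ∀ i j,
    (mp M η η' i j).natDegree ≤ N ∧
    (mp M η η' i j).coeff N = mp (fun s s' => (M s s').map fun q => q.coeff 1) η η' i j) ?_ ?_ η η'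
  · intro η η' i j
    rw [mp_zero, mp_zero]
    by_cases hij : i = j <;> simp [hij, Matrix.one_apply]
  · intro N s s' η η' ih i j
    rw [mp_cons, mp_cons, Matrix.mul_apply, Matrix.mul_apply]
    refine ⟨natDegree_sum_le_of_forall_le _ _ fun k _ => ?_, ?_⟩
    · rw [add_comm]; exact natDegree_mul_le_of_le (h _ _ _ _) (ih _ _).1
    · rw [finset_sum_coeff]
      refine Finset.sum_congr rfl fun k _ => ?_
      rw [add_comm N 1, coeff_mul_add_eq_of_natDegree_le (h _ _ _ _) (ih _ _).1, (ih _ _).2]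
      rfl

lemma mp_tri (a b cE cW : ℂ) {N : ℕ} (η η' : Row N) :
    (cE = 0 ∨ cW = 0 → ∀ α, mp (wM a b cE cW) η η' α α =
      if η = η' then ∏ i, (if α = η i then a else b) else 0) ∧
    (cE = 0 → mp (wM a b cE cW) η η' true false = 0) ∧
    (cW = 0 → mp (wM a b cE cW) η η' false true = 0) := by
  refine row_ind (P := fun {N} η η' =>
    (cE = 0 ∨ cW = 0 → ∀ α, mp (wM a b cE cW) η η' α α =
      if η = η' then ∏ i, (if α = η i then a else b) else 0) ∧
    (cE = 0 → mp (wM a b cE cW) η η' true false = 0) ∧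
    (cW = 0 → mp (wM a b cE cW) η η' false true = 0)) ?_ ?_ η η'
  · intro η η'
    simp [mp_zero, Subsingleton.elim η η']
  · intro N s s' η η' ⟨i1, i2, i3⟩
    simp only [mp_cons, Matrix.mul_apply, Fintype.sum_bool, Fin.cons_inj, Fin.prod_univ_succ,
      Fin.cons_zero, Fin.cons_succ]
    refine ⟨fun h α => ?_, fun h => ?_, fun h => ?_⟩
    · rcases h with h | h
      · have j1 := i1 (.inl h) α
        have j2 := i2 h
        cases α <;> rw [j1] <;> cases s <;> cases s' <;> (simp only [h] at j2; simp [wM, h, j2])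
      · have j1 := i1 (.inr h) α
        have j2 := i3 h
        cases α <;> rw [j1] <;> cases s <;> cases s' <;> (simp only [h] at j2; simp [wM, h, j2])
    · rw [i2 h]; simp [wM, h]
    · rw [i3 h]; simp [wM, h]

lemma prod_cnt (a b : ℂ) {N : ℕ} (η : Row N) :
    ∏ i, (if true = η i then a else b) = a ^ cnt η * b ^ (N - cnt η) ∧
    ∏ i, (if false = η i then a else b) = b ^ cnt η * a ^ (N - cnt η) := by
  have h1 : (Finset.univ.filter fun i => ¬ η i = true).card = N - cnt η := by
    rw [Finset.filter_not, Finset.card_sdiff_of_subset (Finset.filter_subset _ _)]; simp [cnt]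
  constructor
  · have : ∀ i, (if true = η i then a else b) = if η i = true then a else b := fun i => by
      cases η i <;> simp
    simp only [this]
    rw [Finset.prod_ite, Finset.prod_const, Finset.prod_const, h1]; rfl
  · have : ∀ i, (if false = η i then a else b) = if η i = true then b else a := fun i => by
      cases η i <;> simp
    simp only [this]
    rw [Finset.prod_ite, Finset.prod_const, Finset.prod_const, h1]; rfl

lemma tmat_tri (a b cE cW : ℂ) (h : cE = 0 ∨ cW = 0) {N : ℕ} (n : ℕ) (ψ : Row N → ℂ)
    (hψ : star ψ ⬝ᵥ ψ = 1) (hs : ∀ η, ψ η ≠ 0 → cnt η = n) :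
    ∑ η, ∑ η', star (ψ η) * ψ η' * tmat (wM a b cE cW) N η η' =
      a ^ n * b ^ (N - n) + b ^ n * a ^ (N - n) := by
  have : ∀ η, ∑ η', star (ψ η) * ψ η' * tmat (wM a b cE cW) N η η' =
      star (ψ η) * ψ η * (a ^ n * b ^ (N - n) + b ^ n * a ^ (N - n)) := by
    intro η
    simp only [tmat, trace, diag, Fintype.sum_bool, (mp_tri a b cE cW _ _).1 h]
    rw [Finset.sum_eq_single η (fun η' _ hne => by simp [hne.symm]) (by simp)]
    by_cases h0 : ψ η = 0
    · simp [h0]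
    · simp only [if_true, (prod_cnt a b η).1, (prod_cnt a b η).2, hs η h0]
  simp only [this, ← Finset.sum_mul]
  rw [show ∑ η, star (ψ η) * ψ η = 1 from hψ, one_mul]

/-- spectral data of a joint eigenvector -/
structure Spec (ζ : ℝ) (N n : ℕ) (Λ x : ℂ → ℂ) (l : ℂ) (w : Fin N → ℂ) : Prop where
  beL : BE Λ
  beX : BE x
  fus : ∀ u, Λ u * Λ (u + ζ) = (Complex.sinh (ζ - u) * Complex.sinh (u + ζ)) ^ N + Complex.sinh u ^ N * x u
  adj : ∀ u, Λ (ζ - star u) = star (Λ u)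
  xb : ∀ v : ℝ, ‖x (-ζ / 2 + v * Complex.I)‖ ≤ 3 * ‖Complex.sinh ((3 * ζ / 2 : ℝ) + v * Complex.I)‖ ^ N
  pol : ∀ u, Complex.exp u ^ N * Λ u = l * ∏ i, (Complex.exp (2 * u) - w i)
  lead : ‖l‖ = (2:ℝ)⁻¹ ^ N * (Real.exp (-ζ * n) + Real.exp (-ζ * (N - n)))
  low : ‖l * ∏ i, w i‖ = (2:ℝ)⁻¹ ^ N * (Real.exp (ζ * n) + Real.exp (ζ * (N - n)))

/-- polynomial auxiliary matrices -/
def mP (ζ : ℝ) : Bool → Bool → Matrix Bool Bool ℂ[X] :=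
  wM (C (Complex.exp ζ / 2) - C (Complex.exp (-ζ) / 2) * X) (C (2⁻¹) * X - C (2⁻¹))
    (C (Complex.sinh ζ)) (C (Complex.sinh ζ) * X)

lemma mP_deg (ζ : ℝ) (s s' i j : Bool) : (mP ζ s s' i j).natDegree ≤ 1 := by
  unfold mP wM
  split_ifs <;> compute_degree <;> norm_num

lemma wM_map {R S : Type*} [CommRing R] [CommRing S] (f : R →+* S) (a b cE cW : R) :
    (fun s s' => (wM a b cE cW s s').map f) = wM (f a) (f b) (f cE) (f cW) := by
  funext s s'; ext i j; simp only [wM, Matrix.map_apply]; split_ifs <;> simp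

lemma mP_coeff1 (ζ : ℝ) : (fun s s' => (mP ζ s s').map fun q => q.coeff 1) =
    wM (-Complex.exp (-ζ) / 2) (2⁻¹) 0 (Complex.sinh ζ) := by
  funext s s'; ext i j
  simp only [mP, wM, Matrix.map_apply]
  split_ifs <;> simp [coeff_C] <;> ring

lemma mP_eval (ζ : ℝ) (u : ℂ) (N : ℕ) (η η' : Row N) :
    (tmat (mP ζ) N η η').eval (Complex.exp (2 * u)) = Complex.exp u ^ N * TT ζ N u η η' := by
  have h1 : (tmat (mP ζ) N η η').eval (Complex.exp (2 * u)) = tmat (wM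
      ((Complex.exp ζ - Complex.exp (-ζ) * Complex.exp (2 * u)) / 2) ((Complex.exp (2 * u) - 1) / 2)
      (Complex.sinh ζ) (Complex.sinh ζ * Complex.exp (2 * u))) N η η' := by
    have := congrFun₂ (tmat_map (evalRingHom (Complex.exp (2 * u))) (mP ζ) N) η η'
    rw [mP, wM_map] at this
    simp only [Matrix.map_apply, coe_evalRingHom] at this
    rw [mP, ← this]
    congr 2
    all_goals (simp; try ring)
  have h2 : Complex.exp (2 * u) = Complex.exp u * Complex.exp u := by rw [← Complex.exp_add]; ring_nf
  have h3 : Complex.exp u * Complex.exp (-u) = 1 := by rw [← Complex.exp_add]; simp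
  have h0 : Complex.exp u ≠ 0 := Complex.exp_ne_zero u
  rw [h1, TT]
  refine Eq.trans ?_ (congrFun₂ (tmat_smul (Complex.exp u) (wM (Complex.sinh (ζ - u)) (Complex.sinh u) (Complex.sinh ζ) (Complex.sinh ζ)) N) η η')
  symm
  refine congrFun₂ (tmat_conj _ _ (diagonal fun s => if s then 1 else Complex.exp u)
    (diagonal fun s => if s then 1 else (Complex.exp u)⁻¹) ?_ ?_ ?_ N) η η'
  · rw [diagonal_mul_diagonal, ← diagonal_one]; congr 1; funext s; cases s <;> simp [h0]
  · rw [diagonal_mul_diagonal, ← diagonal_one]; congr 1; funext s; cases s <;> simp [h0]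
  · intro s s'
    ext α β
    rw [diagonal_mul, mul_diagonal]
    have e1 : Complex.exp u * Complex.sinh u = (Complex.exp (2 * u) - 1) / 2 := by
      rw [Complex.sinh, h2]; linear_combination -h3 / 2
    have e2 : Complex.exp u * Complex.sinh (ζ - u) = (Complex.exp ζ - Complex.exp (-ζ) * Complex.exp (2 * u)) / 2 := by
      rw [Complex.sinh, h2, neg_sub, Complex.exp_sub, Complex.exp_sub, Complex.exp_neg]
      have := Complex.exp_ne_zero (ζ : ℂ)
      field_simp
    cases s <;> cases s' <;> cases α <;> cases β <;> simp [wM, ← e1, ← e2] <;> (try rw [h2]) <;> ring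

lemma ms_fin {s : Multiset ℂ} {N : ℕ} (h : s.card = N) : ∃ w : Fin N → ℂ, s = Finset.univ.val.map w := by
  induction s using Quotient.inductionOn with
  | h l =>
    simp at h; subst h
    exact ⟨l.get, by rw [Fin.univ_val_map, List.ofFn_get]; rfl⟩

lemma vec_poly (ζ : ℝ) {N n : ℕ} (hN : Even N) (hn : n ≤ N) (ψ : Row N → ℂ)
    (hψ : star ψ ⬝ᵥ ψ = 1) (hs : ∀ η, ψ η ≠ 0 → cnt η = n) (Λ : ℂ → ℂ)
    (hL2 : ∀ u, Λ u = ∑ η, ∑ η', star (ψ η) * ψ η' * TT ζ N u η η') : ∃ p : ℂ[X],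
    (∀ u, Complex.exp u ^ N * Λ u = p.eval (Complex.exp (2 * u))) ∧ p.natDegree ≤ N ∧
    ‖p.coeff N‖ = (2:ℝ)⁻¹ ^ N * (Real.exp (-ζ * n) + Real.exp (-ζ * (N - n))) ∧
    ‖p.eval 0‖ = (2:ℝ)⁻¹ ^ N * (Real.exp (ζ * n) + Real.exp (ζ * (N - n))) := by
  let p : ℂ[X] := ∑ η, ∑ η', C (star (ψ η) * ψ η') * tmat (mP ζ) N η η'
  have hp1 : ∀ u, Complex.exp u ^ N * Λ u = p.eval (Complex.exp (2 * u)) := by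
    intro u
    simp only [p, eval_finset_sum, eval_mul, eval_C, mP_eval, hL2, Finset.mul_sum]
    refine Finset.sum_congr rfl fun η _ => Finset.sum_congr rfl fun η' _ => by ring
  have hsg : ∀ X Y : ℝ, ‖(-(X:ℂ)) ^ n * (Y:ℂ) ^ (N - n) + (Y:ℂ) ^ n * (-(X:ℂ)) ^ (N - n)‖ =
      |X ^ n * Y ^ (N - n) + Y ^ n * X ^ (N - n)| := by
    intro X Y
    obtain ⟨m, hm⟩ := hN
    have e : ((-1:ℂ)) ^ (N - n) = (-1) ^ n := by
      rcases Nat.even_or_odd n with h | h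
      · rw [h.neg_one_pow, (show Even (N - n) from by rw [Nat.even_sub hn]; simp [h, hm]).neg_one_pow]
      · rw [h.neg_one_pow, (Nat.Even.sub_odd hn ⟨m, hm⟩ h).neg_one_pow]
    rw [neg_pow, neg_pow (X:ℂ) (N - n), e]
    rw [show (-1:ℂ) ^ n * (X:ℂ) ^ n * (Y:ℂ) ^ (N - n) + (Y:ℂ) ^ n * ((-1) ^ n * (X:ℂ) ^ (N - n)) =
      (-1) ^ n * ((X ^ n * Y ^ (N - n) + Y ^ n * X ^ (N - n) : ℝ) : ℂ) by push_cast; ring]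
    rw [norm_mul, Complex.norm_real]; simp
  have hco : p.coeff N = (-Complex.exp (-ζ) / 2) ^ n * (2⁻¹) ^ (N - n) + (2⁻¹) ^ n * (-Complex.exp (-ζ) / 2) ^ (N - n) := by
    rw [← tmat_tri _ _ 0 (Complex.sinh ζ) (.inl rfl) n ψ hψ hs]
    simp only [p, finset_sum_coeff, coeff_C_mul, tmat, trace, diag, (mp_coeff _ (mP_deg ζ) _ _ _ _).2,
      mP_coeff1]
  have hc0 : p.eval 0 = (Complex.exp ζ / 2) ^ n * (-2⁻¹) ^ (N - n) + (-2⁻¹) ^ n * (Complex.exp ζ / 2) ^ (N - n) := by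
    rw [← tmat_tri _ _ (Complex.sinh ζ) 0 (.inr rfl) n ψ hψ hs]
    have : ∀ η η', (tmat (mP ζ) N η η').eval 0 = tmat (wM (Complex.exp ζ / 2) (-2⁻¹) (Complex.sinh ζ) 0) N η η' := by
      intro η η'
      have := congrFun₂ (tmat_map (evalRingHom (0:ℂ)) (mP ζ) N) η η'
      rw [mP, wM_map] at this
      simp only [Matrix.map_apply, coe_evalRingHom] at this
      rw [mP, ← this]
      congr 2 <;> simp
    simp only [p, eval_finset_sum, eval_mul, eval_C, this]
  have hn1 : ‖p.coeff N‖ = (2:ℝ)⁻¹ ^ N * (Real.exp (-ζ * n) + Real.exp (-ζ * (N - n))) := by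
    have := hsg (Real.exp (-ζ) * 2⁻¹) 2⁻¹
    rw [hco, show -Complex.exp (-ζ) / 2 = -((Real.exp (-ζ) * 2⁻¹ : ℝ) : ℂ) by push_cast; ring,
      show (2⁻¹ : ℂ) = ((2⁻¹ : ℝ) : ℂ) by push_cast; rfl, this, abs_of_nonneg (by positivity)]
    rw [mul_pow, mul_pow, ← Real.exp_nat_mul, ← Real.exp_nat_mul, Nat.cast_sub hn]
    have e : (2:ℝ)⁻¹ ^ N = 2⁻¹ ^ n * 2⁻¹ ^ (N - n) := by rw [← pow_add]; congr 1; omega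
    rw [e, mul_comm (-ζ), mul_comm (-ζ)]; ring
  have hn2 : ‖p.eval 0‖ = (2:ℝ)⁻¹ ^ N * (Real.exp (ζ * n) + Real.exp (ζ * (N - n))) := by
    have := hsg 2⁻¹ (Real.exp ζ * 2⁻¹)
    rw [hc0, show Complex.exp ζ / 2 = ((Real.exp ζ * 2⁻¹ : ℝ) : ℂ) by push_cast; ring,
      show (2⁻¹ : ℂ) = ((2⁻¹ : ℝ) : ℂ) by push_cast; rfl, add_comm, this, abs_of_nonneg (by positivity)]
    rw [mul_pow, mul_pow, ← Real.exp_nat_mul, ← Real.exp_nat_mul, Nat.cast_sub hn]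
    have e : (2:ℝ)⁻¹ ^ N = 2⁻¹ ^ n * 2⁻¹ ^ (N - n) := by rw [← pow_add]; congr 1; omega
    rw [e, mul_comm ζ, mul_comm ζ]; ring
  have hd : ∀ η η', (tmat (mP ζ) N η η').natDegree ≤ N := by
    intro η η'
    rw [show tmat (mP ζ) N η η' = ∑ k, mp (mP ζ) η η' k k from rfl]
    exact natDegree_sum_le_of_forall_le _ _ fun k _ => (mp_coeff _ (mP_deg ζ) _ _ k k).1
  exact ⟨p, hp1, natDegree_sum_le_of_forall_le _ _ fun η _ => natDegree_sum_le_of_forall_le _ _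
    fun η' _ => (natDegree_C_mul_le _ _).trans (hd η η'), hn1, hn2⟩

lemma exists_spec {ζ : ℝ} (hζ : 0 < ζ) {N n : ℕ} (hN : Even N) (hn : n ≤ N) (u0 : ℝ)
    (h0 : sec n (TT ζ N u0) ≠ 0) : ∃ Λ x l w, Spec ζ N n Λ x l w ∧
      (∀ u, ‖Λ u‖ ≤ ‖sec n (TT ζ N u)‖) ∧ ‖Λ u0‖ = ‖sec n (TT ζ N u0)‖ := by
  have hice : ∀ u η η', TT ζ N u η η' ≠ 0 → cnt η = cnt η' := fun u η η' h => tmat_ice h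
  have hadj : ∀ u, (sec n (TT ζ N u))ᴴ = sec n (TT ζ N (ζ - star u)) := by
    intro u
    rw [← TT_adj]
    ext η η'
    simp only [conjTranspose_apply, sec, and_comm]
    split_ifs <;> simp
  obtain ⟨ψ, hψ, Λ, hΛ, hΛb, hΛ0⟩ := norm_eig (fun u : ℂ => sec n (TT ζ N u)) (fun u v => by
    rw [sec_mul _ _ _ (hice u), sec_mul _ _ _ (hice v), TT_comm hζ.ne']) (u0 : ℂ) (ζ - star (u0 : ℂ))
    (hadj _) h0
  have hne : Λ u0 ≠ 0 := by rw [← norm_ne_zero_iff, hΛ0, norm_ne_zero_iff]; exact h0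
  have hs : ∀ η, ψ η ≠ 0 → cnt η = n := by
    intro η h
    by_contra hc
    have h1 := congrFun (hΛ u0) η
    simp only [mulVec, dotProduct, sec, hc, false_and, if_false, zero_mul, Finset.sum_const_zero,
      Pi.smul_apply, smul_eq_mul] at h1
    exact (mul_ne_zero hne h) h1.symm
  have hΛ' : ∀ u, TT ζ N u *ᵥ ψ = Λ u • ψ := by
    intro u
    rw [← hΛ]
    funext η
    simp only [mulVec, dotProduct]
    refine Finset.sum_congr rfl fun η' _ => ?_
    by_cases h1 : ψ η' = 0
    · simp [h1]
    by_cases h2 : TT ζ N u η η' = 0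
    · simp [sec, h2]
    · rw [sec, if_pos ⟨(hice _ _ _ h2).trans (hs _ h1), hs _ h1⟩]
  have hL : ∀ u, Λ u = star ψ ⬝ᵥ (TT ζ N u *ᵥ ψ) := by
    intro u; rw [hΛ', dotProduct_smul, hψ]; simp
  have hL2 : ∀ u, Λ u = ∑ η, ∑ η', star (ψ η) * ψ η' * TT ζ N u η η' := by
    intro u; rw [hL]
    simp only [dotProduct, mulVec, Finset.mul_sum, Pi.star_apply]
    refine Finset.sum_congr rfl fun η _ => Finset.sum_congr rfl fun η' _ => by ring
  have hadj2 : ∀ u, Λ (ζ - star u) = star (Λ u) := by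
    intro u
    rw [hL2, hL2, ← TT_adj, star_sum, Finset.sum_comm]
    refine Finset.sum_congr rfl fun η _ => ?_
    rw [star_sum]
    refine Finset.sum_congr rfl fun η' _ => ?_
    rw [conjTranspose_apply]
    simp only [star_mul', star_star]; ring
  obtain ⟨p, hp1, hdg, hn1, hn2⟩ := vec_poly ζ hN hn ψ hψ hs Λ hL2
  have hpN : p.coeff N ≠ 0 := by rw [← norm_ne_zero_iff, hn1]; positivity
  have hdeg : p.natDegree = N := natDegree_eq_of_le_of_coeff_ne_zero hdg hpN
  have hspl := IsAlgClosed.splits p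
  obtain ⟨w, hw⟩ := ms_fin (s := p.roots) (N := N) (by rw [← hdeg]; exact hspl.natDegree_eq_card_roots.symm)
  have hev : ∀ z, p.eval z = p.coeff N * ∏ i, (z - w i) := by
    intro z
    conv_lhs => rw [hspl.eq_prod_roots]
    rw [eval_mul, eval_C, eval_multiset_prod, leadingCoeff, hdeg, hw]
    rw [Multiset.map_map, Multiset.map_map]
    simp only [Function.comp_def, eval_sub, eval_X, eval_C]
    rfl
  refine ⟨Λ, fun u => star ψ ⬝ᵥ (XX ζ N u *ᵥ ψ), p.coeff N, w, ⟨?_, ?_, ?_, hadj2, ?_, ?_, hn1, ?_⟩, hΛb, hΛ0⟩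
  · have : Λ = fun u => ∑ η, ∑ η', (star (ψ η) * ψ η') * TT ζ N u η η' := funext hL2
    rw [this]
    exact BE.sum _ fun η => BE.sum _ fun η' => (BE.const _).mul (BE_TT _ _ _ _)
  · simp only [dotProduct, mulVec]
    exact BE.sum _ fun η => (BE.const _).mul (BE.sum _ fun η' => (BE_XX _ _ _ _).mul (BE.const _))
  · intro u
    have h1 : star ψ ⬝ᵥ ((TT ζ N u * TT ζ N (u + ζ)) *ᵥ ψ) = Λ u * Λ (u + ζ) := by
      rw [← mulVec_mulVec, hΛ', mulVec_smul, hΛ', dotProduct_smul, dotProduct_smul, hψ]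
      simp [mul_comm]
    rw [← h1, TT_fusion, add_mulVec, smul_mulVec, smul_mulVec, one_mulVec, dotProduct_add,
      dotProduct_smul, dotProduct_smul, hψ]
    simp
  · intro v; exact XX_bound ζ v ψ hψ
  · intro u; rw [hp1, hev]
  · rw [← hn2, hev]
    simp only [zero_sub, Finset.prod_neg, norm_mul, norm_pow, norm_neg, norm_one, one_pow, one_mul]

end spec

section ana
open Set

lemma nsin (w : ℂ) : ‖Complex.sin w‖ ^ 2 = Real.sin w.re ^ 2 + Real.sinh w.im ^ 2 := by
  rw [← Complex.normSq_eq_norm_sq, Complex.sin_eq, Complex.normSq_apply]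
  simp only [← Complex.ofReal_sin, ← Complex.ofReal_cos, ← Complex.ofReal_sinh, ← Complex.ofReal_cosh,
    ← Complex.ofReal_mul, Complex.add_re, Complex.add_im, Complex.ofReal_re, Complex.ofReal_im,
    Complex.mul_re, Complex.mul_im, Complex.I_re, Complex.I_im]
  have h1 := Real.cosh_sq w.im
  have h2 := Real.sin_sq_add_cos_sq w.re
  ring_nf
  rw [h1, show Real.cos w.re ^ 2 = 1 - Real.sin w.re ^ 2 by linarith]
  ring

/-- closed vertical strip -/
def cs (ζ : ℝ) : Set ℂ := Complex.re ⁻¹' Icc 0 ζ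

/-- bounded near infinity in the strip -/
def BI (ζ : ℝ) (f : ℂ → ℂ) : Prop := ∃ R C : ℝ, ∀ u ∈ cs ζ, R ≤ |u.im| → ‖f u‖ ≤ C

lemma BI.mul {ζ : ℝ} {f g : ℂ → ℂ} (hf : BI ζ f) (hg : BI ζ g) : BI ζ fun u => f u * g u := by
  obtain ⟨R, C, h⟩ := hf
  obtain ⟨R', C', h'⟩ := hg
  refine ⟨max R R', C * C', fun u hu hR => ?_⟩
  have h1 := h u hu ((le_max_left _ _).trans hR)
  rw [norm_mul]
  exact mul_le_mul h1 (h' u hu ((le_max_right _ _).trans hR)) (norm_nonneg _) ((norm_nonneg _).trans h1)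

lemma PLb {ζ : ℝ} {f : ℂ → ℂ} {C : ℝ} (hd : DifferentiableOn ℂ f (cs ζ)) (hB : BI ζ f)
    (h0 : ∀ u : ℂ, u.re = 0 → ‖f u‖ ≤ C) (h1 : ∀ u : ℂ, u.re = ζ → ‖f u‖ ≤ C) (u : ℂ) (hu : u ∈ cs ζ) :
    ‖f u‖ ≤ C := by
  obtain ⟨R, C', h⟩ := hB
  have hcl : IsClosed (cs ζ) := isClosed_Icc.preimage Complex.continuous_re
  have hsub : Complex.re ⁻¹' Ioo 0 ζ ⊆ cs ζ := preimage_mono Ioo_subset_Icc_self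
  rcases eq_or_lt_of_le (hu.1.trans hu.2) with h2 | h2
  · exact h0 u (le_antisymm (hu.2.trans h2.symm.le) hu.1)
  refine PhragmenLindelof.vertical_strip (a := 0) (b := ζ)
    ((hd.mono (closure_minimal hsub hcl)).diffContOnCl) ⟨0, by simpa using div_pos Real.pi_pos h2, 0, ?_⟩ h0 h1 hu.1 hu.2
  refine Asymptotics.IsBigO.of_bound C' ?_
  have h3 : ∀ᶠ z : ℂ in comap (_root_.abs ∘ Complex.im) atTop, R ≤ |z.im| :=
    (tendsto_comap (f := _root_.abs ∘ Complex.im) (x := atTop)).eventually (eventually_ge_atTop R)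
  filter_upwards [mem_inf_of_left h3, mem_inf_of_right (mem_principal_self _)] with z hz hz2
  simpa using h z (hsub hz2) hz

/-- Blaschke factor of the strip -/
def bl (ζ : ℝ) (z u : ℂ) : ℂ :=
  Complex.sin ((π / (2 * ζ) : ℝ) * (u - z)) / Complex.sin ((π / (2 * ζ) : ℝ) * (u + star z))

lemma sin_ne {ζ : ℝ} (hζ : 0 < ζ) {w : ℂ} (h0 : 0 < w.re) (h1 : w.re < 2 * ζ) :
    Complex.sin ((π / (2 * ζ) : ℝ) * w) ≠ 0 := by
  intro h
  have h2 := nsin ((π / (2 * ζ) : ℝ) * w)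
  rw [h, Complex.re_ofReal_mul] at h2
  have h3 : 0 < Real.sin (π / (2 * ζ) * w.re) := by
    apply Real.sin_pos_of_pos_of_lt_pi (by positivity)
    calc π / (2 * ζ) * w.re < π / (2 * ζ) * (2 * ζ) := by gcongr
      _ = π := by field_simp
  rw [norm_zero] at h2
  nlinarith [sq_nonneg (Real.sinh ((π / (2 * ζ) : ℝ) * w : ℂ).im)]

lemma sin_ne' {ζ : ℝ} (hζ : 0 < ζ) {w : ℂ} (hw : w ≠ 0) (h1 : |w.re| < 2 * ζ) :
    Complex.sin ((π / (2 * ζ) : ℝ) * w) ≠ 0 := by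
  have h2 := abs_lt.1 h1
  rcases lt_trichotomy w.re 0 with h | h | h
  · have := sin_ne hζ (w := -w) (by simpa using h) (by simp; linarith)
    simpa [Complex.sin_neg] using this
  · intro h3
    have h4 := nsin ((π / (2 * ζ) : ℝ) * w)
    rw [h3, norm_zero, Complex.im_ofReal_mul] at h4
    have h5 : Real.sinh (π / (2 * ζ) * w.im) = 0 := by
      nlinarith [sq_nonneg (Real.sin ((π / (2 * ζ) : ℝ) * w : ℂ).re), sq_nonneg (Real.sinh (π / (2 * ζ) * w.im))]
    rw [Real.sinh_eq_zero] at h5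
    have : π / (2 * ζ) ≠ 0 := by positivity
    exact hw (Complex.ext h (by simpa [this] using h5))
  · exact sin_ne hζ h h2.2

/-- the factor `(e^{2u}-e^{2z})/bl` -/
lemma exB {ζ : ℝ} (hζ : 0 < ζ) {z : ℂ} (hz : 0 < z.re) (hz1 : z.re < ζ) : ∃ B : ℂ → ℂ,
    DifferentiableOn ℂ B (cs ζ) ∧ BI ζ B ∧
    (∀ u : ℂ, u.re = 0 → ‖B u‖ = ‖Complex.exp (2 * u) - Complex.exp (2 * z)‖) ∧
    (∀ u : ℂ, u.re = ζ → ‖B u‖ = ‖Complex.exp (2 * u) - Complex.exp (2 * z)‖) ∧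
    ∀ u ∈ cs ζ, B u * bl ζ z u = Complex.exp (2 * u) - Complex.exp (2 * z) := by
  set p : ℝ := π / (2 * ζ) with hp
  have hp0 : 0 < p := by positivity
  set h : ℂ → ℂ := fun u => Complex.exp (2 * u) - Complex.exp (2 * z) with hh
  set s : ℂ → ℂ := fun u => Complex.sin (p * (u - z)) with hs
  have dh : Differentiable ℂ h := by fun_prop
  have ds : Differentiable ℂ s := by fun_prop
  have dd : ∀ f : ℂ → ℂ, Differentiable ℂ f → Differentiable ℂ (dslope f z) := fun f hf =>
    differentiableOn_univ.1 ((Complex.differentiableOn_dslope univ_mem).2 hf.differentiableOn)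
  have hsz : s z = 0 := by simp [hs]
  have hhz : h z = 0 := by simp [hh]
  have h1 : ∀ u, (u - z) * dslope s z u = s u := fun u => by
    have := sub_smul_dslope s z u; rw [hsz] at this; simpa using this
  have h2 : ∀ u, (u - z) * dslope h z u = h u := fun u => by
    have := sub_smul_dslope h z u; rw [hhz] at this; simpa using this
  have hre : ∀ u ∈ cs ζ, |(u - z).re| < 2 * ζ := by
    intro u hu
    have := hu.1; have := hu.2
    rw [Complex.sub_re, abs_lt]; constructor <;> linarith
  have hsn : ∀ u ∈ cs ζ, u ≠ z → s u ≠ 0 := fun u hu huz => sin_ne' hζ (sub_ne_zero.2 huz) (hre u hu)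
  have hne : ∀ u ∈ cs ζ, dslope s z u ≠ 0 := by
    intro u hu h0
    by_cases huz : u = z
    · rw [huz, dslope_same] at h0
      have : HasDerivAt s (Complex.cos (p * (z - z)) * (p * 1)) z :=
        HasDerivAt.csin (((hasDerivAt_id z).sub_const z).const_mul (p:ℂ))
      rw [this.deriv] at h0
      simp [hp0.ne'] at h0
    · apply hsn u hu huz; rw [← h1, h0, mul_zero]
  have hq : ∀ u ∈ cs ζ, Complex.sin (p * (u + star z)) ≠ 0 := by
    intro u hu
    have := hu.1; have := hu.2
    apply sin_ne hζ <;> simp <;> linarith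
  have key : ∀ u ∈ cs ζ, dslope h z u / dslope s z u * s u = h u := by
    intro u hu
    rw [← h1, ← h2]; have := hne u hu; field_simp
  have hB : ∀ u ∈ cs ζ, u ≠ z → ‖dslope h z u / dslope s z u * Complex.sin (p * (u + star z))‖ ^ 2 * ‖s u‖ ^ 2
      = ‖h u‖ ^ 2 * ‖Complex.sin (p * (u + star z))‖ ^ 2 := by
    intro u hu huz
    rw [← key u hu]; simp only [norm_mul]; ring
  have him : ∀ u : ℂ, ((p:ℂ) * (u + star z)).im = p * (u - z).im := by
    intro u; rw [Complex.im_ofReal_mul]; simp; ring_nf; tauto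
  have hbd : ∀ u ∈ cs ζ, u ≠ z → Real.sin (p * (u - z).re) ^ 2 = Real.sin (p * (u + star z).re) ^ 2 →
      ‖dslope h z u / dslope s z u * Complex.sin (p * (u + star z))‖ = ‖h u‖ := by
    intro u hu huz hsq
    have e1 : ‖s u‖ ^ 2 = ‖Complex.sin (p * (u + star z))‖ ^ 2 := by
      rw [nsin, nsin, him]
      rw [Complex.re_ofReal_mul, Complex.re_ofReal_mul, Complex.im_ofReal_mul, hsq]
    have e2 := hB u hu huz
    rw [e1] at e2
    have e3 := mul_right_cancel₀ (by have := hq u hu; positivity) e2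
    exact (pow_left_inj₀ (norm_nonneg _) (norm_nonneg _) two_ne_zero).1 e3
  refine ⟨fun u => dslope h z u / dslope s z u * Complex.sin (p * (u + star z)), ?_, ?_, ?_, ?_, ?_⟩
  · have : Differentiable ℂ fun u => Complex.sin (p * (u + star z)) := by fun_prop
    exact (((dd h dh).differentiableOn).div (dd s ds).differentiableOn hne).mul this.differentiableOn
  · refine ⟨|z.im| + 1 / p + 1, 2 * (Real.exp (2 * ζ) + ‖Complex.exp (2 * z)‖), fun u hu hR => ?_⟩
    have huz : u ≠ z := by
      rintro rfl
      have : 0 < 1 / p := by positivity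
      linarith
    have e2 := hB u hu huz
    have e3 : 1 / p ≤ |(u - z).im| := by
      have := abs_sub_abs_le_abs_sub u.im z.im
      rw [Complex.sub_im]; linarith
    have e4 : 1 ≤ Real.sinh (p * (u - z).im) ^ 2 := by
      have e5 : 1 ≤ |p * (u - z).im| := by
        rw [abs_mul, abs_of_pos hp0]
        calc 1 = p * (1 / p) := by field_simp
          _ ≤ _ := by gcongr
      rw [← sq_abs, Real.abs_sinh]
      nlinarith [Real.self_le_sinh_iff.2 (abs_nonneg (p * (u - z).im))]
    have e6 : ‖h u‖ ≤ Real.exp (2 * ζ) + ‖Complex.exp (2 * z)‖ := by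
      refine (norm_sub_le _ _).trans ?_
      gcongr
      rw [Complex.norm_exp, Real.exp_le_exp]
      have := hu.2
      simp; linarith
    have e7 : ‖s u‖ ^ 2 ≥ Real.sinh (p * (u - z).im) ^ 2 := by
      rw [nsin, Complex.im_ofReal_mul]; nlinarith [sq_nonneg (Real.sin ((p:ℂ) * (u - z)).re)]
    have e8 : ‖Complex.sin (p * (u + star z))‖ ^ 2 ≤ 1 + Real.sinh (p * (u - z).im) ^ 2 := by
      rw [nsin, him]; nlinarith [Real.sin_sq_le_one ((p:ℂ) * (u + star z)).re]
    rw [← abs_of_nonneg (norm_nonneg (dslope h z u / _ * _))]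
    refine abs_le_of_sq_le_sq ?_ (by positivity)
    have e9 : ‖h u‖ ^ 2 ≤ (Real.exp (2 * ζ) + ‖Complex.exp (2 * z)‖) ^ 2 := by gcongr
    have e10 := mul_le_mul_of_nonneg_left e8 (sq_nonneg ‖h u‖)
    have e11 := mul_le_mul_of_nonneg_left e7 (sq_nonneg ‖dslope h z u / dslope s z u * Complex.sin (p * (u + star z))‖)
    have e12 : ‖dslope h z u / dslope s z u * Complex.sin (p * (u + star z))‖ ^ 2 * Real.sinh (p * (u - z).im) ^ 2
      ≤ (2 * ‖h u‖ ^ 2) * Real.sinh (p * (u - z).im) ^ 2 := by nlinarith [sq_nonneg ‖h u‖]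
    have e13 := le_of_mul_le_mul_right e12 (by linarith)
    nlinarith
  · intro u hu
    have hu' : u ∈ cs ζ := ⟨hu.ge, hu.le.trans hζ.le⟩
    refine hbd u hu' (by rintro rfl; linarith) ?_
    rw [Complex.sub_re, Complex.add_re, hu, Complex.star_def, Complex.conj_re, zero_sub, zero_add, mul_neg,
      Real.sin_neg, neg_sq]
  · intro u hu
    have hu' : u ∈ cs ζ := ⟨hζ.le.trans hu.ge, hu.le⟩
    refine hbd u hu' (by rintro rfl; linarith) ?_
    have hpz : p * ζ = π / 2 := by rw [hp]; field_simp
    rw [Complex.sub_re, Complex.add_re, hu, Complex.star_def, Complex.conj_re, mul_sub, mul_add, hpz,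
      Real.sin_pi_div_two_sub, add_comm, Real.sin_add_pi_div_two]
  · intro u hu
    have := hq u hu
    show _ * (s u / Complex.sin (p * (u + star z))) = h u
    rw [← key u hu]; field_simp

/-- Blaschke lemma -/
lemma BL {ζ : ℝ} (hζ : 0 < ζ) {ι : Type*} (I : Finset ι) (z : ι → ℂ) (hz : ∀ i ∈ I, 0 < (z i).re ∧ (z i).re < ζ)
    (C : ℝ) : ∀ (G : ℂ → ℂ) (hd : DifferentiableOn ℂ G (cs ζ)) (hB : BI ζ G)
    (h0 : ∀ u : ℂ, u.re = 0 ∨ u.re = ζ → ‖G u * ∏ i ∈ I, (Complex.exp (2 * u) - Complex.exp (2 * z i))‖ ≤ C),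
    ∀ u ∈ cs ζ, ‖G u * ∏ i ∈ I, (Complex.exp (2 * u) - Complex.exp (2 * z i))‖ ≤ C * ∏ i ∈ I, ‖bl ζ (z i) u‖ := by
  classical
  induction I using Finset.induction_on with
  | empty =>
    intro G hd hB h0 u hu
    simp only [Finset.prod_empty, mul_one] at h0 ⊢
    exact PLb hd hB (fun u hu => h0 u (Or.inl hu)) (fun u hu => h0 u (Or.inr hu)) u hu
  | insert i I hi ih =>
    intro G hd hB h0 u hu
    obtain ⟨B, b1, b2, b3, b4, b5⟩ := exB hζ (hz i (Finset.mem_insert_self _ _)).1 (hz i (Finset.mem_insert_self _ _)).2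
    have := ih (fun j hj => hz j (Finset.mem_insert_of_mem hj)) (fun u => G u * B u) (hd.mul b1) (hB.mul b2)
      (fun u hu => by
        have h2 := h0 u hu
        rw [Finset.prod_insert hi] at h2
        simp only [norm_mul] at h2 ⊢
        rw [hu.elim (b3 u) (b4 u), mul_assoc]; exact h2) u hu
    rw [Finset.prod_insert hi, Finset.prod_insert hi, ← b5 u hu]
    simp only [norm_mul] at this ⊢
    nlinarith [mul_le_mul_of_nonneg_right this (norm_nonneg (bl ζ (z i) u))]

/-- width constant -/
def BB (ζ : ℝ) : ℝ := Real.cosh (π ^ 2 / (4 * ζ)) ^ 2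

lemma BB_one (ζ : ℝ) : 1 ≤ BB ζ := one_le_pow₀ (Real.one_le_cosh _)

lemma bl_le {ζ : ℝ} (hζ : 0 < ζ) {z u : ℂ} (hz : 0 < z.re) (hz1 : z.re < ζ) (hu : u ∈ cs ζ)
    (him : |(u - z).im| ≤ π / 2) :
    ‖bl ζ z u‖ ^ 2 ≤ 1 - Real.sin (π * u.re / ζ) * Real.sin (π * z.re / ζ) / BB ζ := by
  set p : ℝ := π / (2 * ζ) with hp
  have hp0 : 0 < p := by positivity
  have hq : Complex.sin (p * (u + star z)) ≠ 0 := by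
    have := hu.1; have := hu.2
    apply sin_ne hζ <;> simp <;> linarith
  rw [bl, norm_div, div_pow]
  have e1 : ‖Complex.sin (p * (u + star z))‖ ^ 2 = Real.sin (p * (u.re + z.re)) ^ 2 + Real.sinh (p * (u - z).im) ^ 2 := by
    rw [nsin, Complex.re_ofReal_mul, Complex.im_ofReal_mul]; simp [sub_eq_add_neg]
  have e2 : ‖Complex.sin (p * (u - z))‖ ^ 2 = Real.sin (p * (u.re - z.re)) ^ 2 + Real.sinh (p * (u - z).im) ^ 2 := by
    rw [nsin, Complex.re_ofReal_mul, Complex.im_ofReal_mul]; simp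
  have e3 : Real.sin (p * (u.re + z.re)) ^ 2 - Real.sin (p * (u.re - z.re)) ^ 2
      = Real.sin (π * u.re / ζ) * Real.sin (π * z.re / ζ) := by
    rw [show π * u.re / ζ = 2 * (p * u.re) by rw [hp]; field_simp, show π * z.re / ζ = 2 * (p * z.re) by rw [hp]; field_simp,
      mul_add, mul_sub, Real.sin_add, Real.sin_sub, Real.sin_two_mul, Real.sin_two_mul]
    ring
  have e4 : ‖Complex.sin (p * (u + star z))‖ ^ 2 ≤ BB ζ := by
    rw [e1, BB, Real.cosh_sq (π ^ 2 / (4 * ζ))]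
    have h1 : Real.sinh (p * (u - z).im) ^ 2 ≤ Real.sinh (π ^ 2 / (4 * ζ)) ^ 2 := by
      rw [← sq_abs, Real.abs_sinh, abs_mul, abs_of_pos hp0]
      have : 0 ≤ Real.sinh (p * |(u - z).im|) := Real.sinh_nonneg_iff.2 (by positivity)
      gcongr
      rw [Real.sinh_le_sinh]
      calc p * |(u - z).im| ≤ p * (π / 2) := by gcongr
        _ = _ := by rw [hp]; field_simp; ring
    linarith [Real.sin_sq_le_one (p * (u.re + z.re))]
  have hs : 0 ≤ Real.sin (π * u.re / ζ) * Real.sin (π * z.re / ζ) := by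
    have := hu.1; have := hu.2; have := Real.pi_pos
    apply mul_nonneg <;> apply Real.sin_nonneg_of_nonneg_of_le_pi <;> first | positivity | skip
    · rw [div_le_iff₀ hζ]; gcongr
    · rw [div_le_iff₀ hζ]; gcongr
  have hpos : 0 < ‖Complex.sin (p * (u + star z))‖ ^ 2 := by positivity
  rw [show ‖Complex.sin (p * (u - z))‖ ^ 2 / ‖Complex.sin (p * (u + star z))‖ ^ 2 =
    1 - Real.sin (π * u.re / ζ) * Real.sin (π * z.re / ζ) / ‖Complex.sin (p * (u + star z))‖ ^ 2 by
      rw [← e3, e2, eq_sub_iff_add_eq]; field_simp; rw [e1]; ring]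
  gcongr

end ana

section ana2
open Set

lemma nsinh (w : ℂ) : ‖Complex.sinh w‖ ^ 2 = Real.sinh w.re ^ 2 + Real.sin w.im ^ 2 := by
  rw [← norm_sinh_sq, Complex.re_add_im]

lemma nsinh_eq {w w' : ℂ} (h : w.re = w'.re) (h2 : w.im = w'.im ∨ w.im = -w'.im) :
    ‖Complex.sinh w‖ = ‖Complex.sinh w'‖ := by
  rw [← pow_left_inj₀ (norm_nonneg _) (norm_nonneg _) two_ne_zero, nsinh, nsinh, h]
  rcases h2 with h2 | h2 <;> simp [h2]

lemma nsinh_neg {w w' : ℂ} (h : w.re = -w'.re) (h2 : w.im = w'.im ∨ w.im = -w'.im) :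
    ‖Complex.sinh w‖ = ‖Complex.sinh w'‖ := by
  rw [← pow_left_inj₀ (norm_nonneg _) (norm_nonneg _) two_ne_zero, nsinh, nsinh, h]
  rcases h2 with h2 | h2 <;> simp [h2]

lemma nsinh_ge {w : ℂ} {r : ℝ} (hr : 0 ≤ r) (h : r ≤ w.re) : Real.sinh r ≤ ‖Complex.sinh w‖ := by
  refine abs_le_of_sq_le_sq' ?_ (norm_nonneg _) |>.2
  rw [nsinh]
  have h1 := Real.sinh_le_sinh.2 h
  have h2 := Real.sinh_nonneg_iff.2 hr
  nlinarith [sq_nonneg (Real.sin w.im)]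

/-- quantum determinant -/
def ph (ζ : ℝ) (N : ℕ) (u : ℂ) : ℂ := (Complex.sinh (ζ - u) * Complex.sinh (u + ζ)) ^ N

lemma ph_ge {ζ : ℝ} (hζ : 0 < ζ) (N : ℕ) {u : ℂ} (hu : |u.re| ≤ ζ / 2) :
    (Real.sinh (ζ / 2) ^ 2) ^ N ≤ ‖ph ζ N u‖ := by
  have h := abs_le.1 hu
  rw [ph, norm_pow, norm_mul]
  have h1 := nsinh_ge (w := ζ - u) (r := ζ / 2) (by positivity) (by simp; linarith)
  have h2 := nsinh_ge (w := u + ζ) (r := ζ / 2) (by positivity) (by simp; linarith)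
  have h3 := Real.sinh_nonneg_iff.2 (half_pos hζ).le
  rw [sq]
  gcongr

lemma ph_ne {ζ : ℝ} (hζ : 0 < ζ) (N : ℕ) {u : ℂ} (hu : |u.re| ≤ ζ / 2) : ph ζ N u ≠ 0 := by
  have := ph_ge hζ N hu
  have h3 := Real.sinh_pos_iff.2 (half_pos hζ)
  exact norm_pos_iff.1 (lt_of_lt_of_le (by positivity) this)

variable {ζ : ℝ} {N n : ℕ} {Λ x : ℂ → ℂ} {l : ℂ} {w : Fin N → ℂ}

lemma Spec.ysym (S : Spec ζ N n Λ x l w) (u : ℂ) :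
    ‖Complex.sinh (-star u) ^ N * x (-star u)‖ = ‖Complex.sinh u ^ N * x u‖ := by
  have h1 := S.fus u
  have h2 := S.fus (-star u)
  have h3 := S.adj u
  have h4 := S.adj (u + ζ)
  rw [show (ζ:ℂ) - star (u + ζ) = -star u by simp] at h4
  rw [show -star u + (ζ:ℂ) = ζ - star u by ring, h3, h4] at h2
  have h5 : Complex.sinh (-star u) ^ N * x (-star u) = star (Complex.sinh u ^ N * x u) := by
    rw [← add_right_inj, ← h2, ← star_mul, h1, star_add]
    congr 1
    simp only [star_pow, star_mul', Complex.star_def, ← Complex.sinh_conj, map_sub, map_add, Complex.conj_ofReal]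
    congr 1; rw [mul_comm]; congr 1 <;> ring_nf
  rw [h5, norm_star]

lemma Spec.ybd (S : Spec ζ N n Λ x l w) (v : ℝ) :
    ‖Complex.sinh (-ζ / 2 + v * Complex.I) ^ N * x (-ζ / 2 + v * Complex.I)‖ ≤ 3 * ‖ph ζ N (-ζ / 2 + v * Complex.I)‖ := by
  rw [norm_mul, norm_pow, ph, norm_pow, norm_mul, mul_pow]
  have e1 : ‖Complex.sinh (-ζ / 2 + v * Complex.I)‖ = ‖Complex.sinh (-ζ / 2 + v * Complex.I + ζ)‖ := by
    apply nsinh_neg <;> simp <;> ring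
  have e2 : ‖Complex.sinh ((3 * ζ / 2 : ℝ) + v * Complex.I)‖ = ‖Complex.sinh (ζ - (-ζ / 2 + v * Complex.I))‖ := by
    apply nsinh_eq <;> simp <;> ring
  have := S.xb v
  rw [e2] at this
  rw [e1]
  nlinarith [mul_le_mul_of_nonneg_left this (pow_nonneg (norm_nonneg (Complex.sinh (-ζ / 2 + v * Complex.I + ζ))) N)]

lemma BE.bd {f : ℂ → ℂ} (h : BE f) (a b : ℝ) : ∃ C, ∀ u : ℂ, a ≤ u.re → u.re ≤ b → ‖f u‖ ≤ C := by
  obtain ⟨C, hC⟩ := h.2 (max |a| |b|)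
  exact ⟨C, fun u h1 h2 => hC u (abs_le_max_abs_abs h1 h2)⟩

lemma Spec.Ysq (hζ : 0 < ζ) (S : Spec ζ N n Λ x l w) {u : ℂ} (hu : |u.re| ≤ ζ / 2) (hv : |u.im| ≤ π / 2) :
    ‖Complex.sinh u ^ N * x u‖ ^ 2 ≤ 9 * ‖ph ζ N u‖ ^ 2 * (1 - Real.cos (π * u.re / ζ) / BB ζ) ^ N := by
  set G : ℂ → ℂ := fun u => x (u - (ζ / 2 : ℝ)) / (ph ζ N (u - (ζ / 2 : ℝ)) * (2 * Complex.exp (u + (ζ / 2 : ℝ))) ^ N) with hG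
  have hre : ∀ u ∈ cs ζ, |(u - (ζ / 2 : ℝ)).re| ≤ ζ / 2 := by
    intro u hu
    have := hu.1; have := hu.2
    rw [Complex.sub_re, Complex.ofReal_re, abs_le]; constructor <;> linarith
  have hG2 : ∀ u ∈ cs ζ, G u * ∏ i : Fin N, (Complex.exp (2 * u) - Complex.exp (2 * (ζ / 2 : ℝ))) =
      Complex.sinh (u - (ζ / 2 : ℝ)) ^ N * x (u - (ζ / 2 : ℝ)) / ph ζ N (u - (ζ / 2 : ℝ)) := by
    intro u hu
    have h1 : Complex.exp (2 * u) - Complex.exp (2 * (ζ / 2 : ℝ)) =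
        (2 * Complex.exp (u + (ζ / 2 : ℝ))) * Complex.sinh (u - (ζ / 2 : ℝ)) := by
      rw [Complex.sinh]
      have : Complex.exp (u + (ζ / 2 : ℝ)) * Complex.exp (u - (ζ / 2 : ℝ)) = Complex.exp (2 * u) := by
        rw [← Complex.exp_add]; ring_nf
      have h3 : Complex.exp (u + (ζ / 2 : ℝ)) * Complex.exp (-(u - (ζ / 2 : ℝ))) = Complex.exp (2 * (ζ / 2 : ℝ)) := by
        rw [← Complex.exp_add]; ring_nf
      rw [← this, ← h3]; ring
    rw [Finset.prod_const, Finset.card_univ, Fintype.card_fin, h1, hG, mul_pow]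
    have h2 := ph_ne hζ N (hre u hu)
    have h3 : (2 * Complex.exp (u + (ζ / 2 : ℝ))) ^ N ≠ 0 := pow_ne_zero _ (mul_ne_zero two_ne_zero (Complex.exp_ne_zero _))
    field_simp
  have hs := Real.sinh_pos_iff.2 (half_pos hζ)
  obtain ⟨Cx, hCx⟩ := S.beX.bd (-ζ / 2) (ζ / 2)
  have key := BL hζ (Finset.univ : Finset (Fin N)) (fun _ => ((ζ / 2 : ℝ) : ℂ)) (fun _ _ => ⟨by simpa using hζ, by simpa using hζ⟩) 3 G
    (by
      refine DifferentiableOn.div ?_ ?_ ?_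
      · exact (S.beX.1.comp (differentiable_id.sub_const _)).differentiableOn
      · unfold ph; fun_prop
      · intro u hu
        exact mul_ne_zero (ph_ne hζ N (hre u hu)) (pow_ne_zero _ (mul_ne_zero two_ne_zero (Complex.exp_ne_zero _))))
    ⟨0, Cx / ((Real.sinh (ζ / 2) ^ 2) ^ N * 1), fun u hu _ => by
      have h1 := abs_le.1 (hre u hu)
      have h2 := hCx (u - (ζ / 2 : ℝ)) (by linarith) (by linarith)
      simp only [hG, norm_div, norm_mul, norm_pow]
      have h3 := ph_ge hζ N (hre u hu)
      have h4 : (1:ℝ) ≤ (‖(2:ℂ)‖ * ‖Complex.exp (u + (ζ / 2 : ℝ))‖) ^ N := by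
        apply one_le_pow₀
        rw [Complex.norm_exp, Complex.norm_ofNat]
        have : 1 ≤ Real.exp (u + (ζ / 2 : ℝ)).re := Real.one_le_exp (by simp; have := hu.1; linarith)
        linarith
      have h5 := (norm_nonneg _).trans h2
      gcongr⟩
    (fun u hu => by
      have hu' : u ∈ cs ζ := by rcases hu with hu | hu <;> simp [cs, hu, hζ.le]
      rw [hG2 u hu', norm_div, div_le_iff₀ (norm_pos_iff.2 (ph_ne hζ N (hre u hu')))]
      rcases hu with hu | hu
      · have := S.ybd u.im
        rwa [show -(ζ:ℂ) / 2 + u.im * Complex.I = u - (ζ / 2 : ℝ) by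
          apply Complex.ext <;> simp [hu]; ring] at this
      · have := S.ybd u.im
        rw [show -(ζ:ℂ) / 2 + u.im * Complex.I = -star (u - (ζ / 2 : ℝ)) by
          apply Complex.ext <;> simp [hu]; ring, S.ysym] at this
        refine this.trans (le_of_eq ?_)
        congr 1
        rw [ph, ph, norm_pow, norm_pow, norm_mul, norm_mul, mul_comm]
        congr 2 <;> apply nsinh_eq <;> simp <;> ring)
    (u + (ζ / 2 : ℝ)) ⟨by have := abs_le.1 hu; simp; linarith, by have := abs_le.1 hu; simp; linarith⟩
  have hu' : u + (ζ / 2 : ℝ) ∈ cs ζ := ⟨by have := abs_le.1 hu; simp; linarith, by have := abs_le.1 hu; simp; linarith⟩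
  have hb := bl_le hζ (z := (ζ / 2 : ℝ)) (u := u + (ζ / 2 : ℝ)) (by simpa using hζ) (by simpa using hζ) hu' (by simpa using hv)
  rw [hG2 _ hu', add_sub_cancel_right, norm_div, div_le_iff₀ (norm_pos_iff.2 (ph_ne hζ N hu)), Finset.prod_const,
    Finset.card_univ, Fintype.card_fin] at key
  have hc : Real.sin (π * (u + (ζ / 2 : ℝ)).re / ζ) * Real.sin (π * (((ζ / 2 : ℝ) : ℂ)).re / ζ) = Real.cos (π * u.re / ζ) := by
    rw [Complex.add_re, Complex.ofReal_re, show π * (u.re + ζ / 2) / ζ = π * u.re / ζ + π / 2 by field_simp,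
      show π * (ζ / 2) / ζ = π / 2 by field_simp, Real.sin_add_pi_div_two, Real.sin_pi_div_two, mul_one]
  rw [hc] at hb
  calc _ ≤ (3 * ‖bl ζ (ζ / 2 : ℝ) (u + (ζ / 2 : ℝ))‖ ^ N * ‖ph ζ N u‖) ^ 2 := by gcongr
    _ = 9 * ‖ph ζ N u‖ ^ 2 * (‖bl ζ (ζ / 2 : ℝ) (u + (ζ / 2 : ℝ))‖ ^ 2) ^ N := by ring
    _ ≤ _ := by gcongr

lemma Spec.per (S : Spec ζ N n Λ x l w) (u : ℂ) (k : ℤ) : ‖Λ (u - k * (π * Complex.I))‖ = ‖Λ u‖ := by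
  have h1 := S.pol (u - k * (π * Complex.I))
  have h2 := S.pol u
  rw [show 2 * (u - k * (π * Complex.I)) = 2 * u - k * (2 * π * Complex.I) by ring, Complex.exp_periodic.sub_int_mul_eq k, ← h2] at h1
  have h3 := congrArg norm h1
  rw [norm_mul, norm_mul, norm_pow, norm_pow, Complex.norm_exp, Complex.norm_exp] at h3
  have : (u - k * (π * Complex.I)).re = u.re := by simp
  rw [this] at h3
  exact mul_left_cancel₀ (by positivity) h3

lemma exk (v : ℝ) : ∃ k : ℤ, |v - k * π| ≤ π / 2 := by
  refine ⟨round (v / π), ?_⟩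
  have h := abs_sub_round (v / π)
  have hp := Real.pi_pos
  rw [show v - round (v / π) * π = (v / π - round (v / π)) * π by field_simp, abs_mul, abs_of_pos hp]
  nlinarith

/-- size of the correction -/
def sY (ζ : ℝ) (N : ℕ) : ℝ := 3 * Real.sqrt ((1 - 1 / BB ζ) ^ N)

lemma BB01 (ζ : ℝ) : 0 ≤ 1 - 1 / BB ζ ∧ 1 - 1 / BB ζ < 1 := by
  have := BB_one ζ
  have h1 : 0 < 1 / BB ζ := by positivity
  have h2 : 1 / BB ζ ≤ 1 := by rw [div_le_one (by linarith)]; exact this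
  constructor <;> linarith

lemma sY0 (ζ : ℝ) (N : ℕ) : 0 ≤ sY ζ N ∧ sY ζ N ≤ 3 := by
  have := BB01 ζ
  have h1 : (1 - 1 / BB ζ) ^ N ≤ 1 := pow_le_one₀ this.1 this.2.le
  have : Real.sqrt ((1 - 1 / BB ζ) ^ N) ≤ 1 := by rw [Real.sqrt_le_one]; exact h1
  have := Real.sqrt_nonneg ((1 - 1 / BB ζ) ^ N)
  unfold sY
  constructor <;> linarith

lemma Spec.edge (hζ : 0 < ζ) (S : Spec ζ N n Λ x l w) {u : ℂ} (hu : u.re = 0) :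
    (1 - sY ζ N) * (‖Complex.sinh (ζ + u)‖ ^ N) ^ 2 ≤ ‖Λ u‖ ^ 2 ∧
    ‖Λ u‖ ^ 2 ≤ (1 + sY ζ N) * (‖Complex.sinh (ζ + u)‖ ^ N) ^ 2 := by
  suffices H : ∀ u : ℂ, u.re = 0 → |u.im| ≤ π / 2 → (1 - sY ζ N) * (‖Complex.sinh (ζ + u)‖ ^ N) ^ 2 ≤ ‖Λ u‖ ^ 2 ∧
      ‖Λ u‖ ^ 2 ≤ (1 + sY ζ N) * (‖Complex.sinh (ζ + u)‖ ^ N) ^ 2 by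
    obtain ⟨k, hk⟩ := exk u.im
    have := H (u - k * (π * Complex.I)) (by simp [hu]) (by simpa using hk)
    rw [S.per, show ‖Complex.sinh (ζ + (u - k * (π * Complex.I)))‖ = ‖Complex.sinh (ζ + u)‖ by
      rw [← pow_left_inj₀ (norm_nonneg _) (norm_nonneg _) two_ne_zero, nsinh, nsinh]
      congr 1
      · simp
      · rw [show (ζ + (u - k * (π * Complex.I))).im = (ζ + u).im - k * π by simp, Real.sin_sub_int_mul_pi]
        rcases Int.even_or_odd k with hk | hk <;> simp [mul_pow, hk.neg_one_zpow]] at this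
    exact this
  intro u hu hv
  have h1 := S.fus u
  have h2 := S.adj u
  have hs : star u = -u := by apply Complex.ext <;> simp [hu]
  rw [hs, sub_neg_eq_add, add_comm] at h2
  have h3 := congrArg norm h1
  rw [h2, norm_mul, norm_star, ← sq, ← ph] at h3
  have h4 := S.Ysq hζ (u := u) (by simp [hu]; linarith) hv
  rw [hu, mul_zero, zero_div, Real.cos_zero] at h4
  have h5 : ‖ph ζ N u‖ = (‖Complex.sinh (ζ + u)‖ ^ N) ^ 2 := by
    rw [ph, norm_pow, norm_mul, show ‖Complex.sinh (ζ - u)‖ = ‖Complex.sinh (ζ + u)‖ by apply nsinh_eq <;> simp [hu],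
      add_comm u, ← sq, ← pow_mul, ← pow_mul, mul_comm]
  have h6 : ‖Complex.sinh u ^ N * x u‖ ≤ sY ζ N * ‖ph ζ N u‖ := by
    refine abs_le_of_sq_le_sq' ?_ (mul_nonneg (sY0 _ _).1 (norm_nonneg _)) |>.2
    refine h4.trans (le_of_eq ?_)
    rw [sY, mul_pow, mul_pow, Real.sq_sqrt (pow_nonneg (BB01 ζ).1 _)]; ring
  have h7 := norm_add_le (ph ζ N u) (Complex.sinh u ^ N * x u)
  have h8 := norm_sub_le (ph ζ N u + Complex.sinh u ^ N * x u) (Complex.sinh u ^ N * x u)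
  rw [add_sub_cancel_right] at h8
  rw [h3, ← h5]
  constructor <;> nlinarith

lemma Spec.edge2 (hζ : 0 < ζ) (S : Spec ζ N n Λ x l w) {u : ℂ} (hu : u.re = 0) :
    ‖Λ u‖ ≤ 2 * ‖Complex.sinh (ζ + u)‖ ^ N ∧ ‖Λ (ζ + u)‖ = ‖Λ u‖ := by
  constructor
  · refine abs_le_of_sq_le_sq' ?_ (by positivity) |>.2
    have := (S.edge hζ hu).2
    nlinarith [(sY0 ζ N).2, sq_nonneg (‖Complex.sinh (ζ + u)‖ ^ N)]
  · have h2 := S.adj u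
    have hs : star u = -u := by apply Complex.ext <;> simp [hu]
    rw [hs, sub_neg_eq_add] at h2
    rw [h2, norm_star]

lemma cos_bd {t : ℝ} (ht : 0 ≤ t) (h : 1 ≤ 9 * (1 - t / BB ζ) ^ N) (ht1 : t ≤ 1) : t * N ≤ BB ζ * Real.log 9 := by
  have hB := BB_one ζ
  have h0 : 0 < BB ζ := by linarith
  have h1 : 1 - t / BB ζ ≤ Real.exp (-(t / BB ζ)) := by have := Real.add_one_le_exp (-(t / BB ζ)); linarith
  have h2 : 0 ≤ 1 - t / BB ζ := by
    have : t / BB ζ ≤ 1 := by rw [div_le_one h0]; linarith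
    linarith
  have h3 : (1 - t / BB ζ) ^ N ≤ Real.exp (-(t / BB ζ) * N) := by
    rw [mul_comm, Real.exp_nat_mul]; gcongr
  have h4 : Real.exp (t / BB ζ * N) ≤ 9 := by
    have h5 : Real.exp (t / BB ζ * N) * Real.exp (-(t / BB ζ) * N) = 1 := by rw [← Real.exp_add]; simp
    have h6 := Real.exp_pos (t / BB ζ * N)
    nlinarith
  have h5 := (Real.le_log_iff_exp_le (by norm_num)).2 h4
  rw [show t / BB ζ * N = t * N / BB ζ by ring, div_le_iff₀ h0] at h5
  linarith

lemma Spec.zero_loc (hζ : 0 < ζ) (S : Spec ζ N n Λ x l w) {z : ℂ} (hz : Λ z = 0) (hv : |z.im| ≤ π / 2)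
    (h1 : -(ζ / 2) ≤ z.re) (h2 : z.re ≤ 3 * ζ / 2) : |Real.cos (π * z.re / ζ)| * N ≤ BB ζ * Real.log 9 := by
  have H : ∀ u : ℂ, |u.re| ≤ ζ / 2 → |u.im| ≤ π / 2 → Λ u * Λ (u + ζ) = 0 → |Real.cos (π * u.re / ζ)| * N ≤ BB ζ * Real.log 9 := by
    intro u hu hv hz
    have h3 := S.Ysq hζ hu hv
    have h4 := S.fus u
    rw [hz, ← ph] at h4
    have h5 : Complex.sinh u ^ N * x u = - ph ζ N u := by linear_combination -h4
    rw [h5, norm_neg] at h3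
    have h6 := abs_le.1 hu
    have h7 : 0 ≤ Real.cos (π * u.re / ζ) := by
      apply Real.cos_nonneg_of_neg_pi_div_two_le_of_le
      · rw [le_div_iff₀ hζ]; nlinarith [Real.pi_pos]
      · rw [div_le_iff₀ hζ]; nlinarith [Real.pi_pos]
    rw [abs_of_nonneg h7]
    have h8 : 0 < ‖ph ζ N u‖ ^ 2 := by have := ph_ne hζ N hu; positivity
    refine cos_bd h7 ?_ (Real.cos_le_one _)
    nlinarith
  rcases le_total z.re (ζ / 2) with h | h
  · exact H z (abs_le.2 ⟨h1, h⟩) hv (by rw [hz, zero_mul])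
  · have := H (z - ζ) (abs_le.2 ⟨by simp; linarith, by simp; linarith⟩) (by simpa using hv) (by rw [sub_add_cancel, hz, mul_zero])
    rw [Complex.sub_re, Complex.ofReal_re, show π * (z.re - ζ) / ζ = π * z.re / ζ - π by field_simp, Real.cos_sub_pi, abs_neg] at this
    exact this

end ana2

section ana3
open Set

variable {ζ : ℝ} {N n : ℕ} {Λ x : ℂ → ℂ} {l : ℂ} {w : Fin N → ℂ}

lemma Spec.lpos (S : Spec ζ N n Λ x l w) : 0 < ‖l‖ := by rw [S.lead]; positivity

lemma Spec.wne (S : Spec ζ N n Λ x l w) (j : Fin N) : w j ≠ 0 := by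
  intro h
  have h1 := S.low
  rw [Finset.prod_eq_zero (Finset.mem_univ j) h, mul_zero, norm_zero] at h1
  have : 0 < (2:ℝ)⁻¹ ^ N * (Real.exp (ζ * n) + Real.exp (ζ * (N - n))) := by positivity
  linarith

lemma Spec.jensen (hζ : 0 < ζ) (S : Spec ζ N n Λ x l w) {s : ℝ} (hs : s = 0 ∨ s = ζ) :
    ‖l‖ * ∏ j, max (Real.exp (2 * s)) ‖w j‖ ≤ 2 * Real.exp s ^ N * (Real.exp ζ / 2) ^ N := by
  set fac : Fin N → ℂ → ℂ := fun j t => if ‖w j‖ < Real.exp (2 * s) then (Real.exp (2 * s) : ℂ) - star (w j) * t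
    else (Real.exp (2 * s) : ℂ) * t - w j with hfac
  have hden : ∀ t : ℂ, ‖t‖ ≤ 1 → (Complex.exp ζ - Complex.exp (-ζ) * t) ≠ 0 := by
    intro t ht h0
    rw [sub_eq_zero] at h0
    have := congrArg norm h0
    rw [norm_mul, Complex.norm_exp, Complex.norm_exp] at this
    simp only [Complex.ofReal_re, Complex.neg_re] at this
    have h2 : Real.exp (-ζ) < Real.exp ζ := Real.exp_lt_exp.2 (by linarith)
    nlinarith [Real.exp_pos (-ζ)]
  have h1 := Complex.norm_le_of_forall_mem_frontier_norm_le (U := Metric.ball (0:ℂ) 1) (C := 2 * Real.exp s ^ N * (1 / 2) ^ N)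
    (f := fun t => l * (∏ j, fac j t) / (Complex.exp ζ - Complex.exp (-ζ) * t) ^ N)
    Metric.isBounded_ball (DifferentiableOn.diffContOnCl (by
      rw [closure_ball _ one_ne_zero]
      refine DifferentiableOn.div ?_ (by fun_prop) (fun t ht => pow_ne_zero _ (hden t (by simpa using ht)))
      apply Differentiable.differentiableOn
      apply Differentiable.const_mul
      apply Differentiable.fun_finsetProd
      intro j _
      simp only [hfac]
      split_ifs <;> fun_prop)) (fun t ht => by
      rw [frontier_ball _ one_ne_zero, mem_sphere_zero_iff_norm] at ht
      rw [norm_div, norm_pow, div_le_iff₀ (pow_pos (norm_pos_iff.2 (hden t ht.le)) _), norm_mul, norm_prod]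
      set v : ℝ := t.arg / 2 with hv
      have ht2 : t = Complex.exp (v * Complex.I) * Complex.exp (v * Complex.I) := by
        rw [← Complex.exp_add, ← add_mul, ← Complex.ofReal_add, hv, add_halves]
        have := Complex.norm_mul_exp_arg_mul_I t
        rw [ht] at this; simpa using this.symm
      have h3 : ∀ j, ‖fac j t‖ = ‖(Real.exp (2 * s) : ℂ) * t - w j‖ := by
        intro j
        simp only [hfac]
        split_ifs
        · rw [← norm_star ((Real.exp (2 * s) : ℂ) - star (w j) * t), star_sub, star_mul, star_star]
          have h4 : star t * t = 1 := by rw [Complex.star_def, Complex.conj_mul', ht]; simp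
          rw [← mul_one ‖_‖, ← ht, ← norm_mul, sub_mul]
          congr 1
          rw [show star ((Real.exp (2 * s) : ℂ)) = (Real.exp (2 * s) : ℂ) from Complex.conj_ofReal _]
          linear_combination (-w j) * h4
        · rfl
      simp_rw [h3]
      have h5 := S.pol (s + v * Complex.I)
      have h6 : Complex.exp (2 * (s + v * Complex.I)) = (Real.exp (2 * s) : ℂ) * t := by
        rw [ht2, ← Complex.exp_add, Complex.ofReal_exp, ← Complex.exp_add]; push_cast; ring_nf
      rw [h6] at h5
      have h7 := congrArg norm h5
      rw [norm_mul, norm_pow, norm_mul, norm_prod, Complex.norm_exp] at h7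
      rw [← h7]
      have h8 : ‖Λ (s + v * Complex.I)‖ ≤ 2 * ‖Complex.sinh (ζ + v * Complex.I)‖ ^ N := by
        have := S.edge2 hζ (u := v * Complex.I) (by simp)
        rcases hs with rfl | rfl
        · simpa using this.1
        · rw [this.2]; exact this.1
      have h9 : ‖Complex.sinh (ζ + v * Complex.I)‖ = 1 / 2 * ‖Complex.exp ζ - Complex.exp (-ζ) * t‖ := by
        rw [show ‖Complex.sinh (ζ + v * Complex.I)‖ = ‖Complex.sinh (ζ - v * Complex.I)‖ by apply nsinh_eq <;> simp,
          Complex.sinh, norm_div, Complex.norm_ofNat]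
        have : Complex.exp ζ - Complex.exp (-ζ) * t =
          Complex.exp (v * Complex.I) * (Complex.exp (ζ - v * Complex.I) - Complex.exp (-(ζ - v * Complex.I))) := by
          rw [ht2, mul_sub, ← Complex.exp_add, ← Complex.exp_add, ← Complex.exp_add, ← Complex.exp_add]; ring_nf
        rw [this, norm_mul, Complex.norm_exp_ofReal_mul_I]; ring
      rw [h9, mul_pow] at h8
      have h10 : ((s:ℂ) + v * Complex.I).re = s := by simp
      rw [h10]
      calc _ ≤ Real.exp s ^ N * (2 * ((1 / 2) ^ N * ‖Complex.exp ζ - Complex.exp (-ζ) * t‖ ^ N)) := by gcongr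
        _ = _ := by ring) (z := 0) (subset_closure (by simp))
  simp only [mul_zero, sub_zero, norm_div, norm_mul, norm_prod, norm_pow, Complex.norm_exp, Complex.ofReal_re] at h1
  rw [div_le_iff₀ (by positivity)] at h1
  have h2 : ∀ j, max (Real.exp (2 * s)) ‖w j‖ = ‖fac j 0‖ := by
    intro j
    simp only [hfac]
    split_ifs with h
    · rw [max_eq_left h.le]; simp [Complex.norm_exp]
    · rw [max_eq_right (not_lt.1 h)]; simp
  simp_rw [h2]
  refine h1.trans (le_of_eq ?_)
  rw [div_pow, div_pow, one_pow]; ring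

/-- logarithmic zeros -/
def zz (w : Fin N → ℂ) (j : Fin N) : ℂ := Complex.log (w j) / 2

lemma zz_re (j : Fin N) : (zz w j).re = Real.log ‖w j‖ / 2 := by simp [zz, Complex.log_re]

lemma zz_im (j : Fin N) : |(zz w j).im| ≤ π / 2 := by
  have := Complex.abs_arg_le_pi (w j)
  simp only [zz, Complex.div_ofNat_im, Complex.log_im, abs_div, abs_two]; linarith

lemma Spec.zz_exp (S : Spec ζ N n Λ x l w) (j : Fin N) : Complex.exp (2 * zz w j) = w j := by
  rw [zz, mul_div_cancel₀ _ two_ne_zero, Complex.exp_log (S.wne j)]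

lemma Spec.zz_zero (S : Spec ζ N n Λ x l w) (j : Fin N) : Λ (zz w j) = 0 := by
  have h1 := S.pol (zz w j)
  rw [Finset.prod_eq_zero (Finset.mem_univ j) (by rw [S.zz_exp, sub_self]), mul_zero] at h1
  exact (mul_eq_zero.1 h1).resolve_left (pow_ne_zero _ (Complex.exp_ne_zero _))

lemma Spec.out_bd (hζ : 0 < ζ) (S : Spec ζ N n Λ x l w) (j : Fin N) (h : ¬ (0 < (zz w j).re ∧ (zz w j).re < ζ)) :
    ζ / 2 * (N - BB ζ * Real.log 9) ≤ N * (max 0 (-(zz w j).re) + max 0 ((zz w j).re - ζ)) := by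
  set X := (zz w j).re with hX
  have hC : 0 ≤ BB ζ * Real.log 9 := mul_nonneg (by linarith [BB_one ζ]) (Real.log_nonneg (by norm_num))
  have hN : (0:ℝ) ≤ N := Nat.cast_nonneg _
  have H : ∀ y : ℝ, 0 ≤ y → y ≤ ζ / 2 → |Real.cos (π * X / ζ)| = Real.sin (π * y / ζ) →
      -(ζ / 2) ≤ X → X ≤ 3 * ζ / 2 → 2 * y / ζ * N ≤ BB ζ * Real.log 9 := by
    intro y hy hy2 hc h1 h2
    have h3 := S.zero_loc hζ (S.zz_zero j) (zz_im j) h1 h2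
    rw [← hX, hc] at h3
    have h4 := Real.mul_le_sin (x := π * y / ζ) (by have := Real.pi_pos; positivity) (by
      rw [div_le_iff₀ hζ]; nlinarith [Real.pi_pos])
    rw [show 2 / π * (π * y / ζ) = 2 * y / ζ by field_simp] at h4
    exact (mul_le_mul_of_nonneg_right h4 hN).trans h3
  have fin : ∀ y : ℝ, 2 * y / ζ * N ≤ BB ζ * Real.log 9 → ζ / 2 * (N - BB ζ * Real.log 9) ≤ N * (ζ / 2 - y) := by
    intro y hy
    have := mul_le_mul_of_nonneg_left hy (half_pos hζ).le
    rw [show ζ / 2 * (2 * y / ζ * N) = y * N by field_simp] at this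
    linarith
  have m1 := le_max_left 0 (-X)
  have m2 := le_max_right 0 (-X)
  have m3 := le_max_left 0 (X - ζ)
  have m4 := le_max_right 0 (X - ζ)
  rw [not_and_or, not_lt, not_lt] at h
  rcases h with h | h
  · have m : N * (-X) ≤ N * (max 0 (-X) + max 0 (X - ζ)) := by gcongr; linarith
    refine le_trans ?_ m
    rcases le_total X (-(ζ / 2)) with h1 | h1
    · nlinarith
    · have := fin (X + ζ / 2) (H (X + ζ / 2) (by linarith) (by linarith) (by
        rw [show π * (X + ζ / 2) / ζ = π * X / ζ + π / 2 by field_simp, Real.sin_add_pi_div_two]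
        apply abs_of_nonneg
        apply Real.cos_nonneg_of_neg_pi_div_two_le_of_le
        · rw [le_div_iff₀ hζ]; nlinarith [Real.pi_pos]
        · rw [div_le_iff₀ hζ]; nlinarith [Real.pi_pos]) h1 (by linarith))
      refine this.trans (le_of_eq (by ring))
  · have m : N * (X - ζ) ≤ N * (max 0 (-X) + max 0 (X - ζ)) := by gcongr; linarith
    refine le_trans ?_ m
    rcases le_total (3 * ζ / 2) X with h1 | h1
    · nlinarith
    · have := fin (3 * ζ / 2 - X) (H (3 * ζ / 2 - X) (by linarith) (by linarith) (by
        rw [show π * (3 * ζ / 2 - X) / ζ = π / 2 - (π * X / ζ - π) by field_simp; ring, Real.sin_pi_div_two_sub,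
          ← abs_neg, ← Real.cos_sub_pi]
        apply abs_of_nonneg
        apply Real.cos_nonneg_of_neg_pi_div_two_le_of_le
        · rw [le_sub_iff_add_le, le_div_iff₀ hζ]; nlinarith [Real.pi_pos]
        · rw [sub_le_iff_le_add, div_le_iff₀ hζ]; nlinarith [Real.pi_pos]) (by linarith) h1)
      refine this.trans (le_of_eq (by ring))

/-- inside zeros -/
def II (ζ : ℝ) (w : Fin N → ℂ) : Finset (Fin N) := Finset.univ.filter fun j => 0 < (zz w j).re ∧ (zz w j).re < ζ

/-- counting constant -/
def CI (ζ : ℝ) : ℝ := 2 * Real.log 2 / ζ + BB ζ * Real.log 9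

lemma Spec.count (hζ : 0 < ζ) (S : Spec ζ N n Λ x l w) (hN : 0 < N) {m : ℝ} (hm : m = n ∨ m = N - n) :
    N - 2 * m - CI ζ ≤ ((II ζ w).card : ℝ) := by
  have hC : 0 ≤ BB ζ * Real.log 9 := mul_nonneg (by linarith [BB_one ζ]) (Real.log_nonneg (by norm_num))
  have hwp : ∀ j, 0 < ‖w j‖ := fun j => norm_pos_iff.2 (S.wne j)
  have hl := S.lpos
  have hll : -(N * Real.log 2) - ζ * m ≤ Real.log ‖l‖ := by
    rw [Real.le_log_iff_exp_le hl, S.lead, sub_eq_add_neg, Real.exp_add, ← mul_neg, Real.exp_nat_mul,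
      Real.exp_neg, Real.exp_log two_pos]
    gcongr
    rcases hm with rfl | rfl
    · have := Real.exp_pos (-ζ * (N - n)); rw [← neg_mul]; linarith
    · have := Real.exp_pos (-ζ * n); rw [← neg_mul]; linarith
  have hj : ∀ s : ℝ, s = 0 ∨ s = ζ → ∑ j, max (2 * s) (2 * (zz w j).re) ≤ N * s + N * ζ + ζ * m + Real.log 2 := by
    intro s hs
    have h1 := S.jensen hζ hs
    have h2 : ∀ j, max (Real.exp (2 * s)) ‖w j‖ = Real.exp (max (2 * s) (2 * (zz w j).re)) := by
      intro j
      rw [Real.exp_monotone.map_max, zz_re, mul_div_cancel₀ _ two_ne_zero, Real.exp_log (hwp j)]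
    simp_rw [h2] at h1
    rw [← Real.exp_sum] at h1
    have h3 := Real.log_le_log (by positivity) h1
    rw [Real.log_mul hl.ne' (Real.exp_ne_zero _), Real.log_exp, Real.log_mul (by positivity) (by positivity),
      Real.log_mul two_ne_zero (by positivity), Real.log_pow, Real.log_pow, Real.log_exp, Real.log_div (by positivity) two_ne_zero,
      Real.log_exp] at h3
    linarith
  have hsum : ∑ j, 2 * (zz w j).re = N * ζ := by
    have h1 : Real.log ‖l * ∏ j, w j‖ = N * ζ + Real.log ‖l‖ := by
      rw [S.low, S.lead, ← Real.log_exp (N * ζ), ← Real.log_mul (Real.exp_ne_zero _) (by positivity)]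
      congr 1
      rw [mul_left_comm (Real.exp (N * ζ)), mul_add (Real.exp (N * ζ)), ← Real.exp_add, ← Real.exp_add]
      ring_nf
    rw [norm_mul, norm_prod, Real.log_mul hl.ne' (Finset.prod_ne_zero_iff.2 fun j _ => (hwp j).ne'),
      Real.log_prod (fun j _ => (hwp j).ne')] at h1
    have h2 : ∀ j, 2 * (zz w j).re = Real.log ‖w j‖ := fun j => by rw [zz_re]; ring
    simp_rw [h2]; linarith
  have h0 := hj 0 (Or.inl rfl)
  have h1 := hj ζ (Or.inr rfl)
  have h2 : ∑ j, (max 0 (-(zz w j).re) + max 0 ((zz w j).re - ζ)) ≤ ζ * m + Real.log 2 := by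
    have : ∀ j, max 0 (-(zz w j).re) + max 0 ((zz w j).re - ζ) =
        (max (2 * 0) (2 * (zz w j).re) - 2 * (zz w j).re + (max (2 * ζ) (2 * (zz w j).re) - 2 * ζ)) / 2 := by
      intro j
      rcases le_total 0 (zz w j).re with a | a <;> rcases le_total ζ (zz w j).re with b | b <;>
        simp only [max_def] <;> split_ifs <;> linarith
    simp_rw [this]
    rw [← Finset.sum_div, Finset.sum_add_distrib, Finset.sum_sub_distrib, Finset.sum_sub_distrib, hsum, Finset.sum_const,
      Finset.card_univ, Fintype.card_fin, nsmul_eq_mul]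
    generalize ∑ j, max (2 * 0) (2 * (zz w j).re) = A1 at h0 ⊢
    generalize ∑ j, max (2 * ζ) (2 * (zz w j).re) = A2 at h1 ⊢
    linarith
  have h3 : ∑ j ∈ (II ζ w)ᶜ, ζ / 2 * (N - BB ζ * Real.log 9) ≤ N * (ζ * m + Real.log 2) := by
    calc _ ≤ ∑ j ∈ (II ζ w)ᶜ, N * (max 0 (-(zz w j).re) + max 0 ((zz w j).re - ζ)) := by
          refine Finset.sum_le_sum fun j hj => S.out_bd hζ j ?_
          simpa [II] using hj
      _ ≤ ∑ j, N * (max 0 (-(zz w j).re) + max 0 ((zz w j).re - ζ)) :=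
          Finset.sum_le_sum_of_subset_of_nonneg (Finset.subset_univ _) fun j _ _ =>
            mul_nonneg (Nat.cast_nonneg _) (add_nonneg (le_max_left _ _) (le_max_left _ _))
      _ ≤ _ := by rw [← Finset.mul_sum]; gcongr
  rw [Finset.sum_const, Finset.card_compl, Fintype.card_fin, nsmul_eq_mul, Nat.cast_sub (by
    simpa using Finset.card_le_univ (II ζ w))] at h3
  set c := ((II ζ w).card : ℝ) with hc
  have hc0 : 0 ≤ c := Nat.cast_nonneg _
  · have hN' : (0:ℝ) < N := by exact_mod_cast hN
    have h4 : (N - c) * (ζ / 2 * (N - BB ζ * Real.log 9)) ≤ N * (ζ * m + Real.log 2) := h3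
    have h5 : (N - c) * N - N * (BB ζ * Real.log 9) ≤ N * (2 * m + 2 * Real.log 2 / ζ) := by
      have h6 := mul_le_mul_of_nonneg_left h4 (by positivity : (0:ℝ) ≤ 2 / ζ)
      rw [show 2 / ζ * ((N - c) * (ζ / 2 * (N - BB ζ * Real.log 9))) = (N - c) * (N - BB ζ * Real.log 9) by field_simp,
        show 2 / ζ * (N * (ζ * m + Real.log 2)) = N * (2 * m + 2 * Real.log 2 / ζ) by field_simp] at h6
      nlinarith
    have h6 : N - c - BB ζ * Real.log 9 ≤ 2 * m + 2 * Real.log 2 / ζ := by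
      have : N * (N - c - BB ζ * Real.log 9) ≤ N * (2 * m + 2 * Real.log 2 / ζ) := by linarith
      exact le_of_mul_le_mul_left this hN'
    unfold CI; linarith

end ana3

section efun
open Set

/-- terms of the exponent of the bulk eigenvalue -/
def ht (ζ : ℝ) (m : ℕ) (u : ℂ) : ℂ :=
  (Real.exp (-(2 * (m + 1) * ζ)) / ((m + 1) * Real.cosh ((m + 1) * ζ)) : ℝ) * Complex.cosh ((2 * (m + 1) : ℝ) * (u - (ζ / 2 : ℝ)))

def hf (ζ : ℝ) (u : ℂ) : ℂ := ∑' m, ht ζ m u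

/-- bulk eigenvalue per site -/
def EE (ζ : ℝ) (u : ℂ) : ℂ := Complex.exp (ζ - hf ζ u) / 2

lemma ncosh_le {w : ℂ} {r : ℝ} (h : |w.re| ≤ r) : ‖Complex.cosh w‖ ≤ Real.cosh r := by
  rw [Complex.cosh, norm_div, Complex.norm_ofNat]
  have h1 := norm_add_le (Complex.exp w) (Complex.exp (-w))
  rw [Complex.norm_exp, Complex.norm_exp, Complex.neg_re] at h1
  have h2 : Real.cosh w.re ≤ Real.cosh r := by rw [← Real.cosh_abs w.re]; exact Real.cosh_le_cosh.2 (by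
    rw [abs_abs]; exact h.trans (le_abs_self r))
  rw [Real.cosh_eq w.re] at h2
  linarith

lemma ht_norm {ζ : ℝ} (hζ : 0 < ζ) (m : ℕ) {u : ℂ} {r : ℝ} (h : |u.re - ζ / 2| ≤ r) :
    ‖ht ζ m u‖ ≤ Real.exp (-(2 * (m + 1) * ζ)) / ((m + 1) * Real.cosh ((m + 1) * ζ)) * Real.cosh (2 * (m + 1) * r) := by
  rw [ht, norm_mul, Complex.norm_real, Real.norm_of_nonneg (by positivity)]
  gcongr
  apply ncosh_le
  rw [Complex.re_ofReal_mul, Complex.sub_re, Complex.ofReal_re, abs_mul, abs_of_pos (by positivity)]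
  gcongr

lemma ht1 {ζ : ℝ} (hζ : 0 < ζ) (m : ℕ) {u : ℂ} (hu : u ∈ cs ζ) : ‖ht ζ m u‖ ≤ Real.exp (-(2 * ζ)) ^ (m + 1) := by
  refine (ht_norm hζ m (r := ζ / 2) (abs_le.2 ⟨by have := hu.1; linarith, by have := hu.2; linarith⟩)).trans ?_
  rw [show 2 * ((m:ℝ) + 1) * (ζ / 2) = (m + 1) * ζ by ring, ← Real.exp_nat_mul]
  have hc := Real.cosh_pos ((m + 1) * ζ)
  calc _ = Real.exp (-(2 * (m + 1) * ζ)) / (m + 1) := by field_simp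
    _ ≤ Real.exp (-(2 * (m + 1) * ζ)) / 1 := by gcongr; linarith [(Nat.cast_nonneg m : (0:ℝ) ≤ m)]
    _ = _ := by rw [div_one]; push_cast; ring_nf

lemma sumq {q : ℝ} (h0 : 0 < q) : Summable fun m : ℕ => Real.exp (-q) ^ (m + 1) := by
  have h1 : Real.exp (-q) < 1 := Real.exp_lt_one_iff.2 (by linarith)
  exact (summable_nat_add_iff 1).2 (summable_geometric_of_lt_one (Real.exp_pos _).le h1)

lemma hf_diff {ζ : ℝ} (hζ : 0 < ζ) : DifferentiableOn ℂ (hf ζ) (cs ζ) := by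
  have h1 : DifferentiableOn ℂ (hf ζ) (Complex.re ⁻¹' Ioo (-(ζ / 2)) (3 * ζ / 2)) := by
    refine Complex.differentiableOn_tsum_of_summable_norm (u := fun m => 2 * Real.exp (-ζ) ^ (m + 1)) ((sumq hζ).mul_left 2) ?_
      (isOpen_Ioo.preimage Complex.continuous_re) ?_
    · intro m; unfold ht; fun_prop
    · intro m u hu
      refine (ht_norm hζ m (r := ζ) (abs_le.2 ⟨by have := hu.1; linarith, by have := hu.2; linarith⟩)).trans ?_
      have hc := Real.exp_pos ((m + 1) * ζ)
      have h2 : Real.cosh (2 * (m + 1) * ζ) ≤ Real.exp (2 * (m + 1) * ζ) := by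
        rw [Real.cosh_eq]; have : Real.exp (-(2 * (m + 1) * ζ)) ≤ Real.exp (2 * (m + 1) * ζ) :=
          Real.exp_le_exp.2 (by have : 0 ≤ 2 * (m + 1) * ζ := by positivity
                                linarith)
        linarith
      have h3 : Real.exp ((m + 1) * ζ) / 2 ≤ (m + 1) * Real.cosh ((m + 1) * ζ) := by
        rw [Real.cosh_eq]; have := Real.exp_pos (-((m + 1) * ζ)); nlinarith [(Nat.cast_nonneg m : (0:ℝ) ≤ m)]
      calc _ ≤ Real.exp (-(2 * (m + 1) * ζ)) / (Real.exp ((m + 1) * ζ) / 2) * Real.exp (2 * (m + 1) * ζ) := by gcongr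
        _ = 2 * (Real.exp ((m + 1) * ζ))⁻¹ := by rw [Real.exp_neg]; field_simp
        _ = _ := by rw [← Real.exp_neg, ← Real.exp_nat_mul]; push_cast; ring_nf
  exact h1.mono fun u hu => ⟨by have := hu.1; linarith, by have := hu.2; linarith⟩

lemma EE_diff {ζ : ℝ} (hζ : 0 < ζ) : DifferentiableOn ℂ (EE ζ) (cs ζ) :=
  ((hf_diff hζ).const_sub _).cexp.div_const 2

lemma EE_ne (ζ : ℝ) (u : ℂ) : EE ζ u ≠ 0 := div_ne_zero (Complex.exp_ne_zero _) two_ne_zero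

lemma EE_norm (ζ : ℝ) (u : ℂ) : ‖EE ζ u‖ = Real.exp (ζ - (hf ζ u).re) / 2 := by
  simp [EE, Complex.norm_exp]

lemma EE_bd {ζ : ℝ} (hζ : 0 < ζ) : ∃ C : ℝ, 0 < C ∧ ∀ u ∈ cs ζ, ‖EE ζ u‖ ≤ C ∧ ‖(EE ζ u)⁻¹‖ ≤ C := by
  have hs := sumq (q := 2 * ζ) (by positivity)
  set H := ∑' m : ℕ, Real.exp (-(2 * ζ)) ^ (m + 1) with hH
  refine ⟨2 * Real.exp (ζ + H), by positivity, fun u hu => ?_⟩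
  have h1 : ‖hf ζ u‖ ≤ H := tsum_of_norm_bounded hs.hasSum fun m => ht1 hζ m hu
  have h2 := abs_le.1 ((Complex.abs_re_le_norm _).trans h1)
  rw [norm_inv, EE_norm, inv_div]
  constructor
  · have : Real.exp (ζ - (hf ζ u).re) ≤ Real.exp (ζ + H) := Real.exp_le_exp.2 (by linarith)
    have := Real.exp_pos (ζ + H)
    linarith
  · rw [div_eq_mul_inv, ← Real.exp_neg]
    have : Real.exp (-(ζ - (hf ζ u).re)) ≤ Real.exp (ζ + H) := Real.exp_le_exp.2 (by linarith)
    linarith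

lemma EE_edge {ζ : ℝ} (hζ : 0 < ζ) {u : ℂ} (hu : u.re = 0 ∨ u.re = ζ) :
    ‖EE ζ u‖ = ‖Complex.sinh (ζ + u.im * Complex.I)‖ := by
  have hcs : u ∈ cs ζ := by rcases hu with hu | hu <;> simp [cs, hu, hζ.le]
  set q : ℂ := Complex.exp (-(2 * ζ) + 2 * u.im * Complex.I) with hq
  have hq1 : ‖q‖ < 1 := by
    rw [hq, Complex.norm_exp]; apply Real.exp_lt_one_iff.2; simp; linarith
  have h1 := (hasSum_nat_add_iff' 1).2 (Complex.hasSum_taylorSeries_neg_log hq1)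
  simp only [Finset.range_one, Finset.sum_singleton, pow_zero, Nat.cast_zero, div_zero, sub_zero] at h1
  have hre : ∀ m, (ht ζ m u).re = (q ^ (m + 1) / ((m + 1 : ℕ) : ℂ)).re := by
    intro m
    have hw : ∀ w : ℂ, (Complex.cosh w).re = Real.cosh w.re * Real.cos w.im := by
      intro w
      conv_lhs => rw [← Complex.re_add_im w, Complex.cosh_add, Complex.cosh_mul_I, Complex.sinh_mul_I]
      rw [← Complex.ofReal_cosh, ← Complex.ofReal_cos, ← Complex.ofReal_sinh, ← Complex.ofReal_sin]
      simp [Complex.cosh_ofReal_re, Complex.cos_ofReal_re]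
    rw [ht, Complex.re_ofReal_mul, hw, hq, ← Complex.exp_nat_mul, Complex.div_natCast_re, Complex.exp_re,
      Complex.re_ofReal_mul, Complex.im_ofReal_mul]
    have e1 : Real.cosh (2 * (m + 1) * (u - (ζ / 2 : ℝ)).re) = Real.cosh ((m + 1) * ζ) := by
      rw [Complex.sub_re, Complex.ofReal_re]
      rcases hu with hu | hu <;> rw [hu]
      · rw [← Real.cosh_neg]; ring_nf
      · ring_nf
    rw [e1]
    have := Real.cosh_pos ((m + 1) * ζ)
    simp
    field_simp
  have h2 : (hf ζ u).re = - Real.log ‖1 - q‖ := by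
    have hsm : Summable fun m => ht ζ m u := Summable.of_norm_bounded (sumq (q := 2 * ζ) (by positivity)) fun m => ht1 hζ m hcs
    rw [hf, Complex.re_tsum hsm]
    simp_rw [hre]
    rw [(Complex.hasSum_re h1).tsum_eq, Complex.neg_re, Complex.log_re]
  have h1q : 0 < ‖1 - q‖ := by
    rw [norm_pos_iff, sub_ne_zero]; rintro h; rw [← h] at hq1; simp at hq1
  rw [EE_norm, h2, sub_neg_eq_add, Real.exp_add, Real.exp_log h1q]
  rw [show ‖Complex.sinh (ζ + u.im * Complex.I)‖ = ‖Complex.sinh (ζ - u.im * Complex.I)‖ by apply nsinh_eq <;> simp]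
  rw [Complex.sinh, norm_div, Complex.norm_ofNat]
  have h3 : Complex.exp (ζ - u.im * Complex.I) - Complex.exp (-(ζ - u.im * Complex.I)) =
      Complex.exp (ζ - u.im * Complex.I) * (1 - q) := by
    rw [mul_sub, mul_one, hq, ← Complex.exp_add]; ring_nf
  rw [h3, norm_mul, Complex.norm_exp]
  simp

/-- bulk value at the symmetric point -/
lemma hf_mid (ζ : ℝ) : hf ζ (ζ / 2 : ℝ) = ((∑' m : ℕ, Real.exp (-(2 * (m + 1) * ζ)) / ((m + 1) * Real.cosh ((m + 1) * ζ)) : ℝ) : ℂ) := by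
  simp only [hf, ht, sub_self, mul_zero, Complex.cosh_zero, mul_one]
  push_cast; rfl

lemma EE_mid_le (ζ : ℝ) : ‖EE ζ (ζ / 2 : ℝ)‖ ≤ Real.exp ζ / 2 := by
  rw [EE_norm, hf_mid, Complex.ofReal_re]
  have : 0 ≤ ∑' m : ℕ, Real.exp (-(2 * (m + 1) * ζ)) / ((m + 1) * Real.cosh ((m + 1) * ζ)) := tsum_nonneg fun m => by
    have := Real.cosh_pos ((m + 1) * ζ); positivity
  gcongr; linarith

lemma EE_mid_cont {ζ : ℝ} (hζ : 0 < ζ) : ContinuousOn (fun t : ℝ => ‖EE t (t / 2 : ℝ)‖) (Ici ζ) := by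
  have h1 : ContinuousOn (fun t : ℝ => ∑' m : ℕ, Real.exp (-(2 * (m + 1) * t)) / ((m + 1) * Real.cosh ((m + 1) * t))) (Ici ζ) := by
    refine continuousOn_tsum (u := fun m => Real.exp (-(2 * ζ)) ^ (m + 1)) (fun m => ?_) (sumq (by positivity)) ?_
    · refine Continuous.continuousOn (Continuous.div (by fun_prop) (by fun_prop) fun t => ?_)
      have := Real.cosh_pos ((m + 1) * t); positivity
    · intro m t ht
      have ht' : ζ ≤ t := ht
      have hc := Real.one_le_cosh ((m + 1) * t)
      rw [Real.norm_of_nonneg (by positivity), ← Real.exp_nat_mul]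
      calc _ ≤ Real.exp (-(2 * (m + 1) * t)) / 1 := by
            gcongr; nlinarith [(Nat.cast_nonneg m : (0:ℝ) ≤ m)]
        _ ≤ _ := by
          rw [div_one, Real.exp_le_exp]; push_cast
          nlinarith [mul_le_mul_of_nonneg_left ht' (by positivity : (0:ℝ) ≤ 2 * (m + 1))]
  have h2 : (fun t : ℝ => ‖EE t (t / 2 : ℝ)‖) = fun t => Real.exp (t - ∑' m : ℕ, Real.exp (-(2 * (m + 1) * t)) / ((m + 1) * Real.cosh ((m + 1) * t))) / 2 := by
    funext t; rw [EE_norm, hf_mid, Complex.ofReal_re]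
  rw [h2]
  exact ((continuousOn_id.sub h1).rexp).div_const 2

end efun

section up
open Set

lemma BI.of {ζ : ℝ} {f : ℂ → ℂ} {C : ℝ} (h : ∀ u ∈ cs ζ, ‖f u‖ ≤ C) : BI ζ f := ⟨0, C, fun u hu _ => h u hu⟩

lemma BI.prod {ζ : ℝ} {ι : Type*} (s : Finset ι) {f : ι → ℂ → ℂ} (h : ∀ i ∈ s, BI ζ (f i)) :
    BI ζ fun u => ∏ i ∈ s, f i u := by
  classical
  induction s using Finset.induction_on with
  | empty => exact BI.of (C := 1) fun u _ => by simp
  | insert i s hi ih =>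
    simp only [Finset.prod_insert hi]
    exact (h i (Finset.mem_insert_self _ _)).mul (ih fun j hj => h j (Finset.mem_insert_of_mem hj))

lemma BI.pow {ζ : ℝ} {f : ℂ → ℂ} (h : BI ζ f) (n : ℕ) : BI ζ fun u => f u ^ n := by
  have := BI.prod (Finset.range n) (f := fun _ => f) (fun _ _ => h)
  simpa using this

lemma nexp2 {ζ : ℝ} {u : ℂ} : ‖Complex.exp (2 * u)‖ = Real.exp (2 * u.re) := by
  rw [Complex.norm_exp]; simp

lemma BI.fac (ζ : ℝ) (w : ℂ) : BI ζ fun u => Complex.exp (2 * u) - w := by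
  refine BI.of (C := Real.exp (2 * ζ) + ‖w‖) fun u hu => (norm_sub_le _ _).trans ?_
  rw [nexp2 (ζ := ζ)]
  have := hu.2
  gcongr

lemma BI.ex (ζ : ℝ) : BI ζ fun u => Complex.exp (-u) := by
  refine BI.of (C := 1) fun u hu => ?_
  rw [Complex.norm_exp, Complex.neg_re]
  exact Real.exp_le_one_iff.2 (by have := hu.1; linarith)

lemma BI.ex' (ζ : ℝ) : BI ζ fun u => Complex.exp u := by
  refine BI.of (C := Real.exp ζ) fun u hu => ?_
  rw [Complex.norm_exp]
  exact Real.exp_le_exp.2 hu.2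

variable {ζ : ℝ} {N n : ℕ} {Λ x : ℂ → ℂ} {l : ℂ} {w : Fin N → ℂ}

lemma Spec.edges (hζ : 0 < ζ) (S : Spec ζ N n Λ x l w) {u : ℂ} (hu : u.re = 0 ∨ u.re = ζ) :
    (1 - sY ζ N) * (‖EE ζ u‖ ^ N) ^ 2 ≤ ‖Λ u‖ ^ 2 ∧ ‖Λ u‖ ^ 2 ≤ (1 + sY ζ N) * (‖EE ζ u‖ ^ N) ^ 2 := by
  rw [EE_edge hζ hu]
  have h0 : (u.im * Complex.I).re = 0 := by simp
  have h1 := S.edge hζ h0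
  have h2 : ‖Λ u‖ = ‖Λ (u.im * Complex.I)‖ := by
    rcases hu with hu | hu
    · congr 2; apply Complex.ext <;> simp [hu]
    · rw [← (S.edge2 hζ h0).2]; congr 2; apply Complex.ext <;> simp [hu]
  rw [h2]; exact h1

lemma Spec.up (hζ : 0 < ζ) (S : Spec ζ N n Λ x l w) {u0 : ℂ} (hu0 : u0 ∈ cs ζ) :
    ‖Λ u0‖ ≤ √(1 + sY ζ N) * ‖EE ζ u0‖ ^ N * ∏ j ∈ II ζ w, ‖bl ζ (zz w j) u0‖ := by
  classical
  obtain ⟨C, hC, hE⟩ := EE_bd hζ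
  set G : ℂ → ℂ := fun u => Complex.exp (-u) ^ N * (l * ((∏ j ∈ (II ζ w)ᶜ, (Complex.exp (2 * u) - w j)) * (EE ζ u)⁻¹ ^ N))
  have hG : ∀ u, G u * ∏ i ∈ II ζ w, (Complex.exp (2 * u) - Complex.exp (2 * zz w i)) = Λ u * (EE ζ u)⁻¹ ^ N := by
    intro u
    have h1 : ∏ i ∈ II ζ w, (Complex.exp (2 * u) - Complex.exp (2 * zz w i)) = ∏ i ∈ II ζ w, (Complex.exp (2 * u) - w i) :=
      Finset.prod_congr rfl fun i _ => by rw [S.zz_exp]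
    have h2 := S.pol u
    rw [← Finset.prod_mul_prod_compl (II ζ w)] at h2
    have h3 : Complex.exp (-u) ^ N * Complex.exp u ^ N = 1 := by
      rw [← mul_pow, ← Complex.exp_add, neg_add_cancel, Complex.exp_zero, one_pow]
    rw [h1]
    calc _ = Complex.exp (-u) ^ N * (l * ((∏ i ∈ II ζ w, (Complex.exp (2 * u) - w i)) * ∏ i ∈ (II ζ w)ᶜ, (Complex.exp (2 * u) - w i))) * (EE ζ u)⁻¹ ^ N := by
          simp only [G]; ring
      _ = (Complex.exp (-u) ^ N * Complex.exp u ^ N) * Λ u * (EE ζ u)⁻¹ ^ N := by rw [← h2]; ring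
      _ = _ := by rw [h3, one_mul]
  have key := BL hζ (II ζ w) (zz w) (fun i hi => by simpa [II] using hi) (√(1 + sY ζ N)) G ?_ ?_ ?_ u0 hu0
  · rw [hG, norm_mul, norm_pow, norm_inv, inv_pow] at key
    have hp : 0 < ‖EE ζ u0‖ ^ N := pow_pos (norm_pos_iff.2 (EE_ne ζ u0)) N
    rw [← div_eq_mul_inv, div_le_iff₀ hp] at key
    linarith
  · refine DifferentiableOn.mul (by fun_prop) (DifferentiableOn.mul (by fun_prop) (DifferentiableOn.mul ?_ ?_))
    · exact Differentiable.differentiableOn (by fun_prop)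
    · exact ((EE_diff hζ).inv fun u _ => EE_ne ζ u).pow N
  · refine ((BI.ex ζ).pow N).mul (BI.mul (BI.of (C := ‖l‖) fun _ _ => le_rfl) ((BI.prod _ fun i _ => BI.fac ζ _).mul (BI.pow (BI.of (C := C) fun u hu => ?_) N)))
    exact (hE u hu).2
  · intro u hu
    rw [hG, norm_mul, norm_pow, norm_inv, inv_pow]
    have hp : 0 < ‖EE ζ u‖ ^ N := pow_pos (norm_pos_iff.2 (EE_ne ζ u)) N
    rw [← div_eq_mul_inv, div_le_iff₀ hp]
    refine abs_le_of_sq_le_sq' ?_ (by positivity) |>.2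
    rw [mul_pow, Real.sq_sqrt (by have := (sY0 ζ N).1; linarith)]
    exact (S.edges hζ hu).2

lemma Spec.sinI (hζ : 0 < ζ) (S : Spec ζ N n Λ x l w) (h2 : 2 * (BB ζ * Real.log 9) ≤ N) (hN : 0 < N) {j : Fin N} (hj : j ∈ II ζ w) :
    1 / 2 ≤ Real.sin (π * (zz w j).re / ζ) := by
  have hj' : 0 < (zz w j).re ∧ (zz w j).re < ζ := by simpa [II] using hj
  have h := S.zero_loc hζ (S.zz_zero j) (zz_im j) (by linarith) (by linarith)
  have hN' : (0:ℝ) < N := by exact_mod_cast hN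
  have hc : |Real.cos (π * (zz w j).re / ζ)| ≤ 1 / 2 := by
    by_contra hc
    push Not at hc
    nlinarith
  have hs : 0 ≤ Real.sin (π * (zz w j).re / ζ) := Real.sin_nonneg_of_nonneg_of_le_pi (by have := hj'.1; positivity) (by
    rw [div_le_iff₀ hζ]; nlinarith [Real.pi_pos])
  have h3 := Real.sin_sq_add_cos_sq (π * (zz w j).re / ζ)
  have h4 : Real.cos (π * (zz w j).re / ζ) ^ 2 ≤ 1 / 4 := by
    rw [← sq_abs]; nlinarith [abs_nonneg (Real.cos (π * (zz w j).re / ζ))]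
  nlinarith

lemma Spec.up2 (hζ : 0 < ζ) (S : Spec ζ N n Λ x l w) (h2 : 2 * (BB ζ * Real.log 9) ≤ N) (hN : 0 < N) {v : ℝ} (hv : 0 ≤ v) (hv1 : v ≤ ζ) :
    ‖Λ v‖ ^ 2 ≤ (1 + sY ζ N) * (‖EE ζ v‖ ^ N) ^ 2 * (1 - Real.sin (π * v / ζ) / (2 * BB ζ)) ^ (II ζ w).card := by
  have hv2 : (v : ℂ) ∈ cs ζ := ⟨by simpa using hv, by simpa using hv1⟩
  have h := S.up hζ hv2
  have hB := BB_one ζ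
  have hs : 0 ≤ Real.sin (π * v / ζ) := Real.sin_nonneg_of_nonneg_of_le_pi (by positivity) (by
    rw [div_le_iff₀ hζ]; nlinarith [Real.pi_pos])
  calc ‖Λ v‖ ^ 2 ≤ (√(1 + sY ζ N) * ‖EE ζ v‖ ^ N * ∏ j ∈ II ζ w, ‖bl ζ (zz w j) v‖) ^ 2 := by gcongr
    _ = (1 + sY ζ N) * (‖EE ζ v‖ ^ N) ^ 2 * ∏ j ∈ II ζ w, ‖bl ζ (zz w j) v‖ ^ 2 := by
      rw [mul_pow, mul_pow, Real.sq_sqrt (by have := (sY0 ζ N).1; linarith), Finset.prod_pow]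
    _ ≤ _ := by
      have := (sY0 ζ N).1
      rw [← Finset.prod_const]
      gcongr with j hj
      have hj' : 0 < (zz w j).re ∧ (zz w j).re < ζ := by simpa [II] using hj
      refine (bl_le hζ hj'.1 hj'.2 hv2 ?_).trans ?_
      · rw [Complex.sub_im, Complex.ofReal_im, zero_sub, abs_neg]; exact zz_im j
      · have h5 := S.sinI hζ h2 hN hj
        rw [Complex.ofReal_re]
        have : Real.sin (π * v / ζ) / (2 * BB ζ) ≤ Real.sin (π * v / ζ) * Real.sin (π * (zz w j).re / ζ) / BB ζ := by
          rw [div_le_div_iff₀ (by positivity) (by positivity)]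
          have : 0 ≤ Real.sin (π * v / ζ) * BB ζ := by positivity
          nlinarith
        linarith

lemma Spec.lowr (hζ : 0 < ζ) (S : Spec ζ N n Λ x l w) (hI : II ζ w = ∅) (hs : sY ζ N < 1) {u0 : ℂ} (hu0 : u0 ∈ cs ζ) :
    (1 - sY ζ N) * (‖EE ζ u0‖ ^ N) ^ 2 ≤ ‖Λ u0‖ ^ 2 := by
  obtain ⟨C, hC, hE⟩ := EE_bd hζ
  have hs1 : 0 < 1 - sY ζ N := by linarith
  have hEp : ∀ u, 0 < ‖EE ζ u‖ ^ N := fun u => pow_pos (norm_pos_iff.2 (EE_ne ζ u)) N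
  have hbd : ∀ u : ℂ, u.re = 0 ∨ u.re = ζ → Λ u ≠ 0 := fun u hu h => by
    have h1 := (S.edges hζ hu).1
    rw [h, norm_zero] at h1
    have := hEp u
    have : 0 < (1 - sY ζ N) * (‖EE ζ u‖ ^ N) ^ 2 := by positivity
    norm_num at h1; linarith
  have hz : ∀ j, (zz w j).re < 0 ∨ ζ < (zz w j).re := by
    intro j
    by_contra h
    push Not at h
    rcases h.1.eq_or_lt with h1 | h1
    · exact hbd _ (Or.inl h1.symm) (S.zz_zero j)
    rcases h.2.eq_or_lt with h2 | h2
    · exact hbd _ (Or.inr h2) (S.zz_zero j)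
    have : j ∈ II ζ w := by simp [II, h1, h2]
    rw [hI] at this; simp at this
  have hsep : ∀ j, ∃ c > 0, ∀ u ∈ cs ζ, c ≤ ‖Complex.exp (2 * u) - w j‖ := by
    intro j
    have hw : ‖w j‖ = Real.exp (2 * (zz w j).re) := by rw [← S.zz_exp j, nexp2 (ζ := ζ)]
    rcases hz j with h | h
    · refine ⟨1 - ‖w j‖, by rw [hw, gt_iff_lt, sub_pos, Real.exp_lt_one_iff]; linarith, fun u hu => ?_⟩
      have h1 := norm_sub_norm_le (Complex.exp (2 * u)) (w j)
      rw [nexp2 (ζ := ζ)] at h1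
      have : 1 ≤ Real.exp (2 * u.re) := Real.one_le_exp (by have := hu.1; linarith)
      linarith
    · refine ⟨‖w j‖ - Real.exp (2 * ζ), by rw [hw, gt_iff_lt, sub_pos, Real.exp_lt_exp]; linarith, fun u hu => ?_⟩
      have h1 := norm_sub_norm_le (w j) (Complex.exp (2 * u))
      rw [nexp2 (ζ := ζ), norm_sub_rev] at h1
      have : Real.exp (2 * u.re) ≤ Real.exp (2 * ζ) := Real.exp_le_exp.2 (by have := hu.2; linarith)
      linarith
  have hne : ∀ j, ∀ u ∈ cs ζ, Complex.exp (2 * u) - w j ≠ 0 := fun j u hu h => by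
    obtain ⟨c, hc, h1⟩ := hsep j
    have := h1 u hu
    rw [h, norm_zero] at this; linarith
  set G : ℂ → ℂ := fun u => EE ζ u ^ N * (Complex.exp u ^ N * (l⁻¹ * ∏ j, (Complex.exp (2 * u) - w j)⁻¹))
  have hG : ∀ u, G u = EE ζ u ^ N / Λ u := by
    intro u
    have h2 := S.pol u
    have h3 : Complex.exp u ^ N ≠ 0 := pow_ne_zero _ (Complex.exp_ne_zero _)
    simp only [G, Finset.prod_inv_distrib]
    rw [← mul_inv, ← h2, mul_inv, ← mul_assoc (Complex.exp u ^ N), mul_inv_cancel₀ h3, one_mul, div_eq_mul_inv]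
  have hΛ : Λ u0 ≠ 0 := by
    intro h
    have h2 := S.pol u0
    rw [h, mul_zero] at h2
    have hl : l ≠ 0 := by
      have := S.lead
      intro h; rw [h, norm_zero] at this
      have : 0 < (2:ℝ)⁻¹ ^ N * (Real.exp (-ζ * n) + Real.exp (-ζ * (N - n))) := by positivity
      linarith
    rcases mul_eq_zero.1 h2.symm with h | h
    · exact hl h
    · obtain ⟨j, _, hj⟩ := Finset.prod_eq_zero_iff.1 h
      exact hne j u0 hu0 hj
  have hbG : ∀ u : ℂ, u.re = 0 ∨ u.re = ζ → ‖G u‖ ≤ (√(1 - sY ζ N))⁻¹ := by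
    intro u hu
    have h1 := (S.edges hζ hu).1
    rw [hG, norm_div, norm_pow, div_le_iff₀ (norm_pos_iff.2 (hbd u hu)), inv_mul_eq_div, le_div_iff₀ (Real.sqrt_pos.2 hs1)]
    refine abs_le_of_sq_le_sq' ?_ (by positivity) |>.2
    rw [mul_pow, Real.sq_sqrt hs1.le]; linarith
  have key := PLb (ζ := ζ) (f := G) (C := (√(1 - sY ζ N))⁻¹) ?_ ?_ (fun u hu => hbG u (Or.inl hu)) (fun u hu => hbG u (Or.inr hu)) u0 hu0
  · rw [hG, norm_div, norm_pow, div_le_iff₀ (norm_pos_iff.2 hΛ), inv_mul_eq_div, le_div_iff₀ (Real.sqrt_pos.2 hs1)] at key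
    calc _ = (‖EE ζ u0‖ ^ N * √(1 - sY ζ N)) ^ 2 := by rw [mul_pow, Real.sq_sqrt hs1.le]; ring
      _ ≤ _ := by gcongr
  · refine ((EE_diff hζ).pow N).mul (DifferentiableOn.mul (by fun_prop) (DifferentiableOn.mul (by fun_prop) ?_))
    refine DifferentiableOn.fun_finsetProd fun j _ => ?_
    exact DifferentiableOn.inv (by fun_prop) fun u hu => hne j u hu
  · refine BI.mul (BI.pow (BI.of (C := C) fun u hu => (hE u hu).1) N) (BI.mul ((BI.ex' ζ).pow N) (BI.mul (BI.of (C := ‖l⁻¹‖) fun _ _ => le_rfl) (BI.prod _ fun j _ => ?_)))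
    obtain ⟨c, hc, h1⟩ := hsep j
    refine BI.of (C := c⁻¹) fun u hu => ?_
    rw [norm_inv]; exact inv_anti₀ hc (h1 u hu)

end up

section E12
open Set
open scoped Matrix.Norms.L2Operator

lemma entry_le {m : Type*} [Fintype m] [DecidableEq m] (A : Matrix m m ℂ) (i j : m) : ‖A i j‖ ≤ ‖A‖ := by
  have h := Matrix.l2_opNorm_mulVec A (EuclideanSpace.single j 1)
  rw [EuclideanSpace.norm_single, norm_one, mul_one] at h
  refine le_trans ?_ h
  refine le_trans (le_of_eq ?_) (PiLp.norm_apply_le _ i)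
  congr 1
  have : (EuclideanSpace.single j (1:ℂ)).ofLp = Pi.single j 1 := by simp
  simp

lemma E2 {ζ v : ℝ} (hv : 0 < v) (hv1 : v < ζ) : ∃ κ > 0, ∃ C > 0, ∀ N n : ℕ, Even N → 0 < N → n ≤ N →
    ‖sec n (TT ζ N v)‖ ≤ C * Real.exp (-κ * |(N:ℝ) - 2 * n|) * ‖EE ζ v‖ ^ N := by
  have hζ : 0 < ζ := hv.trans hv1
  have hB := BB_one ζ
  have hs : 0 < Real.sin (π * v / ζ) := Real.sin_pos_of_pos_of_lt_pi (by positivity) (by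
    rw [div_lt_iff₀ hζ]; nlinarith [Real.pi_pos])
  have hs1 := Real.sin_le_one (π * v / ζ)
  set p := 1 - Real.sin (π * v / ζ) / (2 * BB ζ) with hp
  have h2B : Real.sin (π * v / ζ) / (2 * BB ζ) ≤ 1 / 2 := by
    rw [div_le_div_iff₀ (by positivity) (by norm_num)]; linarith
  have hp0 : 0 < p := by rw [hp]; linarith
  have hp1 : p < 1 := by
    have : 0 < Real.sin (π * v / ζ) / (2 * BB ζ) := by positivity
    rw [hp]; linarith
  have hlp := Real.log_neg hp0 hp1
  have hCI : 0 ≤ CI ζ := by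
    have := Real.log_nonneg (show (1:ℝ) ≤ 2 by norm_num)
    have := Real.log_nonneg (show (1:ℝ) ≤ 9 by norm_num)
    rw [CI]; positivity
  have hl9 : 0 ≤ 2 * (BB ζ * Real.log 9) := by
    have := Real.log_nonneg (show (1:ℝ) ≤ 9 by norm_num)
    positivity
  set κ := -Real.log p / 2 with hκ
  have hκ0 : 0 < κ := by rw [hκ]; linarith
  refine ⟨κ, hκ0, 2 * Real.exp (κ * (CI ζ + 2 * (BB ζ * Real.log 9))), by positivity, fun N n hN hN0 hn => ?_⟩
  by_cases h0 : sec n (TT ζ N v) = 0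
  · rw [h0, norm_zero]; positivity
  obtain ⟨Λ, x, l, w, S, -, h1⟩ := exists_spec hζ hN hn v h0
  have hv2 : (v : ℂ) ∈ cs ζ := ⟨by simpa using hv.le, by simpa using hv1.le⟩
  rw [← h1]
  have hsY := sY0 ζ N
  rw [show ∀ a b c d e : ℝ, 2 * Real.exp (κ * a) * Real.exp b * c = 2 * c * Real.exp (κ * a + b) from fun a b c d e => by
    rw [Real.exp_add]; ring]
  · by_cases hc : 2 * (BB ζ * Real.log 9) ≤ N
    · have h3 := S.up2 hζ hc hN0 hv.le hv1.le
      have hcard : |(N:ℝ) - 2 * n| - CI ζ ≤ ((II ζ w).card : ℝ) := by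
        rcases abs_cases ((N:ℝ) - 2 * n) with ⟨h, _⟩ | ⟨h, _⟩
        · rw [h]; exact S.count hζ hN0 (Or.inl rfl)
        · rw [h]; have := S.count hζ hN0 (Or.inr rfl); linarith
      have h4 : p ^ (II ζ w).card ≤ Real.exp (κ * CI ζ + -κ * |(N:ℝ) - 2 * n|) ^ 2 := by
        rw [← Real.rpow_natCast, Real.rpow_def_of_pos hp0, ← Real.exp_nat_mul]
        apply Real.exp_le_exp.2
        have : Real.log p = - (2 * κ) := by rw [hκ]; ring
        rw [this]; push_cast
        nlinarith
      have h5 : ‖Λ v‖ ^ 2 ≤ (2 * ‖EE ζ v‖ ^ N * Real.exp (κ * CI ζ + -κ * |(N:ℝ) - 2 * n|)) ^ 2 := by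
        refine h3.trans ?_
        rw [mul_pow, mul_pow]
        have : (1 + sY ζ N) ≤ 2 ^ 2 := by linarith
        gcongr
      refine (abs_le_of_sq_le_sq' h5 (by positivity)).2.trans ?_
      gcongr
      linarith
    · push Not at hc
      have h3 := S.up hζ hv2
      have h4 : ∏ j ∈ II ζ w, ‖bl ζ (zz w j) v‖ ≤ 1 := by
        refine Finset.prod_le_one (fun _ _ => norm_nonneg _) fun j hj => ?_
        have hj' : 0 < (zz w j).re ∧ (zz w j).re < ζ := by simpa [II] using hj
        have h6 := bl_le hζ hj'.1 hj'.2 hv2 (by rw [Complex.sub_im, Complex.ofReal_im, zero_sub, abs_neg]; exact zz_im j)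
        have hsj : 0 ≤ Real.sin (π * (zz w j).re / ζ) := Real.sin_nonneg_of_nonneg_of_le_pi (by have := hj'.1; positivity) (by
          rw [div_le_iff₀ hζ]; nlinarith [Real.pi_pos])
        rw [Complex.ofReal_re] at h6
        have : 0 ≤ Real.sin (π * v / ζ) * Real.sin (π * (zz w j).re / ζ) / BB ζ := by positivity
        exact (abs_le_of_sq_le_sq' (show ‖bl ζ (zz w j) v‖ ^ 2 ≤ 1 ^ 2 by linarith) (by norm_num)).2
      have h5 : √(1 + sY ζ N) ≤ 2 := by
        rw [Real.sqrt_le_left (by norm_num)]; linarith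
      have h7 : |(N:ℝ) - 2 * n| ≤ N := by
        have : (n:ℝ) ≤ N := by exact_mod_cast hn
        have : (0:ℝ) ≤ n := by positivity
        rw [abs_le]; constructor <;> linarith
      have h8 : 1 ≤ Real.exp (κ * (CI ζ + 2 * (BB ζ * Real.log 9)) + -κ * |(N:ℝ) - 2 * n|) := by
        apply Real.one_le_exp
        nlinarith
      calc ‖Λ v‖ ≤ _ := h3
        _ ≤ 2 * ‖EE ζ v‖ ^ N * 1 := by gcongr
        _ ≤ _ := by gcongr
  · exact 0
  · exact 0

/-- Neel entry -/
lemma neel {R : Type*} [CommRing R] (a b cE cW : R) (k : ℕ) : ∃ η η' : Row (2 * k), cnt η = k ∧ cnt η' = k ∧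
    mp (wM a b cE cW) η η' = (wM a b cE cW true false * wM a b cE cW false true) ^ k := by
  induction k with
  | zero => exact ⟨fun _ => true, fun _ => true, by simp [cnt], by simp [cnt], by rw [pow_zero]; exact mp_zero _ _ _⟩
  | succ k ih =>
    obtain ⟨η, η', h1, h2, h3⟩ := ih
    refine ⟨(Fin.cons true (Fin.cons false η : Row (2 * k + 1)) : Row (2 * k + 1 + 1)), (Fin.cons false (Fin.cons true η' : Row (2 * k + 1)) : Row (2 * k + 1 + 1)), ?_, ?_, ?_⟩
    · refine (cnt_cons _ _).trans ?_
      rw [cnt_cons, h1]; simp; ring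
    · refine (cnt_cons _ _).trans ?_
      rw [cnt_cons, h2]; simp; ring
    · refine (mp_cons _ _ _ _ _).trans ?_
      rw [mp_cons, h3, pow_succ', mul_assoc]

lemma neel_TT {ζ : ℝ} {u : ℂ} {k : ℕ} (hk : 0 < k) : ‖Complex.sinh ζ‖ ^ (2 * k) ≤ ‖sec k (TT ζ (2 * k) u)‖ := by
  obtain ⟨η, η', h1, h2, h3⟩ := neel (Complex.sinh (ζ - u)) (Complex.sinh u) (Complex.sinh ζ) (Complex.sinh ζ) k
  refine le_trans (le_of_eq ?_) (entry_le _ η η')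
  rw [sec, if_pos ⟨h1, h2⟩, TT, tmat, h3]
  have : wM (Complex.sinh (ζ - u)) (Complex.sinh u) (Complex.sinh ζ) (Complex.sinh ζ) true false *
      wM (Complex.sinh (ζ - u)) (Complex.sinh u) (Complex.sinh ζ) (Complex.sinh ζ) false true =
      Matrix.diagonal (fun s => if s then 0 else Complex.sinh ζ * Complex.sinh ζ) := by
    ext i j; fin_cases i <;> fin_cases j <;> simp [wM, Matrix.mul_apply]
  rw [this, Matrix.diagonal_pow, Matrix.trace_diagonal]
  simp [hk.ne']
  ring

lemma TT_cont (N n : ℕ) : Continuous fun t : ℝ => ‖sec n (TT t N (t / 2 : ℝ))‖ := by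
  have h : ∀ {N : ℕ} (η η' : Row N), Continuous fun t : ℝ => mp (wM (Complex.sinh (t - (t / 2 : ℝ))) (Complex.sinh (t / 2 : ℝ)) (Complex.sinh t) (Complex.sinh t)) η η' := by
    intro N η η'
    refine row_ind (P := fun {N} η η' => Continuous fun t : ℝ => mp (wM (Complex.sinh (t - (t / 2 : ℝ))) (Complex.sinh (t / 2 : ℝ)) (Complex.sinh t) (Complex.sinh t)) η η') ?_ ?_ η η'
    · intro η η'; simp only [mp_zero]; exact continuous_const
    · intro N s s' η η' ih
      simp only [mp_cons]
      refine Continuous.matrix_mul (continuous_matrix fun i j => ?_) ih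
      unfold wM; split_ifs <;> fun_prop
  refine continuous_norm.comp (continuous_matrix fun η η' => ?_)
  unfold sec
  split_ifs
  · exact (h η η').matrix_trace
  · exact continuous_const

lemma BB_mono {ζ t : ℝ} (hζ : 0 < ζ) (h : ζ ≤ t) : BB t ≤ BB ζ := by
  have := hζ.trans_le h
  unfold BB
  have h1 : Real.cosh (π ^ 2 / (4 * t)) ≤ Real.cosh (π ^ 2 / (4 * ζ)) := by
    rw [Real.cosh_le_cosh, abs_of_pos (by positivity), abs_of_pos (by positivity)]
    gcongr
  have := Real.cosh_pos (π ^ 2 / (4 * t))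
  gcongr

lemma sY_mono {ζ t : ℝ} (hζ : 0 < ζ) (h : ζ ≤ t) (N : ℕ) : sY t N ≤ sY ζ N := by
  unfold sY
  have h1 := BB_mono hζ h
  have h2 := BB_one t
  have h3 := (BB01 t).1
  gcongr

lemma dich {ζ t : ℝ} (hζ : 0 < ζ) (ht : ζ ≤ t) {k : ℕ} (hk : 0 < k) (h1 : 2 * (BB ζ * Real.log 9) ≤ (2 * k : ℕ)) (h2 : sY ζ (2 * k) ≤ 1 / (8 * BB ζ)) :
    ‖sec k (TT t (2 * k) (t / 2 : ℝ))‖ ^ 2 ≤ (1 - 3 / (8 * BB ζ)) * (‖EE t (t / 2 : ℝ)‖ ^ (2 * k)) ^ 2 ∨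
    ∀ u ∈ cs t, (1 - 1 / (8 * BB ζ)) * (‖EE t u‖ ^ (2 * k)) ^ 2 ≤ ‖sec k (TT t (2 * k) u)‖ ^ 2 := by
  have ht0 := hζ.trans_le ht
  have hB := BB_one ζ
  have hBt := BB_one t
  have hBm := BB_mono hζ ht
  have hs := (sY_mono hζ ht (2 * k)).trans h2
  have hs0 := (sY0 t (2 * k)).1
  have h8 : 1 / (8 * BB ζ) ≤ 1 / 8 := by
    rw [div_le_div_iff₀ (by positivity) (by norm_num)]; linarith
  have hl := Real.log_nonneg (show (1:ℝ) ≤ 9 by norm_num)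
  have hne : sec k (TT t (2 * k) (t / 2 : ℝ)) ≠ 0 := by
    intro h
    have := neel_TT (ζ := t) (u := (t / 2 : ℝ)) hk
    rw [h, norm_zero, ← Complex.ofReal_sinh, Complex.norm_real, Real.norm_of_nonneg (Real.sinh_nonneg_iff.2 ht0.le)] at this
    have h3 : 0 < Real.sinh t := Real.sinh_pos_iff.2 ht0
    have : 0 < Real.sinh t ^ (2 * k) := by positivity
    linarith
  obtain ⟨Λ, x, l, w, S, h3, h4⟩ := exists_spec ht0 ⟨k, by ring⟩ (by omega) (t / 2) hne
  by_cases hI : II t w = ∅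
  · right
    intro u hu
    have h5 := S.lowr ht0 hI (by linarith) hu
    have h6 := h3 u
    calc _ ≤ (1 - sY t (2 * k)) * (‖EE t u‖ ^ (2 * k)) ^ 2 := by gcongr
      _ ≤ ‖Λ u‖ ^ 2 := h5
      _ ≤ _ := by gcongr
  · left
    rw [← h4]
    have h5 := S.up2 ht0 (v := t / 2) (le_trans (by gcongr) h1) (by omega) (by positivity) (by linarith)
    rw [show π * (t / 2) / t = π / 2 by field_simp, Real.sin_pi_div_two] at h5
    have hc : 1 ≤ (II t w).card := Finset.card_pos.2 (Finset.nonempty_iff_ne_empty.2 hI)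
    have h6 : 1 / (2 * BB t) ≤ 1 / 2 := by
      rw [div_le_div_iff₀ (by positivity) (by norm_num)]; linarith
    have h6' : 0 < 1 / (2 * BB t) := by positivity
    have h7 : (1 - 1 / (2 * BB t)) ^ (II t w).card ≤ 1 - 1 / (2 * BB ζ) :=
      (pow_le_of_le_one (by linarith) (by linarith) (by omega)).trans (by gcongr)
    have h9 : (1 + sY t (2 * k)) * (1 - 1 / (2 * BB t)) ^ (II t w).card ≤ 1 - 3 / (8 * BB ζ) := by
      have h10 : 0 ≤ 1 - 1 / (2 * BB ζ) := le_trans (pow_nonneg (by linarith) _) h7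
      calc _ ≤ (1 + 1 / (8 * BB ζ)) * (1 - 1 / (2 * BB ζ)) := by
            have : 0 ≤ (1 - 1 / (2 * BB t)) ^ (II t w).card := pow_nonneg (by linarith) _
            gcongr
        _ = 1 - 3 / (8 * BB ζ) - 1 / (16 * BB ζ ^ 2) := by field_simp; ring
        _ ≤ _ := by have : 0 < 1 / (16 * BB ζ ^ 2) := by positivity
                    linarith
    calc _ ≤ _ := h5
      _ = ((1 + sY t (2 * k)) * (1 - 1 / (2 * BB t)) ^ (II t w).card) * (‖EE t (t / 2 : ℝ)‖ ^ (2 * k)) ^ 2 := by ring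
      _ ≤ _ := by gcongr

lemma E1 {ζ : ℝ} (hζ : 0 < ζ) : ∃ N0 : ℕ, ∀ k : ℕ, N0 ≤ k → ∀ v : ℝ, 0 ≤ v → v ≤ ζ →
    ‖EE ζ v‖ ^ (2 * k) / 2 ≤ ‖sec k (TT ζ (2 * k) v)‖ := by
  have hB := BB_one ζ
  have hb := BB01 ζ
  obtain ⟨N1, hN1⟩ := exists_nat_ge (2 * (BB ζ * Real.log 9))
  have hlim : Tendsto (fun k : ℕ => 3 * (1 - 1 / BB ζ) ^ k) atTop (nhds (3 * 0)) :=
    (tendsto_pow_atTop_nhds_zero_of_lt_one hb.1 hb.2).const_mul 3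
  have hpos : 3 * 0 < 1 / (8 * BB ζ) := by rw [mul_zero]; positivity
  obtain ⟨N2, hN2⟩ := eventually_atTop.1 (hlim.eventually_lt_const hpos)
  have h8 : 1 / (8 * BB ζ) ≤ 1 / 8 := by
    rw [div_le_div_iff₀ (by positivity) (by norm_num)]; linarith
  refine ⟨N1 + N2 + 1, fun k hk v hv hv1 => ?_⟩
  have hk0 : 0 < k := by omega
  have h1 : 2 * (BB ζ * Real.log 9) ≤ (2 * k : ℕ) := hN1.trans (by exact_mod_cast (by omega))
  have h2 : sY ζ (2 * k) ≤ 1 / (8 * BB ζ) := by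
    rw [sY, pow_mul', Real.sqrt_sq (pow_nonneg hb.1 _)]
    exact (hN2 k (by omega)).le
  have hEp : ∀ t : ℝ, 0 < ‖EE t (t / 2 : ℝ)‖ := fun t => norm_pos_iff.2 (EE_ne t _)
  set r : ℝ → ℝ := fun t => ‖sec k (TT t (2 * k) (t / 2 : ℝ))‖ ^ 2 / (‖EE t (t / 2 : ℝ)‖ ^ (2 * k)) ^ 2 with hr
  have hrd : ∀ t, ζ ≤ t → r t ≤ 1 - 3 / (8 * BB ζ) ∨ 1 - 1 / (8 * BB ζ) ≤ r t := by
    intro t ht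
    have hp := hEp t
    rcases dich hζ ht hk0 h1 h2 with h | h
    · left; rw [hr, div_le_iff₀ (by positivity)]; exact h
    · right; rw [hr, le_div_iff₀ (by positivity)]
      have := hζ.trans_le ht
      exact h _ ⟨by simp; linarith, by simp; linarith⟩
  have hrc : ContinuousOn r (Ici ζ) := by
    refine ContinuousOn.div ((TT_cont (2 * k) k).pow 2).continuousOn (((EE_mid_cont hζ).pow _).pow _) fun t _ => ?_
    have := hEp t; positivity
  have hrl : ∀ t, ζ ≤ t → ((1 - Real.exp (-(2 * t))) ^ (2 * k)) ^ 2 ≤ r t := by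
    intro t ht
    have ht0 := hζ.trans_le ht
    have hp := hEp t
    have hn := neel_TT (ζ := t) (u := (t / 2 : ℝ)) hk0
    rw [← Complex.ofReal_sinh, Complex.norm_real, Real.norm_of_nonneg (Real.sinh_nonneg_iff.2 ht0.le)] at hn
    have hx : 0 ≤ 1 - Real.exp (-(2 * t)) := by
      rw [sub_nonneg, Real.exp_le_one_iff]; linarith
    have hsh : Real.sinh t = (1 - Real.exp (-(2 * t))) * (Real.exp t / 2) := by
      rw [Real.sinh_eq, show -(2 * t) = -t + -t by ring, Real.exp_add]
      have : Real.exp (-t) * Real.exp t = 1 := by rw [← Real.exp_add]; simp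
      linear_combination (Real.exp (-t) / 2) * this
    rw [hr, le_div_iff₀ (by positivity), ← mul_pow, ← mul_pow]
    have : ((1 - Real.exp (-(2 * t))) * ‖EE t (t / 2 : ℝ)‖) ^ (2 * k) ≤ ‖sec k (TT t (2 * k) (t / 2 : ℝ))‖ := by
      refine le_trans ?_ hn
      rw [hsh]
      have := EE_mid_le t
      gcongr
    gcongr
  have hbig : 1 - 1 / (8 * BB ζ) ≤ r ζ := by
    rcases hrd ζ le_rfl with h | h
    swap
    · exact h
    exfalso
    have hT : Tendsto (fun t : ℝ => ((1 - Real.exp (-(2 * t))) ^ (2 * k)) ^ 2) atTop (nhds (((1 - 0) ^ (2 * k)) ^ 2)) := by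
      refine ((Tendsto.sub tendsto_const_nhds ?_).pow _).pow _
      exact Real.tendsto_exp_neg_atTop_nhds_zero.comp (tendsto_id.const_mul_atTop (by norm_num : (0:ℝ) < 2))
    have hpp : 0 < 1 / (8 * BB ζ) := by positivity
    have hlt : 1 - 1 / (4 * BB ζ) < ((1 - 0 : ℝ) ^ (2 * k)) ^ 2 := by
      simp; linarith
    obtain ⟨t, ht, hz⟩ := ((hT.eventually_const_lt hlt).and (eventually_ge_atTop ζ)).exists
    have h3 : 1 / (4 * BB ζ) = 2 * (1 / (8 * BB ζ)) := by field_simp; norm_num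
    have h4 : 3 / (8 * BB ζ) = 3 * (1 / (8 * BB ζ)) := by field_simp
    obtain ⟨s, hs, hs2⟩ := intermediate_value_Icc hz (hrc.mono (Icc_subset_Ici_self)) (show 1 - 1 / (4 * BB ζ) ∈ Icc (r ζ) (r t) from
      ⟨by linarith, by have := hrl t hz; linarith⟩)
    rcases hrd s hs.1 with h | h <;> rw [hs2] at h <;> linarith
  rcases dich hζ le_rfl hk0 h1 h2 with h | h
  · exfalso
    have hp := hEp ζ
    rw [hr, le_div_iff₀ (by positivity)] at hbig
    have : 0 < 1 / (8 * BB ζ) * (‖EE ζ (ζ / 2 : ℝ)‖ ^ (2 * k)) ^ 2 := by positivity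
    have h4 : 3 / (8 * BB ζ) = 3 * (1 / (8 * BB ζ)) := by field_simp
    rw [h4] at h
    nlinarith
  · have h3 := h v ⟨by simpa using hv, by simpa using hv1⟩
    have hp : 0 < ‖EE ζ v‖ ^ (2 * k) := pow_pos (norm_pos_iff.2 (EE_ne ζ _)) _
    refine (abs_le_of_sq_le_sq' ?_ (norm_nonneg _)).2
    refine le_trans ?_ h3
    nlinarith [sq_nonneg (‖EE ζ v‖ ^ (2 * k))]

end E12

section nrms
open Set
open scoped Matrix.Norms.L2Operator

variable {ι κ : Type*} [Fintype ι] [DecidableEq ι] [Fintype κ] [DecidableEq κ]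

/-- operator norm of a real matrix -/
def nrm (B : Matrix ι ι ℝ) : ℝ := ‖B.map Complex.ofRealHom‖

/-- sum of entries -/
def ent (B : Matrix ι ι ℝ) : ℝ := ∑ i, ∑ j, B i j

def pw (m : ℕ) (B : Matrix ι ι ℝ) : Matrix ι ι ℝ := (B * B.transpose) ^ m

lemma nrm0 (B : Matrix ι ι ℝ) : 0 ≤ nrm B := norm_nonneg _

lemma single_norm (i j : ι) (z : ℂ) : ‖Matrix.single i j z‖ ≤ ‖z‖ := by
  have h : ∀ k l : ι, ‖Matrix.single k l (1:ℂ)‖ * ‖Matrix.single k l (1:ℂ)‖ = ‖Matrix.single l l (1:ℂ)‖ := by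
    intro k l
    rw [← Matrix.l2_opNorm_conjTranspose_mul_self, Matrix.conjTranspose_single, Matrix.single_mul_single_same]
    simp
  have h1 : ‖Matrix.single j j (1:ℂ)‖ ≤ 1 := by nlinarith [h j j, norm_nonneg (Matrix.single j j (1:ℂ))]
  have h2 : ‖Matrix.single i j (1:ℂ)‖ ≤ 1 := by nlinarith [h i j, norm_nonneg (Matrix.single i j (1:ℂ))]
  have : Matrix.single i j z = z • Matrix.single i j (1:ℂ) := by rw [Matrix.smul_single, smul_eq_mul, mul_one]
  rw [this, norm_smul]
  exact mul_le_of_le_one_right (norm_nonneg _) h2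

lemma nrm_le_ent {B : Matrix ι ι ℝ} (h : ∀ i j, 0 ≤ B i j) : nrm B ≤ ent B := by
  rw [nrm, Matrix.matrix_eq_sum_single (B.map Complex.ofRealHom)]
  refine (norm_sum_le _ _).trans (Finset.sum_le_sum fun i _ => (norm_sum_le _ _).trans (Finset.sum_le_sum fun j _ => ?_))
  refine (single_norm _ _ _).trans ?_
  rw [Matrix.map_apply, Complex.ofRealHom_eq_coe, Complex.norm_real, Real.norm_of_nonneg (h i j)]

lemma ent_le_nrm (B : Matrix ι ι ℝ) : ent B ≤ (Fintype.card ι : ℝ) ^ 2 * nrm B := by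
  have : ent B ≤ ∑ i : ι, ∑ j : ι, nrm B := Finset.sum_le_sum fun i _ => Finset.sum_le_sum fun j _ => by
    have := entry_le (B.map Complex.ofRealHom) i j
    rw [Matrix.map_apply, Complex.ofRealHom_eq_coe, Complex.norm_real] at this
    exact (le_abs_self _).trans this
  simp only [Finset.sum_const, Finset.card_univ, nsmul_eq_mul] at this
  linarith

lemma nrm_pw (B : Matrix ι ι ℝ) (j : ℕ) : nrm (pw (2 ^ j) B) = nrm B ^ (2 * 2 ^ j) := by
  set X := B.map Complex.ofRealHom with hX
  have h1 : (pw (2 ^ j) B).map Complex.ofRealHom = (X * star X) ^ 2 ^ j := by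
    rw [pw, Matrix.map_pow, Matrix.map_mul, hX]
    congr 2
    ext k l; simp [Matrix.star_apply]
  have h2 := IsSelfAdjoint.nnnorm_pow_two_pow (IsSelfAdjoint.mul_star_self X) j
  rw [nrm, h1]
  have h3 : ‖(X * star X) ^ 2 ^ j‖ = ‖X * star X‖ ^ 2 ^ j := by
    have := congrArg NNReal.toReal h2
    rwa [NNReal.coe_pow, coe_nnnorm, coe_nnnorm] at this
  rw [h3, CStarRing.norm_self_mul_star, ← pow_two, ← pow_mul]; rfl

lemma mul_nn {B C : Matrix ι ι ℝ} (h : ∀ i j, 0 ≤ B i j) (h' : ∀ i j, 0 ≤ C i j) (i j : ι) : 0 ≤ (B * C) i j := by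
  rw [Matrix.mul_apply]; exact Finset.sum_nonneg fun k _ => mul_nonneg (h _ _) (h' _ _)

lemma pow_nn {B : Matrix ι ι ℝ} (h : ∀ i j, 0 ≤ B i j) (m : ℕ) : ∀ i j, 0 ≤ (B ^ m) i j := by
  induction m with
  | zero => intro i j; rw [pow_zero, Matrix.one_apply]; split_ifs <;> norm_num
  | succ m ih => rw [pow_succ]; exact mul_nn ih h

lemma pw_nn {B : Matrix ι ι ℝ} (h : ∀ i j, 0 ≤ B i j) (m : ℕ) (i j : ι) : 0 ≤ pw m B i j :=
  pow_nn (mul_nn h fun i j => h j i) m i j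

lemma root_le {x y K : ℝ} (hx : 0 ≤ x) (hy : 0 ≤ y) (h : ∀ j : ℕ, x ^ (2 * 2 ^ j) ≤ K * y ^ (2 * 2 ^ j)) : x ≤ y := by
  by_contra hxy
  push Not at hxy
  rcases hy.eq_or_lt with h0 | h0
  · have := h 0
    rw [← h0] at this hxy
    simp at this
    nlinarith
  have hr : 1 < x / y := (one_lt_div h0).2 hxy
  have ht := (tendsto_pow_atTop_atTop_of_one_lt hr).comp (show Tendsto (fun j : ℕ => 2 * 2 ^ j) atTop atTop from
    (tendsto_pow_atTop_atTop_of_one_lt (by norm_num : 1 < 2)).const_mul_atTop' (by norm_num))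
  obtain ⟨j, hj⟩ := (ht.eventually_gt_atTop K).exists
  simp only [Function.comp_apply, div_pow] at hj
  rw [lt_div_iff₀ (by positivity)] at hj
  linarith [h j]

lemma mul_emb {f : ι → κ} (hf : Function.Injective f) {B B' : Matrix κ κ ℝ} {C C' : Matrix ι ι ℝ} (hB : ∀ i j, 0 ≤ B i j)
    (hB' : ∀ i j, 0 ≤ B' i j) (hC' : ∀ i j, 0 ≤ C' i j)
    (h : ∀ i j, C i j ≤ B (f i) (f j)) (h' : ∀ i j, C' i j ≤ B' (f i) (f j)) (i j : ι) :
    (C * C') i j ≤ (B * B') (f i) (f j) := by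
  rw [Matrix.mul_apply, Matrix.mul_apply]
  calc ∑ k, C i k * C' k j ≤ ∑ k, B (f i) (f k) * B' (f k) (f j) := Finset.sum_le_sum fun k _ =>
        mul_le_mul (h _ _) (h' _ _) (hC' _ _) (hB _ _)
    _ = ∑ k ∈ Finset.univ.map ⟨f, hf⟩, B (f i) k * B' k (f j) := by rw [Finset.sum_map]; rfl
    _ ≤ _ := Finset.sum_le_sum_of_subset_of_nonneg (Finset.subset_univ _) fun k _ _ => mul_nonneg (hB _ _) (hB' _ _)

lemma pow_emb {f : ι → κ} (hf : Function.Injective f) {B : Matrix κ κ ℝ} {C : Matrix ι ι ℝ} (hB : ∀ i j, 0 ≤ B i j)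
    (hC : ∀ i j, 0 ≤ C i j) (h : ∀ i j, C i j ≤ B (f i) (f j)) (m : ℕ) : ∀ i j, (C ^ m) i j ≤ (B ^ m) (f i) (f j) := by
  induction m with
  | zero => intro i j; simp [Matrix.one_apply, hf.eq_iff]
  | succ m ih => rw [pow_succ, pow_succ]; exact mul_emb hf (pow_nn hB m) hB hC ih h

lemma ent_emb {f : ι → κ} (hf : Function.Injective f) {B : Matrix κ κ ℝ} {C : Matrix ι ι ℝ} (hB : ∀ i j, 0 ≤ B i j)
    (h : ∀ i j, C i j ≤ B (f i) (f j)) : ent C ≤ ent B := by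
  calc ent C ≤ ∑ i, ∑ j, B (f i) (f j) := Finset.sum_le_sum fun i _ => Finset.sum_le_sum fun j _ => h i j
    _ = ∑ i ∈ Finset.univ.map ⟨f, hf⟩, ∑ j ∈ Finset.univ.map ⟨f, hf⟩, B i j := by simp only [Finset.sum_map]; rfl
    _ ≤ ∑ i ∈ Finset.univ.map ⟨f, hf⟩, ∑ j, B i j := Finset.sum_le_sum fun i _ =>
        Finset.sum_le_sum_of_subset_of_nonneg (Finset.subset_univ _) fun k _ _ => hB _ _
    _ ≤ _ := Finset.sum_le_sum_of_subset_of_nonneg (Finset.subset_univ _) fun k _ _ => Finset.sum_nonneg fun _ _ => hB _ _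

lemma nrm_emb {f : ι → κ} (hf : Function.Injective f) {B : Matrix κ κ ℝ} {C : Matrix ι ι ℝ} (hB : ∀ i j, 0 ≤ B i j)
    (hC : ∀ i j, 0 ≤ C i j) (h : ∀ i j, C i j ≤ B (f i) (f j)) : nrm C ≤ nrm B := by
  refine root_le (nrm0 _) (nrm0 _) (K := (Fintype.card κ : ℝ) ^ 2) fun j => ?_
  rw [← nrm_pw, ← nrm_pw]
  refine (nrm_le_ent (pw_nn hC _)).trans (le_trans (ent_emb hf (pw_nn hB _) ?_) (ent_le_nrm _))
  exact pow_emb hf (mul_nn hB fun i j => hB j i) (mul_nn hC fun i j => hC j i)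
    (mul_emb hf hB (fun i j => hB j i) (fun i j => hC j i) h fun i j => h j i) _

lemma nrm_mono {B C : Matrix ι ι ℝ} (hC : ∀ i j, 0 ≤ C i j) (h : ∀ i j, C i j ≤ B i j) : nrm C ≤ nrm B :=
  nrm_emb Function.injective_id (fun i j => (hC i j).trans (h i j)) hC h

lemma nrm_add (B C : Matrix ι ι ℝ) : nrm (B + C) ≤ nrm B + nrm C := by
  unfold nrm; rw [Matrix.map_add _ (by simp)]; exact norm_add_le _ _

lemma nrm_smul {c : ℝ} (hc : 0 ≤ c) (B : Matrix ι ι ℝ) : nrm (c • B) = c * nrm B := by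
  unfold nrm
  rw [show (c • B).map Complex.ofRealHom = (c : ℂ) • B.map Complex.ofRealHom by ext i j; simp, norm_smul, Complex.norm_real,
    Real.norm_of_nonneg hc]

open scoped Kronecker in
lemma nrm_kron {B : Matrix ι ι ℝ} {C : Matrix κ κ ℝ} (hB : ∀ i j, 0 ≤ B i j) (hC : ∀ i j, 0 ≤ C i j) :
    nrm B * nrm C ≤ nrm (B ⊗ₖ C) := by
  refine root_le (mul_nonneg (nrm0 _) (nrm0 _)) (nrm0 _) (K := (Fintype.card (ι × κ) : ℝ) ^ 2) fun j => ?_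
  rw [← nrm_pw, mul_pow, ← nrm_pw, ← nrm_pw]
  refine le_trans (mul_le_mul (nrm_le_ent (pw_nn hB _)) (nrm_le_ent (pw_nn hC _)) (nrm0 _) ?_) (le_trans (le_of_eq ?_) (ent_le_nrm _))
  · exact (nrm0 _).trans (nrm_le_ent (pw_nn hB _))
  have h : ∀ m, pw m (B ⊗ₖ C) = pw m B ⊗ₖ pw m C := by
    intro m
    unfold pw
    rw [← Matrix.kroneckerMap_transpose, ← Matrix.mul_kronecker_mul]
    induction m with
    | zero => simp
    | succ m ih => rw [pow_succ, ih, ← Matrix.mul_kronecker_mul, pow_succ, pow_succ]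
  rw [h]
  simp only [ent, Fintype.sum_prod_type, Matrix.kroneckerMap_apply]
  rw [Finset.sum_mul_sum]
  refine Finset.sum_congr rfl fun i _ => Finset.sum_congr rfl fun k _ => ?_
  rw [Finset.sum_mul_sum]

end nrms

section heights
open Set

def sg (s : Bool) : ℤ := if s then 1 else -1

/-- height function of a row started at l -/
def HH : (N : ℕ) → ℤ → Row N → (Fin (N + 1) → ℤ)
  | 0, l, _ => fun _ => l
  | N + 1, l, η => Fin.cons l (HH N (l + sg (η 0)) (Fin.tail η))

lemma HH_cons {N : ℕ} (l : ℤ) (s : Bool) (η : Row N) :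
    HH (N + 1) l (Fin.cons s η : Row (N + 1)) = Fin.cons l (HH N (l + sg s) η) := by
  simp [HH]

def ad (x y : ℤ) : Prop := x = y + 1 ∨ y = x + 1

instance : DecidableRel ad := fun x y => by unfold ad; infer_instance

lemma HH_zero {N : ℕ} (l : ℤ) (η : Row N) : HH N l η 0 = l := by cases N <;> simp [HH]

lemma cons_last {N : ℕ} {A : Type*} (z : A) (f : Fin (N + 1) → A) :
    (Fin.cons z f : Fin (N + 2) → A) (Fin.last (N + 1)) = f (Fin.last N) := by
  rw [← Fin.succ_last, Fin.cons_succ]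

lemma HH_last {N : ℕ} (l : ℤ) (η : Row N) : HH N l η (Fin.last N) = l + 2 * cnt η - N := by
  induction N generalizing l with
  | zero => simp [HH, cnt]
  | succ N ih =>
    obtain ⟨s, η, rfl⟩ : ∃ s η', η = Fin.cons s η' := ⟨η 0, Fin.tail η, (Fin.cons_self_tail η).symm⟩
    rw [HH_cons, cons_last, ih, cnt_cons]
    cases s <;> simp [sg] <;> ring

lemma HH_ad {N : ℕ} (l : ℤ) (η : Row N) (i : Fin N) : ad (HH N l η i.castSucc) (HH N l η i.succ) := by
  induction N generalizing l with
  | zero => exact i.elim0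
  | succ N ih =>
    obtain ⟨s, η, rfl⟩ : ∃ s η', η = Fin.cons s η' := ⟨η 0, Fin.tail η, (Fin.cons_self_tail η).symm⟩
    rw [HH_cons]
    refine Fin.cases ?_ (fun i => ?_) i
    · rw [Fin.castSucc_zero, Fin.cons_zero, Fin.cons_succ, HH_zero]
      cases s <;> simp [sg, ad]
    · rw [← Fin.succ_castSucc, Fin.cons_succ, Fin.cons_succ]; exact ih _ _ _

lemma HH_inj {N : ℕ} (l : ℤ) : Function.Injective (HH N l) := by
  induction N generalizing l with
  | zero => intro _ _ _; exact Subsingleton.elim _ _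
  | succ N ih =>
    intro η η' h
    have h1 : HH N (l + sg (η 0)) (Fin.tail η) = HH N (l + sg (η' 0)) (Fin.tail η') := (Fin.cons_injective2 h).2
    have h2 : η 0 = η' 0 := by
      have := congrFun h1 0
      rw [HH_zero, HH_zero] at this
      revert this; cases η 0 <;> cases η' 0 <;> simp [sg] <;> omega
    rw [h2] at h1
    rw [← Fin.cons_self_tail η, ← Fin.cons_self_tail η', h2, ih _ h1]

lemma HH_surj {N : ℕ} (x : Fin (N + 1) → ℤ) (h : ∀ i : Fin N, ad (x i.castSucc) (x i.succ)) : ∃ η, HH N (x 0) η = x := by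
  induction N with
  | zero => exact ⟨fun _ => true, by funext i; simp [HH, Fin.fin_one_eq_zero i]⟩
  | succ N ih =>
    obtain ⟨η, hη⟩ := ih (Fin.tail x) fun i => by
      have := h i.succ
      rwa [← Fin.succ_castSucc] at this
    have h0 := h 0
    rw [Fin.castSucc_zero] at h0
    refine ⟨(Fin.cons (decide (x 1 = x 0 + 1)) η : Row (N + 1)), ?_⟩
    have : x 0 + sg (decide (x 1 = x 0 + 1)) = x 1 := by
      have h0 : ad (x 0) (x 1) := h0
      unfold ad at h0
      by_cases h2 : x 1 = x 0 + 1
      · simp [sg, h2]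
      · simp [sg, h2]; omega
    rw [HH_cons, this, show x 1 = Fin.tail x 0 from rfl, hη, Fin.cons_self_tail]

/-- height paths -/
def PP (N : ℕ) (l r : ℤ) : Finset (Fin (N + 1) → ℤ) :=
  (Finset.univ.filter fun η : Row N => l + 2 * cnt η - N = r).image (HH N l)

lemma mem_PP {N : ℕ} {l r : ℤ} {x : Fin (N + 1) → ℤ} :
    x ∈ PP N l r ↔ x 0 = l ∧ x (Fin.last N) = r ∧ ∀ i : Fin N, ad (x i.castSucc) (x i.succ) := by
  simp only [PP, Finset.mem_image, Finset.mem_filter, Finset.mem_univ, true_and]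
  constructor
  · rintro ⟨η, h1, rfl⟩
    exact ⟨HH_zero _ _, by rw [HH_last, h1], HH_ad _ _⟩
  · rintro ⟨rfl, h2, h3⟩
    obtain ⟨η, hη⟩ := HH_surj x h3
    refine ⟨η, ?_, hη⟩
    rw [← HH_last, hη, h2]

lemma sum_PP {N : ℕ} {l r : ℤ} (f : (Fin (N + 1) → ℤ) → ℝ) :
    ∑ x ∈ PP N l r, f x = ∑ η : Row N, if l + 2 * cnt η - N = r then f (HH N l η) else 0 := by
  rw [PP, Finset.sum_image fun _ _ _ _ h => HH_inj l h, Finset.sum_filter]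

lemma PP_par {N : ℕ} {l r L R : ℤ} {x y : Fin (N + 1) → ℤ} (hx : x ∈ PP N l r) (hy : y ∈ PP N L R) (h : Even (l - L)) (i : Fin (N + 1)) :
    Even (x i - y i) := by
  rw [mem_PP] at hx hy
  induction i using Fin.induction with
  | zero => rw [hx.1, hy.1]; exact h
  | succ i ih =>
    have h1 := hx.2.2 i
    have h2 := hy.2.2 i
    unfold ad at h1 h2
    rw [Int.even_iff] at *; omega

lemma ad_lat {x y X Y : ℤ} (h : Even (x - X)) (h1 : ad x y) (h2 : ad X Y) : ad (x ⊓ X) (y ⊓ Y) ∧ ad (x ⊔ X) (y ⊔ Y) := by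
  unfold ad at *
  rw [Int.even_iff] at h; constructor <;> omega

lemma PP_lat {N : ℕ} {l r L R : ℤ} {x y : Fin (N + 1) → ℤ} (hx : x ∈ PP N l r) (hy : y ∈ PP N L R) (h : Even (l - L)) :
    x ⊓ y ∈ PP N (l ⊓ L) (r ⊓ R) ∧ x ⊔ y ∈ PP N (l ⊔ L) (r ⊔ R) := by
  have hp := PP_par hx hy h
  rw [mem_PP] at hx hy ⊢
  rw [mem_PP]
  refine ⟨⟨by simp [hx.1, hy.1], by simp [hx.2.1, hy.2.1], fun i => ?_⟩, ⟨by simp [hx.1, hy.1], by simp [hx.2.1, hy.2.1], fun i => ?_⟩⟩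
  · exact (ad_lat (hp _) (hx.2.2 i) (hy.2.2 i)).1
  · exact (ad_lat (hp _) (hx.2.2 i) (hy.2.2 i)).2

open scoped FinsetFamily in
lemma FF {N : ℕ} {l r L R : ℤ} (hp : Even (l - L)) {f1 f2 f3 f4 : (Fin (N + 1) → ℤ) → ℝ} (h1 : ∀ x, 0 ≤ f1 x) (h2 : ∀ x, 0 ≤ f2 x)
    (h3 : ∀ x, 0 ≤ f3 x) (h4 : ∀ x, 0 ≤ f4 x) (h : ∀ x ∈ PP N l r, ∀ y ∈ PP N L R, f1 x * f2 y ≤ f3 (x ⊓ y) * f4 (x ⊔ y)) :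
    (∑ x ∈ PP N l r, f1 x) * (∑ x ∈ PP N L R, f2 x) ≤ (∑ x ∈ PP N (l ⊓ L) (r ⊓ R), f3 x) * ∑ x ∈ PP N (l ⊔ L) (r ⊔ R), f4 x := by
  classical
  set g1 : (Fin (N + 1) → ℤ) → ℝ := fun x => if x ∈ PP N l r then f1 x else 0
  set g2 : (Fin (N + 1) → ℤ) → ℝ := fun x => if x ∈ PP N L R then f2 x else 0
  have key := four_functions_theorem (f₁ := g1) (f₂ := g2) (f₃ := f3) (f₄ := f4) (fun x => by simp only [g1]; split_ifs; exacts [h1 x, le_rfl])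
    (fun x => by simp only [g2]; split_ifs; exacts [h2 x, le_rfl]) h3 h4 (fun x y => by
      simp only [g1, g2]
      have := mul_nonneg (h3 (x ⊓ y)) (h4 (x ⊔ y))
      split_ifs with hx hy
      · exact h x hx y hy
      · simpa using this
      · simpa using this
      · simpa using this) (PP N l r) (PP N L R)
  rw [Finset.sum_congr rfl (fun x hx => by simp only [g1]; rw [if_pos hx] : ∀ x ∈ PP N l r, g1 x = f1 x),
    Finset.sum_congr rfl (fun x hx => by simp only [g2]; rw [if_pos hx] : ∀ x ∈ PP N L R, g2 x = f2 x)] at key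
  refine key.trans (mul_le_mul ?_ ?_ (Finset.sum_nonneg fun x _ => h4 x) (Finset.sum_nonneg fun x _ => h3 x))
  · refine Finset.sum_le_sum_of_subset_of_nonneg (fun z hz => ?_) fun x _ _ => h3 x
    obtain ⟨x, hx, y, hy, rfl⟩ := Finset.mem_infs.1 hz
    exact (PP_lat hx hy hp).1
  · refine Finset.sum_le_sum_of_subset_of_nonneg (fun z hz => ?_) fun x _ _ => h4 x
    obtain ⟨x, hx, y, hy, rfl⟩ := Finset.mem_sups.1 hz
    exact (PP_lat hx hy hp).2

/-- local weight in terms of heights -/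
def wl (a b c : ℝ) (x y x' y' : ℤ) : ℝ :=
  if ad x y ∧ ad x' y' ∧ ad x x' ∧ ad y y' then (if x = y' then (if y = x' then c else a) else b) else 0

def KK (a b c : ℝ) {N : ℕ} (x x' : Fin (N + 1) → ℤ) : ℝ :=
  ∏ i : Fin N, wl a b c (x i.castSucc) (x i.succ) (x' i.castSucc) (x' i.succ)

variable {a b c : ℝ}

lemma wl_nn (ha : 0 ≤ a) (hb : 0 ≤ b) (hc : 0 ≤ c) (x y x' y' : ℤ) : 0 ≤ wl a b c x y x' y' := by
  unfold wl; split_ifs <;> first | assumption | exact le_rfl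

lemma KK_nn (ha : 0 ≤ a) (hb : 0 ≤ b) (hc : 0 ≤ c) {N : ℕ} (x x' : Fin (N + 1) → ℤ) : 0 ≤ KK a b c x x' :=
  Finset.prod_nonneg fun i _ => wl_nn ha hb hc _ _ _ _

lemma six_cfg {x y x' y' : ℤ} (h : ad x y ∧ ad x' y' ∧ ad x x' ∧ ad y y') :
    (y = x + 1 ∧ x' = x + 1 ∧ y' = x + 2) ∨ (y = x + 1 ∧ x' = x + 1 ∧ y' = x) ∨ (y = x + 1 ∧ x' = x - 1 ∧ y' = x) ∨
    (y = x - 1 ∧ x' = x + 1 ∧ y' = x) ∨ (y = x - 1 ∧ x' = x - 1 ∧ y' = x) ∨ (y = x - 1 ∧ x' = x - 1 ∧ y' = x - 2) := by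
  obtain ⟨h1, h2, h3, h4⟩ := h
  unfold ad at *
  rcases h1 with h1 | h1 <;> rcases h3 with h3 | h3 <;> omega

lemma inc_cfg {x y x' y' X Y X' Y' : ℤ} (h1 : ad x y ∧ ad x' y' ∧ ad x x' ∧ ad y y') (h2 : ad X Y ∧ ad X' Y' ∧ ad X X' ∧ ad Y Y')
    (h : Even (x - X)) (h3 : ¬ (x ≤ X ∧ y ≤ Y ∧ x' ≤ X' ∧ y' ≤ Y')) (h4 : ¬ (X ≤ x ∧ Y ≤ y ∧ X' ≤ x' ∧ Y' ≤ y')) :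
    (X = x ∧ y' = x ∧ Y' = x ∧ y = x + 1 ∧ x' = x - 1 ∧ Y = x - 1 ∧ X' = x + 1) ∨
    (X = x ∧ y' = x ∧ Y' = x ∧ y = x - 1 ∧ x' = x + 1 ∧ Y = x + 1 ∧ X' = x - 1) ∨
    (X = x + 2 ∧ y' = x + 2 ∧ Y' = x ∧ y = x + 1 ∧ x' = x + 1 ∧ Y = x + 1 ∧ X' = x + 1) ∨
    (X = x - 2 ∧ y' = x - 2 ∧ Y' = x ∧ y = x - 1 ∧ x' = x - 1 ∧ Y = x - 1 ∧ X' = x - 1) := by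
  obtain ⟨d, hd⟩ := h
  obtain rfl : X = x - 2 * d := by omega
  clear hd
  have hd : d ≤ 1 ∧ -1 ≤ d := by
    constructor
    · by_contra hd; apply h4
      rcases six_cfg h1 with ⟨rfl, rfl, rfl⟩ | ⟨rfl, rfl, rfl⟩ | ⟨rfl, rfl, rfl⟩ | ⟨rfl, rfl, rfl⟩ | ⟨rfl, rfl, rfl⟩ | ⟨rfl, rfl, rfl⟩ <;>
      rcases six_cfg h2 with ⟨rfl, rfl, rfl⟩ | ⟨rfl, rfl, rfl⟩ | ⟨rfl, rfl, rfl⟩ | ⟨rfl, rfl, rfl⟩ | ⟨rfl, rfl, rfl⟩ | ⟨rfl, rfl, rfl⟩ <;>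
      omega
    · by_contra hd; apply h3
      rcases six_cfg h1 with ⟨rfl, rfl, rfl⟩ | ⟨rfl, rfl, rfl⟩ | ⟨rfl, rfl, rfl⟩ | ⟨rfl, rfl, rfl⟩ | ⟨rfl, rfl, rfl⟩ | ⟨rfl, rfl, rfl⟩ <;>
      rcases six_cfg h2 with ⟨rfl, rfl, rfl⟩ | ⟨rfl, rfl, rfl⟩ | ⟨rfl, rfl, rfl⟩ | ⟨rfl, rfl, rfl⟩ | ⟨rfl, rfl, rfl⟩ | ⟨rfl, rfl, rfl⟩ <;>
      omega
  obtain rfl | rfl | rfl : d = 0 ∨ d = 1 ∨ d = -1 := by omega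
  all_goals
    replace h1 := six_cfg h1
    replace h2 := six_cfg h2
    clear hd
    rcases h1 with ⟨rfl, rfl, rfl⟩ | ⟨rfl, rfl, rfl⟩ | ⟨rfl, rfl, rfl⟩ | ⟨rfl, rfl, rfl⟩ | ⟨rfl, rfl, rfl⟩ | ⟨rfl, rfl, rfl⟩ <;>
    rcases h2 with ⟨rfl, rfl, rfl⟩ | ⟨rfl, rfl, rfl⟩ | ⟨rfl, rfl, rfl⟩ | ⟨rfl, rfl, rfl⟩ | ⟨rfl, rfl, rfl⟩ | ⟨rfl, rfl, rfl⟩ <;>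
    first
    | (exfalso; apply h3; clear h3 h4; omega)
    | (exfalso; apply h4; clear h3 h4; omega)
    | (clear h3 h4; omega)

lemma wl_SM (ha : 0 ≤ a) (hb : 0 ≤ b) (hac : a ≤ c) (hbc : b ≤ c) {x y x' y' X Y X' Y' : ℤ} (h : Even (x - X)) :
    wl a b c x y x' y' * wl a b c X Y X' Y' ≤ wl a b c (x ⊓ X) (y ⊓ Y) (x' ⊓ X') (y' ⊓ Y') * wl a b c (x ⊔ X) (y ⊔ Y) (x' ⊔ X') (y' ⊔ Y') := by
  have hc := ha.trans hac
  by_cases h1 : ad x y ∧ ad x' y' ∧ ad x x' ∧ ad y y'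
  swap
  · rw [wl, if_neg h1, zero_mul]; exact mul_nonneg (wl_nn ha hb hc _ _ _ _) (wl_nn ha hb hc _ _ _ _)
  by_cases h2 : ad X Y ∧ ad X' Y' ∧ ad X X' ∧ ad Y Y'
  swap
  · rw [mul_comm, wl, if_neg h2, zero_mul]; exact mul_nonneg (wl_nn ha hb hc _ _ _ _) (wl_nn ha hb hc _ _ _ _)
  by_cases h3 : x ≤ X ∧ y ≤ Y ∧ x' ≤ X' ∧ y' ≤ Y'
  · rw [inf_of_le_left h3.1, inf_of_le_left h3.2.1, inf_of_le_left h3.2.2.1, inf_of_le_left h3.2.2.2, sup_of_le_right h3.1,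
      sup_of_le_right h3.2.1, sup_of_le_right h3.2.2.1, sup_of_le_right h3.2.2.2]
  by_cases h4 : X ≤ x ∧ Y ≤ y ∧ X' ≤ x' ∧ Y' ≤ y'
  · rw [inf_of_le_right h4.1, inf_of_le_right h4.2.1, inf_of_le_right h4.2.2.1, inf_of_le_right h4.2.2.2, sup_of_le_left h4.1,
      sup_of_le_left h4.2.1, sup_of_le_left h4.2.2.1, sup_of_le_left h4.2.2.2, mul_comm]
  have h0 := inc_cfg h1 h2 h h3 h4
  have h5 : (x = y' ∧ y ≠ x' ∧ X = Y' ∧ Y ≠ X') ∨ (x ≠ y' ∧ X ≠ Y') := by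
    rcases h0 with h0 | h0 | h0 | h0 <;> omega
  have h6 : (x ⊓ X = y' ⊓ Y') ∧ (x ⊔ X = y' ⊔ Y') ∧ (y ⊓ Y = x' ⊓ X') ∧ (y ⊔ Y = x' ⊔ X') ∧ ad (x ⊓ X) (y ⊓ Y) ∧ ad (x ⊔ X) (y ⊔ Y) := by
    clear h1 h2 h3 h4 h5
    unfold ad
    rcases h0 with ⟨rfl, rfl, rfl, rfl, rfl, rfl, rfl⟩ | ⟨rfl, rfl, rfl, rfl, rfl, rfl, rfl⟩ | ⟨rfl, rfl, rfl, rfl, rfl, rfl, rfl⟩ | ⟨rfl, rfl, rfl, rfl, rfl, rfl, rfl⟩ <;>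
      exact ⟨by omega, by omega, by omega, by omega, by omega, by omega⟩
  have h7 : ∀ x y : ℤ, ad x y → ad y x := fun x y h => h.symm
  have hcc : ∀ x y : ℤ, ad x y → wl a b c x y y x = c := fun x y h => by
    rw [wl, if_pos ⟨h, h7 _ _ h, h, h7 _ _ h⟩, if_pos rfl, if_pos rfl]
  rw [← h6.1, ← h6.2.1, ← h6.2.2.1, ← h6.2.2.2.1, hcc _ _ h6.2.2.2.2.1, hcc _ _ h6.2.2.2.2.2]
  rw [wl, wl, if_pos h1, if_pos h2]
  rcases h5 with ⟨e1, e2, e3, e4⟩ | ⟨e1, e2⟩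
  · rw [if_pos e1, if_neg e2, if_pos e3, if_neg e4]; exact mul_le_mul hac hac ha hc
  · rw [if_neg e1, if_neg e2]; exact mul_le_mul hbc hbc hb hc

lemma KK_SM (ha : 0 ≤ a) (hb : 0 ≤ b) (hac : a ≤ c) (hbc : b ≤ c) {N : ℕ} {x x' y y' : Fin (N + 1) → ℤ} (h : ∀ i, Even (x i - y i)) :
    KK a b c x x' * KK a b c y y' ≤ KK a b c (x ⊓ y) (x' ⊓ y') * KK a b c (x ⊔ y) (x' ⊔ y') := by
  unfold KK
  rw [← Finset.prod_mul_distrib, ← Finset.prod_mul_distrib]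
  have hc := ha.trans hac
  exact Finset.prod_le_prod (fun i _ => mul_nonneg (wl_nn ha hb hc _ _ _ _) (wl_nn ha hb hc _ _ _ _)) fun i _ => wl_SM ha hb hac hbc (h _)

/-- iterated kernel -/
def ph2 (a b c : ℝ) (N : ℕ) (l r : ℤ) : ℕ → (Fin (N + 1) → ℤ) → ℝ
  | 0, _ => 1
  | m + 1, x => ∑ x' ∈ PP N (l - 1) (r - 1), KK a b c x x' * ∑ x'' ∈ PP N l r, KK a b c x'' x' * ph2 a b c N l r m x''

lemma ph2_nn (ha : 0 ≤ a) (hb : 0 ≤ b) (hc : 0 ≤ c) {N : ℕ} (l r : ℤ) (m : ℕ) : ∀ x, 0 ≤ ph2 a b c N l r m x := by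
  induction m with
  | zero => intro x; simp [ph2]
  | succ m ih =>
    intro x
    exact Finset.sum_nonneg fun x' _ => mul_nonneg (KK_nn ha hb hc _ _) (Finset.sum_nonneg fun x'' _ => mul_nonneg (KK_nn ha hb hc _ _) (ih _))

lemma ph2_SM (ha : 0 ≤ a) (hb : 0 ≤ b) (hac : a ≤ c) (hbc : b ≤ c) {N : ℕ} {l r L R : ℤ} (hp : Even (l - L)) (m : ℕ) :
    ∀ x ∈ PP N l r, ∀ y ∈ PP N L R, ph2 a b c N l r m x * ph2 a b c N L R m y ≤
      ph2 a b c N (l ⊓ L) (r ⊓ R) m (x ⊓ y) * ph2 a b c N (l ⊔ L) (r ⊔ R) m (x ⊔ y) := by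
  have hc := ha.trans hac
  have K0 := fun x x' => KK_nn ha hb hc (N := N) x x'
  induction m with
  | zero => intro x _ y _; simp [ph2]
  | succ m ih =>
    intro x hx y hy
    have e1 : l ⊓ L - 1 = (l - 1) ⊓ (L - 1) := by omega
    have e2 : r ⊓ R - 1 = (r - 1) ⊓ (R - 1) := by omega
    have e3 : l ⊔ L - 1 = (l - 1) ⊔ (L - 1) := by omega
    have e4 : r ⊔ R - 1 = (r - 1) ⊔ (R - 1) := by omega
    have inn : ∀ l r x', 0 ≤ ∑ x'' ∈ PP N l r, KK a b c x'' x' * ph2 a b c N l r m x'' := fun l r x' =>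
      Finset.sum_nonneg fun x'' _ => mul_nonneg (K0 _ _) (ph2_nn ha hb hc _ _ _ _)
    simp only [ph2]
    rw [e1, e2, e3, e4]
    refine FF (by simpa using hp) (fun z => mul_nonneg (K0 _ _) (inn _ _ _)) (fun z => mul_nonneg (K0 _ _) (inn _ _ _))
      (fun z => mul_nonneg (K0 _ _) (inn _ _ _)) (fun z => mul_nonneg (K0 _ _) (inn _ _ _)) fun x' hx' y' hy' => ?_
    rw [mul_mul_mul_comm, mul_mul_mul_comm (KK a b c (x ⊓ y) _)]
    refine mul_le_mul (KK_SM ha hb hac hbc (PP_par hx hy hp)) ?_ (mul_nonneg (inn _ _ _) (inn _ _ _)) (mul_nonneg (K0 _ _) (K0 _ _))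
    refine FF hp (fun z => mul_nonneg (K0 _ _) (ph2_nn ha hb hc _ _ _ _)) (fun z => mul_nonneg (K0 _ _) (ph2_nn ha hb hc _ _ _ _))
      (fun z => mul_nonneg (K0 _ _) (ph2_nn ha hb hc _ _ _ _)) (fun z => mul_nonneg (K0 _ _) (ph2_nn ha hb hc _ _ _ _)) fun x'' hx'' y'' hy'' => ?_
    rw [mul_mul_mul_comm, mul_mul_mul_comm (KK a b c (x'' ⊓ y'') _)]
    exact mul_le_mul (KK_SM ha hb hac hbc (PP_par hx'' hy'' hp)) (ih _ hx'' _ hy'')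
      (mul_nonneg (ph2_nn ha hb hc _ _ _ _) (ph2_nn ha hb hc _ _ _ _)) (mul_nonneg (K0 _ _) (K0 _ _))

lemma KK_cons {N : ℕ} (z z' : ℤ) (x x' : Fin (N + 1) → ℤ) :
    KK a b c (Fin.cons z x : Fin (N + 2) → ℤ) (Fin.cons z' x') = wl a b c z (x 0) z' (x' 0) * KK a b c x x' := by
  unfold KK
  rw [Fin.prod_univ_succ]
  simp only [Fin.castSucc_zero, Fin.cons_zero, Fin.cons_succ, ← Fin.succ_castSucc]

lemma mp_KK {N : ℕ} (η η' : Row N) : ∀ (l : ℤ) (α β : Bool), mp (wM a b c c) η η' α β =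
    if HH N l η (Fin.last N) - sg β = HH N (l - sg α) η' (Fin.last N) then KK a b c (HH N l η) (HH N (l - sg α) η') else 0 := by
  refine row_ind (P := fun {N} η η' => ∀ (l : ℤ) (α β : Bool), mp (wM a b c c) η η' α β =
    if HH N l η (Fin.last N) - sg β = HH N (l - sg α) η' (Fin.last N) then KK a b c (HH N l η) (HH N (l - sg α) η') else 0) ?_ ?_ η η'
  · intro η η' l α β
    rw [mp_zero]
    cases α <;> cases β <;> simp [HH, sg, KK] <;> omega
  · intro N s s' η η' ih l α β
    rw [mp_cons, Matrix.mul_apply, Fintype.sum_bool, HH_cons, HH_cons, cons_last, cons_last, KK_cons, HH_zero, HH_zero,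
      ih (l + sg s) true β, ih (l + sg s) false β]
    cases s <;> cases s' <;> cases α <;> simp [wM, wl, sg, ad, sub_eq_add_neg, add_assoc]

end heights

section soft
open Set
open scoped Matrix.Norms.L2Operator

variable {a b c : ℝ}

lemma nrm_emb2 {ι κ : Type*} [Fintype ι] [DecidableEq ι] [Fintype κ] [DecidableEq κ] {f g : ι → κ} (hf : Function.Injective f)
    (hg : Function.Injective g) {B : Matrix κ κ ℝ} {C : Matrix ι ι ℝ} (hB : ∀ i j, 0 ≤ B i j)
    (hC : ∀ i j, 0 ≤ C i j) (h : ∀ i j, C i j ≤ B (f i) (g j)) : nrm C ≤ nrm B := by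
  refine root_le (nrm0 _) (nrm0 _) (K := (Fintype.card κ : ℝ) ^ 2) fun j => ?_
  rw [← nrm_pw, ← nrm_pw]
  refine (nrm_le_ent (pw_nn hC _)).trans (le_trans (ent_emb hf (pw_nn hB _) ?_) (ent_le_nrm _))
  refine pow_emb hf (mul_nn hB fun i j => hB j i) (mul_nn hC fun i j => hC j i) (fun i j => ?_) _
  change (C * C.transpose) i j ≤ (B * B.transpose) (f i) (f j)
  rw [Matrix.mul_apply, Matrix.mul_apply]
  calc ∑ k, C i k * C.transpose k j ≤ ∑ k, B (f i) (g k) * B.transpose (g k) (f j) := Finset.sum_le_sum fun k _ =>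
        mul_le_mul (h _ _) (h _ _) (hC _ _) (hB _ _)
    _ = ∑ k ∈ Finset.univ.map ⟨g, hg⟩, B (f i) k * B.transpose k (f j) := by rw [Finset.sum_map]; rfl
    _ ≤ _ := Finset.sum_le_sum_of_subset_of_nonneg (Finset.subset_univ _) fun k _ _ => mul_nonneg (hB _ _) (hB _ _)

/-- diagonal entry of the monodromy, restricted to a sector -/
def AB (a b c : ℝ) (α : Bool) (N n : ℕ) : Matrix (Row N) (Row N) ℝ := sec n fun η η' => mp (wM a b c c) η η' α α

lemma AB_apply (α : Bool) (N n : ℕ) (η η' : Row N) : AB a b c α N n η η' = if cnt η = n ∧ cnt η' = n then mp (wM a b c c) η η' α α else 0 := rfl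

lemma wM_nn (ha : 0 ≤ a) (hb : 0 ≤ b) (hc : 0 ≤ c) (s s' α β : Bool) : 0 ≤ wM a b c c s s' α β := by
  unfold wM; split_ifs <;> first | assumption | exact le_rfl

lemma mp_nn (ha : 0 ≤ a) (hb : 0 ≤ b) (hc : 0 ≤ c) {N : ℕ} (η η' : Row N) : ∀ α β, 0 ≤ mp (wM a b c c) η η' α β := by
  refine row_ind (P := fun {N} η η' => ∀ α β, 0 ≤ mp (wM a b c c) η η' α β) ?_ ?_ η η'
  · intro η η' α β; rw [mp_zero, Matrix.one_apply]; split_ifs <;> norm_num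
  · intro N s s' η η' ih α β
    rw [mp_cons]; exact mul_nn (wM_nn ha hb hc s s') ih α β

lemma AB_nn (ha : 0 ≤ a) (hb : 0 ≤ b) (hc : 0 ≤ c) (α : Bool) (N n : ℕ) (η η' : Row N) : 0 ≤ AB a b c α N n η η' := by
  unfold AB sec; split_ifs; exacts [mp_nn ha hb hc _ _ _ _, le_rfl]

lemma tm_nn (ha : 0 ≤ a) (hb : 0 ≤ b) (hc : 0 ≤ c) (N n : ℕ) (η η' : Row N) : 0 ≤ sec n (tmat (wM a b c c) N) η η' := by
  unfold sec tmat Matrix.trace; split_ifs; exacts [Finset.sum_nonneg fun i _ => mp_nn ha hb hc _ _ _ _, le_rfl]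

lemma tm_AB (N n : ℕ) : sec n (tmat (wM a b c c) N) = AB a b c true N n + AB a b c false N n := by
  ext η η'
  rw [Matrix.add_apply, AB_apply, AB_apply]; unfold sec
  split_ifs
  · rw [tmat, Matrix.trace, Fintype.sum_bool]; rfl
  · simp

/-- link with heights -/
lemma AB_KK {N n : ℕ} (l : ℤ) (η η' : Row N) (h : cnt η = n) : AB a b c true N n η η' =
    if (l - 1) + 2 * (cnt η' : ℤ) - N = (l + 2 * n - N) - 1 then KK a b c (HH N l η) (HH N (l - 1) η') else 0 := by
  rw [AB_apply, mp_KK η η' l true true, HH_last, HH_last, h]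
  simp only [sg, if_true, true_and]
  by_cases h' : cnt η' = n
  · rw [if_pos h', if_pos (by rw [h']; ring), if_pos (by rw [h']; ring)]
  · rw [if_neg h', if_neg (by omega)]

lemma ph2_link (N n : ℕ) (l : ℤ) (m : ℕ) : ∀ η : Row N, cnt η = n →
    ((AB a b c true N n * (AB a b c true N n).transpose) ^ m).mulVec (fun _ => 1) η = ph2 a b c N l (l + 2 * n - N) m (HH N l η) := by
  induction m with
  | zero => intro η _; simp [ph2]
  | succ m ih =>
    intro η hη
    rw [pow_succ', ← Matrix.mulVec_mulVec, ← Matrix.mulVec_mulVec, ph2, sum_PP]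
    simp only [Matrix.mulVec, dotProduct] at ih ⊢
    refine Finset.sum_congr rfl fun η' _ => ?_
    rw [AB_KK l η η' hη, ite_mul, zero_mul]
    by_cases h' : (l - 1) + 2 * (cnt η' : ℤ) - N = (l + 2 * n - N) - 1
    · rw [if_pos h', if_pos h', sum_PP]
      congr 1
      refine Finset.sum_congr rfl fun η'' _ => ?_
      rw [Matrix.transpose_apply]
      by_cases h2 : cnt η'' = n
      · rw [if_pos (by rw [h2]), AB_KK l η'' η' h2, if_pos h']
        congr 1
        exact ih η'' h2
      · rw [if_neg (by omega), AB_apply, if_neg (fun h => h2 h.1), zero_mul]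
    · rw [if_neg h', if_neg h']

lemma ent_ph2 (N n : ℕ) (l : ℤ) {m : ℕ} (hm : m ≠ 0) : ent (pw m (AB a b c true N n)) =
    ∑ x ∈ PP N l (l + 2 * n - N), ph2 a b c N l (l + 2 * n - N) m x := by
  rw [sum_PP, ent]
  refine Finset.sum_congr rfl fun η _ => ?_
  have e : ∑ η', pw m (AB a b c true N n) η η' = ((AB a b c true N n * (AB a b c true N n).transpose) ^ m).mulVec (fun _ => 1) η := by
    simp [Matrix.mulVec, dotProduct, pw]
  rw [e]
  by_cases h : cnt η = n
  · rw [if_pos (by rw [h]), ph2_link N n l m η h]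
  · rw [if_neg (by omega)]
    obtain ⟨m, rfl⟩ := Nat.exists_eq_succ_of_ne_zero hm
    rw [Nat.succ_eq_add_one, pow_succ', ← Matrix.mulVec_mulVec, ← Matrix.mulVec_mulVec]
    refine Finset.sum_eq_zero fun η' _ => ?_
    have e0 : AB a b c true N n η η' = 0 := if_neg (fun h' => h h'.1)
    exact mul_eq_zero_of_left e0 _

lemma AB_logconc (ha : 0 ≤ a) (hb : 0 ≤ b) (hac : a ≤ c) (hbc : b ≤ c) (N n : ℕ) :
    nrm (AB a b c true N n) * nrm (AB a b c true N (n + 2)) ≤ nrm (AB a b c true N (n + 1)) ^ 2 := by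
  have hc := ha.trans hac
  have nn := AB_nn ha hb hc true N
  refine root_le (mul_nonneg (nrm0 _) (nrm0 _)) (sq_nonneg _) (K := ((Fintype.card (Row N) : ℝ) ^ 2) ^ 2) fun j => ?_
  rw [mul_pow, pow_right_comm (nrm _) 2, ← nrm_pw, ← nrm_pw, ← nrm_pw, ← mul_pow]
  refine (mul_le_mul (nrm_le_ent (pw_nn (nn _) _)) (nrm_le_ent (pw_nn (nn _) _)) (nrm0 _) ?_).trans (le_trans ?_ (pow_le_pow_left₀ ?_ (ent_le_nrm _) 2))
  · exact (nrm0 _).trans (nrm_le_ent (pw_nn (nn _) _))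
  · have hm : 2 ^ j ≠ 0 := by positivity
    rw [ent_ph2 N n 2 hm, ent_ph2 N (n + 2) 0 hm, sq]
    nth_rewrite 1 [ent_ph2 N (n + 1) 0 hm]
    rw [ent_ph2 N (n + 1) 2 hm]
    have := FF (N := N) (l := 2) (L := 0) (r := 2 + 2 * n - N) (R := 0 + 2 * ((n + 2 : ℕ) : ℤ) - N) (by decide) (ph2_nn ha hb hc (N := N) 2 (2 + 2 * n - N) (2 ^ j))
      (ph2_nn ha hb hc (N := N) 0 (0 + 2 * ((n + 2 : ℕ) : ℤ) - N) (2 ^ j)) (ph2_nn ha hb hc _ _ _) (ph2_nn ha hb hc _ _ _) (ph2_SM ha hb hac hbc (by decide) (2 ^ j))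
    have e1 : (2 + 2 * (n : ℤ) - N) ⊓ (0 + 2 * ((n + 2 : ℕ) : ℤ) - N) = 0 + 2 * ((n + 1 : ℕ) : ℤ) - N := by push_cast; omega
    have e2 : (2 + 2 * (n : ℤ) - N) ⊔ (0 + 2 * ((n + 2 : ℕ) : ℤ) - N) = 2 + 2 * ((n + 1 : ℕ) : ℤ) - N := by push_cast; omega
    rw [e1, e2] at this
    exact this
  · exact (nrm0 _).trans (nrm_le_ent (pw_nn (nn _) _))

lemma mp_append {M : Bool → Bool → Matrix Bool Bool ℝ} {N N' : ℕ} (η η' : Row N) (ξ ξ' : Row N') :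
    mp M (Fin.append η ξ) (Fin.append η' ξ') = mp M η η' * mp M ξ ξ' := by
  unfold mp
  rw [← List.prod_append, ← List.ofFn_fin_append]
  congr 2
  funext i
  refine Fin.addCases (fun i => ?_) (fun i => ?_) i <;> simp

lemma cnt_append {N N' : ℕ} (η : Row N) (ξ : Row N') : cnt (Fin.append η ξ) = cnt η + cnt ξ := by
  unfold cnt
  simp only [Finset.card_filter, Fin.sum_univ_add, Fin.append_left, Fin.append_right]

lemma append_inj {N N' : ℕ} : Function.Injective fun p : Row N × Row N' => (Fin.append p.1 p.2 : Row (N + N')) := by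
  rintro ⟨x, y⟩ ⟨x', y'⟩ h
  have h : (Fin.append x y : Row (N + N')) = Fin.append x' y' := h
  have h1 : x = x' := by
    funext i; have := congrFun h (Fin.castAdd _ i); rwa [Fin.append_left, Fin.append_left] at this
  have h2 : y = y' := by
    funext i; have := congrFun h (Fin.natAdd _ i); rwa [Fin.append_right, Fin.append_right] at this
  rw [h1, h2]

lemma AB_super (ha : 0 ≤ a) (hb : 0 ≤ b) (hc : 0 ≤ c) (N N' n n' : ℕ) :
    nrm (AB a b c true N n) * nrm (AB a b c true N' n') ≤ nrm (AB a b c true (N + N') (n + n')) := by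
  refine (nrm_kron (AB_nn ha hb hc _ _ _) (AB_nn ha hb hc _ _ _)).trans (nrm_emb append_inj (AB_nn ha hb hc _ _ _)
    (fun i j => mul_nonneg (AB_nn ha hb hc _ _ _ _ _) (AB_nn ha hb hc _ _ _ _ _)) ?_)
  rintro ⟨x, y⟩ ⟨x', y'⟩
  rw [Matrix.kroneckerMap_apply]
  have nn := AB_nn ha hb hc true (N + N') (n + n') (Fin.append x y) (Fin.append x' y')
  by_cases h : cnt x = n ∧ cnt x' = n
  · by_cases h' : cnt y = n' ∧ cnt y' = n'
    · rw [AB_apply, AB_apply, AB_apply, if_pos h, if_pos h', if_pos (by rw [cnt_append, cnt_append, h.1, h'.1, h.2, h'.2]; exact ⟨rfl, rfl⟩),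
        mp_append, Matrix.mul_apply, Fintype.sum_bool]
      exact le_add_of_nonneg_right (mul_nonneg (mp_nn ha hb hc _ _ _ _) (mp_nn ha hb hc _ _ _ _))
    · have : AB a b c true N' n' y y' = 0 := if_neg h'
      rw [this, mul_zero]; exact nn
  · have : AB a b c true N n x x' = 0 := if_neg h
    rw [this, zero_mul]; exact nn

def flp {N : ℕ} (η : Row N) : Row N := fun i => !η i

lemma flp_flp {N : ℕ} (η : Row N) : flp (flp η) = η := by funext i; simp [flp]

lemma flp_inj {N : ℕ} : Function.Injective (flp : Row N → Row N) := fun x y h => by rw [← flp_flp x, h, flp_flp]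

lemma cnt_flp {N : ℕ} (η : Row N) : cnt (flp η) + cnt η = N := by
  unfold cnt flp
  have := Finset.card_filter_add_card_filter_not (s := (Finset.univ : Finset (Fin N))) (fun i => η i = true)
  simp only [Finset.card_univ, Fintype.card_fin] at this
  simpa [add_comm] using this

lemma mp_flp {N : ℕ} (η η' : Row N) : ∀ α β, mp (wM a b c c) (flp η) (flp η') α β = mp (wM a b c c) η η' (!α) (!β) := by
  refine row_ind (P := fun {N} η η' => ∀ α β, mp (wM a b c c) (flp η) (flp η') α β = mp (wM a b c c) η η' (!α) (!β)) ?_ ?_ η η'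
  · intro η η' α β; rw [mp_zero, mp_zero]; cases α <;> cases β <;> simp
  · intro N s s' η η' ih α β
    have h : ∀ (s : Bool) (η : Row N), flp (Fin.cons s η : Row (N + 1)) = Fin.cons (!s) (flp η) := by
      intro s η; funext i; refine Fin.cases ?_ (fun i => ?_) i <;> simp [flp]
    rw [h, h, mp_cons, mp_cons, Matrix.mul_apply, Matrix.mul_apply, Fintype.sum_bool, Fintype.sum_bool, ih, ih]
    cases s <;> cases s' <;> cases α <;> simp [wM]

lemma AB_flp {N n : ℕ} (hn : n ≤ N) (η η' : Row N) (α : Bool) : AB a b c α N (N - n) (flp η) (flp η') = AB a b c (!α) N n η η' := by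
  rw [AB_apply, AB_apply, mp_flp]
  have h1 := cnt_flp η
  have h2 := cnt_flp η'
  congr 1
  apply propext; omega

lemma AB_false (ha : 0 ≤ a) (hb : 0 ≤ b) (hc : 0 ≤ c) {N n : ℕ} (hn : n ≤ N) : nrm (AB a b c false N n) ≤ nrm (AB a b c true N (N - n)) :=
  nrm_emb flp_inj (AB_nn ha hb hc _ _ _) (AB_nn ha hb hc _ _ _) fun η η' => (AB_flp hn η η' true).ge

lemma AB_turn (ha : 0 ≤ a) (hb : 0 ≤ b) (hc : 0 ≤ c) {N n : ℕ} (hn : n ≤ N) : c ^ 2 * nrm (AB a b c true N (N - n)) ≤ nrm (AB a b c true (N + 2) (n + 1)) := by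
  have key : c ^ 2 * nrm (AB a b c true N (N - n)) ≤ nrm (AB a b c true (1 + N + 1) (n + 1)) := by
    rw [← nrm_smul (sq_nonneg c)]
    set f : Bool → Row N → Row (1 + N + 1) := fun s η => Fin.append (Fin.append (fun _ : Fin 1 => s) (flp η)) (fun _ : Fin 1 => !s) with hf
    have finj : ∀ s, Function.Injective (f s) := fun s x y h => by
      have h1 := append_inj (a₁ := (Fin.append (fun _ : Fin 1 => s) (flp x), fun _ : Fin 1 => !s)) (a₂ := (Fin.append (fun _ : Fin 1 => s) (flp y), fun _ : Fin 1 => !s)) h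
      have h2 := append_inj (a₁ := (fun _ : Fin 1 => s, flp x)) (a₂ := (fun _ : Fin 1 => s, flp y)) (Prod.ext_iff.1 h1).1
      exact flp_inj (Prod.ext_iff.1 h2).2
    have one : ∀ s s', mp (wM a b c c) (fun _ : Fin 1 => s) (fun _ : Fin 1 => s') = wM a b c c s s' := fun s s' => by simp [mp]
    have cf : ∀ s η, cnt (f s η) = cnt (flp η) + 1 := fun s η => by
      rw [hf]; simp only [cnt_append]
      cases s <;> simp [cnt] <;> ring
    have M := fun x y => mp_nn ha hb hc (N := N) x y
    refine nrm_emb2 (finj false) (finj true) (AB_nn ha hb hc _ _ _) (fun i j => by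
      rw [Matrix.smul_apply, smul_eq_mul]; exact mul_nonneg (sq_nonneg c) (AB_nn ha hb hc _ _ _ _ _)) fun η η' => ?_
    rw [Matrix.smul_apply, smul_eq_mul, AB_apply, AB_apply, cf, cf]
    have h1 := cnt_flp η
    have h2 := cnt_flp η'
    split_ifs with q1 q2
    · have e : mp (wM a b c c) (f false η) (f true η') true true = c ^ 2 * mp (wM a b c c) η η' true true := by
        rw [hf]
        simp only [mp_append, one, Matrix.mul_apply, Fintype.sum_bool, mp_flp]
        simp [wM]; ring
      rw [e]
    · omega
    · rw [mul_zero]; exact mp_nn ha hb hc _ _ _ _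
    · simp
  rwa [show 1 + N + 1 = N + 2 by ring] at key

lemma tm_le (ha : 0 ≤ a) (hb : 0 ≤ b) (hc : 0 ≤ c) {N n : ℕ} (hn : n ≤ N) : nrm (sec n (tmat (wM a b c c) N)) ≤
    nrm (AB a b c true N n) + nrm (AB a b c true N (N - n)) := by
  rw [tm_AB]; exact (nrm_add _ _).trans (add_le_add le_rfl (AB_false ha hb hc hn))

lemma le_tm (ha : 0 ≤ a) (hb : 0 ≤ b) (hc : 0 ≤ c) {N n : ℕ} : nrm (AB a b c true N n) ≤ nrm (sec n (tmat (wM a b c c) N)) := by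
  refine nrm_mono (AB_nn ha hb hc _ _ _) fun i j => ?_
  rw [tm_AB, Matrix.add_apply]
  exact le_add_of_nonneg_right (AB_nn ha hb hc _ _ _ _ _)

end soft

section numeric

lemma cvx_up {f : ℕ → ℝ} {n : ℕ} (h : ∀ i, i + 2 ≤ n → 2 * f (i + 1) ≤ f i + f (i + 2)) (k : ℕ) (hk : k + 1 ≤ n) :
    f k - f 0 ≤ k * (f (k + 1) - f k) := by
  induction k with
  | zero => simp
  | succ k ih =>
    have h1 := ih (by omega)
    have h2 := h k (by omega)
    push_cast
    nlinarith [mul_le_mul_of_nonneg_left h2 (Nat.cast_nonneg (α := ℝ) k)]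

lemma cvx_dn {f : ℕ → ℝ} {n : ℕ} (h : ∀ i, i + 2 ≤ n → 2 * f (i + 1) ≤ f i + f (i + 2)) (k j : ℕ) (hk : k + 1 + j ≤ n) :
    f (k + 1) - f k ≤ f (k + 1 + j) - f (k + j) ∧ (j + 1) * (f (k + 1) - f k) ≤ f (k + 1 + j) - f k := by
  induction j with
  | zero => simp
  | succ j ih =>
    obtain ⟨h1, h1'⟩ := ih (by omega)
    have h2 := h (k + j) (by omega)
    have e1 : k + 1 + (j + 1) = k + j + 2 := by ring
    have e2 : k + (j + 1) = k + j + 1 := by ring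
    have e3 : k + 1 + j = k + j + 1 := by ring
    rw [e1, e2]
    rw [e3] at h1 h1'
    push_cast
    constructor <;> nlinarith

lemma cvx {f : ℕ → ℝ} {n : ℕ} (h : ∀ i, i + 2 ≤ n → 2 * f (i + 1) ≤ f i + f (i + 2)) (k : ℕ) (hk : k ≤ n) :
    n * f k ≤ (n - k) * f 0 + k * f n := by
  rcases hk.eq_or_lt with rfl | hk
  · simp
  obtain ⟨j, rfl⟩ : ∃ j, n = k + 1 + j := ⟨n - (k + 1), by omega⟩
  have h1 := cvx_up h k (by omega)
  have h2 := (cvx_dn h k j (by omega)).2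
  push_cast
  nlinarith [mul_le_mul_of_nonneg_left h2 (Nat.cast_nonneg (α := ℝ) k), mul_le_mul_of_nonneg_left h1 (by positivity : (0:ℝ) ≤ j + 1)]

lemma numer {d : ℕ → ℤ → ℝ} {κ C : ℝ} (hκ : 0 < κ) (hC : 0 ≤ C)
    (H1 : ∀ (m m' : ℕ) (k k' : ℤ), |k| ≤ m → |k'| ≤ m' → d (m + m') (k + k') ≤ d m k + d m' k')
    (H2 : ∀ (m : ℕ) (k : ℤ), |k| < m → 2 * d m k ≤ d m (k - 1) + d m (k + 1))
    (H3 : ∀ (m : ℕ) (k : ℤ), |k| ≤ m → 2 * κ * |(k : ℝ)| - C ≤ d m k)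
    (H4 : ∀ m : ℕ, d m 0 ≤ C) (H5 : ∀ (m : ℕ) (k : ℤ), |k| ≤ m → d (m + 1) (-k) ≤ d m k + C) :
    ∃ K > 0, ∃ C', 0 ≤ C' ∧ (∀ m k : ℕ, k ≤ m → K * k - C' ≤ d m k ∧ K * k - C' ≤ d m (-k)) ∧
      ∀ ε > 0, ∃ δ > 0, ∀ m k : ℕ, k ≤ m → (k : ℝ) ≤ δ * m → d m k ≤ (K + ε) * k + C' := by
  set S : Set ℝ := {x | ∃ m k : ℕ, 1 ≤ k ∧ k ≤ m ∧ x = (d m k + C) / k} with hS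
  have lb : ∀ x ∈ S, 2 * κ ≤ x := by
    rintro x ⟨m, k, h1, h2, rfl⟩
    have hk : (0:ℝ) < k := by exact_mod_cast h1
    rw [le_div_iff₀ hk]
    have := H3 m k (by rw [Nat.abs_cast]; exact_mod_cast h2)
    rw [Int.cast_natCast, Nat.abs_cast] at this; linarith
  have ne : S.Nonempty := ⟨_, 1, 1, le_rfl, le_rfl, rfl⟩
  have bd : BddBelow S := ⟨2 * κ, lb⟩
  have hK : 2 * κ ≤ sInf S := le_csInf ne lb
  have low : ∀ m k : ℕ, k ≤ m → sInf S * k - C ≤ d m k := by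
    intro m k hk
    rcases Nat.eq_zero_or_pos k with rfl | h0
    · have := H3 m 0 (by simp); simp at this ⊢; linarith
    · have h1 := csInf_le bd (show (d m k + C) / k ∈ S from ⟨m, k, h0, hk, rfl⟩)
      rw [le_div_iff₀ (by exact_mod_cast h0)] at h1; linarith
  refine ⟨sInf S, by linarith, 2 * C, by linarith, fun m k hk => ⟨by have := low m k hk; linarith, ?_⟩, fun ε hε => ?_⟩
  · have h1 := low (m + 1) k (by omega)
    have h2 := H5 m (-k) (by rw [abs_neg, Nat.abs_cast]; exact_mod_cast hk)
    rw [neg_neg] at h2; linarith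
  obtain ⟨x, ⟨m1, k1, hk1, hkm, rfl⟩, hx⟩ := exists_lt_of_csInf_lt ne (show sInf S < sInf S + ε by linarith)
  have hk1' : (0:ℝ) < k1 := by exact_mod_cast hk1
  have hm1 : 0 < m1 := by omega
  have hm1' : (0:ℝ) < m1 := by exact_mod_cast hm1
  rw [div_lt_iff₀ hk1'] at hx
  refine ⟨1 / (2 * m1), by positivity, fun m k hkm2 hk => ?_⟩
  rw [div_mul_eq_mul_div, one_mul, le_div_iff₀ (by positivity)] at hk
  have hk : k * (2 * m1) ≤ m := by exact_mod_cast hk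
  rcases Nat.eq_zero_or_pos k with rfl | h0
  · have := H4 m; simp; linarith
  have hmm : m1 ≤ m := by nlinarith
  have hq : ∀ q : ℕ, d ((q + 1) * m1) ((q + 1 : ℕ) * k1 : ℤ) ≤ (q + 1) * d m1 k1 := by
    intro q
    induction q with
    | zero => simp
    | succ q ih =>
      have := H1 ((q + 1) * m1) m1 ((q + 1 : ℕ) * k1) k1 (by
        rw [← Nat.cast_mul, Nat.abs_cast]; exact_mod_cast Nat.mul_le_mul_left _ hkm) (by rw [Nat.abs_cast]; exact_mod_cast hkm)
      rw [show (q + 1 + 1) * m1 = (q + 1) * m1 + m1 by ring, show ((q + 1 + 1 : ℕ) * k1 : ℤ) = (q + 1 : ℕ) * k1 + k1 by push_cast; ring]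
      push_cast at *; linarith
  obtain ⟨q, hq0⟩ : ∃ q, m / m1 = q + 1 := ⟨m / m1 - 1, by have := Nat.div_pos hmm hm1; omega⟩
  set n := (q + 1) * k1 with hn
  have hr := Nat.div_add_mod m m1
  have hr2 := Nat.mod_lt m hm1
  rw [hq0] at hr
  set r := m % m1
  have hnm : n ≤ m := by nlinarith
  have hkn : k ≤ n := by
    have h1 : m < m1 * (q + 2) := by nlinarith
    have h2 : 2 * k < q + 2 := by nlinarith
    nlinarith
  have hend : d m n ≤ (sInf S + ε) * n + C := by
    have h1 := H1 ((q + 1) * m1) r ((q + 1 : ℕ) * k1) 0 (by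
        rw [← Nat.cast_mul, Nat.abs_cast]; exact_mod_cast Nat.mul_le_mul_left _ hkm) (by simp)
    rw [add_zero, show (q + 1) * m1 + r = m by rw [← hr]; ring] at h1
    have h2 := hq q
    have h3 := H4 r
    have h4 : ((q:ℝ) + 1) * d m1 k1 ≤ (q + 1) * ((sInf S + ε) * k1) := mul_le_mul_of_nonneg_left (by linarith) (by positivity)
    rw [hn]; push_cast at *; linarith
  have hc := cvx (f := fun i : ℕ => d m i) (n := n) (fun i hi => by
    have := H2 m (i + 1 : ℕ) (by rw [Nat.abs_cast]; exact_mod_cast (by omega : i + 1 < m))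
    rw [show ((i + 1 : ℕ) : ℤ) - 1 = i by push_cast; ring, show ((i + 1 : ℕ) : ℤ) + 1 = (i + 2 : ℕ) by push_cast; ring] at this
    exact this) k hkn
  have hn0 : (0:ℝ) < n := by exact_mod_cast (lt_of_lt_of_le h0 hkn)
  have hkn' : (k:ℝ) ≤ n := by exact_mod_cast hkn
  have h4 := H4 m
  have : (n:ℝ) * d m k ≤ n * ((sInf S + ε) * k + 2 * C) := by
    have e1 : ((n:ℝ) - k) * d m (0 : ℕ) ≤ n * C := by
      have : ((n:ℝ) - k) * d m (0 : ℕ) ≤ ((n:ℝ) - k) * C := mul_le_mul_of_nonneg_left (by simpa using h4) (by linarith)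
      nlinarith [mul_nonneg (Nat.cast_nonneg (α := ℝ) k) hC]
    have e2 : (k:ℝ) * d m n ≤ k * ((sInf S + ε) * n + C) := mul_le_mul_of_nonneg_left hend (by positivity)
    nlinarith [mul_le_mul_of_nonneg_right hkn' hC]
  exact le_of_mul_le_mul_left this hn0

end numeric

section bulk
open scoped Matrix.Norms.L2Operator

lemma TT_real (ζ v : ℝ) (N n : ℕ) : nrm (sec n (tmat (wM (Real.sinh (ζ - v)) (Real.sinh v) (Real.sinh ζ) (Real.sinh ζ)) N)) =
    ‖sec n (TT ζ N v)‖ := by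
  unfold nrm TT
  congr 1
  have : ∀ s s', wM (Complex.sinh (ζ - v)) (Complex.sinh v) (Complex.sinh ζ) (Complex.sinh ζ) s s' =
      (wM (Real.sinh (ζ - v)) (Real.sinh v) (Real.sinh ζ) (Real.sinh ζ) s s').map Complex.ofRealHom := by
    intro s s'; ext α β
    rw [Matrix.map_apply]
    simp only [wM]
    split_ifs <;> simp
  rw [show wM (Complex.sinh (ζ - v)) (Complex.sinh v) (Complex.sinh ζ) (Complex.sinh ζ) = _ from funext fun s => funext fun s' => this s s', tmat_map]
  ext η η'
  simp only [sec, Matrix.map_apply]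
  split_ifs <;> simp

lemma AB_pos {a b c : ℝ} (ha : 0 < a) (hb : 0 < b) (hc : 0 < c) {N n : ℕ} (hn : n ≤ N) : 0 < nrm (AB a b c true N n) := by
  have e : ∀ (N n : ℕ) (η η' : Row N), AB a b c true N n η η' ≤ nrm (AB a b c true N n) := fun N n η η' => by
    have := entry_le ((AB a b c true N n).map Complex.ofRealHom) η η'
    rw [Matrix.map_apply, Complex.ofRealHom_eq_coe, Complex.norm_real] at this
    exact (le_abs_self _).trans this
  induction N generalizing n with
  | zero =>
    obtain rfl : n = 0 := by omega
    refine lt_of_lt_of_le ?_ (e 0 0 (fun _ => true) fun _ => true)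
    rw [AB_apply, if_pos (by simp [cnt]), mp_zero]; simp
  | succ N ih =>
    have one : ∀ s s', mp (wM a b c c) (fun _ : Fin 1 => s) (fun _ : Fin 1 => s') = wM a b c c s s' := fun s s' => by simp [mp]
    rcases Nat.lt_or_ge N n with h | h
    · have h1 : 0 < nrm (AB a b c true 1 1) := by
        refine lt_of_lt_of_le ?_ (e 1 1 (fun _ => true) fun _ => true)
        rw [AB_apply, if_pos (by simp [cnt]), one]; simpa [wM] using ha
      obtain rfl : n = N + 1 := by omega
      exact (mul_pos (ih le_rfl) h1).trans_le (AB_super ha.le hb.le hc.le N 1 N 1)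
    · have h1 : 0 < nrm (AB a b c true 1 0) := by
        refine lt_of_lt_of_le ?_ (e 1 0 (fun _ => false) fun _ => false)
        rw [AB_apply, if_pos (by simp [cnt]), one]; simpa [wM] using hb
      exact (mul_pos (ih h) h1).trans_le (AB_super ha.le hb.le hc.le N 1 n 0)

lemma bulk {ζ v : ℝ} (hv : 0 < v) (hv1 : v < ζ) : ∃ K > 0, ∃ C', 0 ≤ C' ∧
    ∀ ε > 0, ∃ δ > 0, ∀ N n : ℕ, Even N → 0 < N → 2 * n ≤ N → (1:ℝ) / 2 - n / N ≤ δ →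
    |Real.log ‖sec n (TT ζ N v)‖ / N - Real.log ‖EE ζ v‖ + K * (1 - 2 * n / N)| ≤ ε * (1 - 2 * n / N) + C' / N := by
  have hζ : 0 < ζ := hv.trans hv1
  set a := Real.sinh (ζ - v) with ha'
  set b := Real.sinh v with hb'
  set c := Real.sinh ζ with hc'
  have ha : 0 < a := Real.sinh_pos_iff.2 (by linarith)
  have hb : 0 < b := Real.sinh_pos_iff.2 hv
  have hc : 0 < c := Real.sinh_pos_iff.2 hζ
  have hac : a ≤ c := Real.sinh_le_sinh.2 (by linarith)
  have hbc : b ≤ c := Real.sinh_le_sinh.2 hv1.le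
  set g : ℕ → ℕ → ℝ := fun N n => nrm (AB a b c true N n) with hg
  have gpos : ∀ {N n : ℕ}, n ≤ N → 0 < g N n := fun h => AB_pos ha hb hc h
  have gT : ∀ N n, g N n ≤ ‖sec n (TT ζ N v)‖ := fun N n => (le_tm ha.le hb.le hc.le).trans_eq (TT_real ζ v N n)
  have Tg : ∀ {N n : ℕ}, n ≤ N → ‖sec n (TT ζ N v)‖ ≤ g N n + g N (N - n) := fun h => (TT_real ζ v _ _).symm.trans_le (tm_le ha.le hb.le hc.le h)
  have hE : 0 < ‖EE ζ v‖ := norm_pos_iff.2 (EE_ne ζ v)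
  set F := Real.log ‖EE ζ v‖ with hF
  obtain ⟨κ, hκ, C1, hC1, hE2⟩ := E2 hv hv1
  obtain ⟨N0, hE1⟩ := E1 hζ
  set d : ℕ → ℤ → ℝ := fun m k => 2 * m * F - Real.log (g (2 * m) (m - k).toNat) with hd
  set C := |Real.log C1| + |2 * F - 2 * Real.log c| + Real.log 4 + |d 0 0| + ∑ m ∈ Finset.range N0, |d m 0| with hCd
  have hl4 : 0 ≤ Real.log 4 := Real.log_nonneg (by norm_num)
  have hsum : 0 ≤ ∑ m ∈ Finset.range N0, |d m 0| := Finset.sum_nonneg fun _ _ => abs_nonneg _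
  have q1 := abs_nonneg (Real.log C1)
  have q2 := abs_nonneg (2 * F - 2 * Real.log c)
  have q3 := abs_nonneg (d 0 0)
  obtain ⟨K, hK, C', hC', hlow, hup⟩ := numer (d := d) (κ := κ) (C := C) hκ (by positivity)
    (fun m m' k k' hk hk' => by
      rw [abs_le] at hk hk'
      have h := AB_super ha.le hb.le hc.le (2 * m) (2 * m') (m - k).toNat (m' - k').toNat
      have h := Real.log_le_log (mul_pos (gpos (by omega)) (gpos (by omega))) h
      rw [Real.log_mul (gpos (by omega)).ne' (gpos (by omega)).ne', show 2 * m + 2 * m' = 2 * (m + m') by ring,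
        show (m - k).toNat + (m' - k').toNat = (((m + m' : ℕ) : ℤ) - (k + k')).toNat by omega] at h
      simp only [hd, hg]; push_cast at *; linarith)
    (fun m k hk => by
      rw [abs_lt] at hk
      have h := AB_logconc ha.le hb.le hac hbc (2 * m) (m - (k + 1)).toNat
      have h := Real.log_le_log (mul_pos (gpos (by omega)) (gpos (by omega))) h
      rw [Real.log_mul (gpos (by omega)).ne' (gpos (by omega)).ne', Real.log_pow,
        show (m - (k + 1)).toNat + 1 = (m - k).toNat by omega, show (m - (k + 1)).toNat + 2 = (m - (k - 1)).toNat by omega] at h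
      simp only [hd, hg]; push_cast at *; linarith)
    (fun m k hk => by
      rcases Nat.eq_zero_or_pos m with rfl | hm
      · obtain rfl : k = 0 := by simpa using hk
        have := neg_abs_le (d 0 0)
        simp; linarith
      rw [abs_le] at hk
      have h := (gT (2 * m) (m - k).toNat).trans (hE2 (2 * m) (m - k).toNat (even_two_mul m) (by omega) (by omega))
      have h := Real.log_le_log (gpos (by omega)) h
      rw [Real.log_mul (by positivity) (by positivity), Real.log_mul hC1.ne' (Real.exp_pos _).ne', Real.log_exp, Real.log_pow] at h
      have e : (((m - k).toNat : ℕ) : ℝ) = m - k := by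
        have : (((m - k).toNat : ℕ) : ℤ) = m - k := by omega
        exact_mod_cast this
      rw [e, show ((2 * m : ℕ) : ℝ) - 2 * (m - k) = 2 * k by push_cast; ring, abs_mul, abs_two] at h
      have := le_abs_self (Real.log C1)
      simp only [hd]; push_cast at *; linarith)
    (fun m => by
      rcases Nat.lt_or_ge m N0 with hm | hm
      · have := Finset.single_le_sum (f := fun m => |d m 0|) (fun _ _ => abs_nonneg _) (Finset.mem_range.2 hm)
        have h2 := le_abs_self (d m 0)
        linarith
      · have h := (hE1 m hm v hv.le hv1.le).trans (Tg (by omega))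
        rw [show 2 * m - m = m by omega] at h
        have h : ‖EE ζ v‖ ^ (2 * m) / 4 ≤ g (2 * m) m := by linarith
        have h := Real.log_le_log (by positivity) h
        rw [Real.log_div (by positivity) (by norm_num), Real.log_pow] at h
        simp only [hd, sub_zero, Int.toNat_natCast]; push_cast at *; linarith)
    (fun m k hk => by
      rw [abs_le] at hk
      have h := AB_turn ha.le hb.le hc.le (N := 2 * m) (n := (m + k).toNat) (by omega)
      rw [show 2 * m - (m + k).toNat = (m - k).toNat by omega] at h
      have h := Real.log_le_log (mul_pos (by positivity) (gpos (by omega))) h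
      rw [Real.log_mul (by positivity) (gpos (by omega)).ne', Real.log_pow, show 2 * m + 2 = 2 * (m + 1) by ring,
        show (m + k).toNat + 1 = (((m + 1 : ℕ) : ℤ) - -k).toNat by omega] at h
      have := le_abs_self (2 * F - 2 * Real.log c)
      simp only [hd, hg]; push_cast at *; linarith)
  have hl2 : 0 ≤ Real.log 2 := Real.log_nonneg (by norm_num)
  refine ⟨K / 2, by positivity, C' + Real.log 2, by positivity, fun ε hε => ?_⟩
  obtain ⟨δ, hδ, hup⟩ := hup (2 * ε) (by positivity)
  refine ⟨δ / 2, by positivity, fun N n hN hN0 hn hnδ => ?_⟩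
  obtain ⟨m, rfl⟩ := hN.two_dvd
  obtain ⟨k, rfl⟩ : ∃ k, m = n + k := ⟨m - n, by omega⟩
  set m := n + k with hm
  have hm0 : (0:ℝ) < m := by exact_mod_cast (by omega : 0 < m)
  have hmr : (m:ℝ) = n + k := by rw [hm]; push_cast; ring
  have hx : (1:ℝ) - 2 * n / (2 * m : ℕ) = k / m := by push_cast; rw [eq_div_iff hm0.ne']; field_simp; linarith
  have hkδ : (k:ℝ) ≤ δ * m := by
    have : (k:ℝ) / m ≤ δ := by rw [← hx]; linarith [show (2:ℝ) * n / (2 * m : ℕ) = 2 * (n / (2 * m : ℕ)) by ring]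
    rwa [div_le_iff₀ hm0] at this
  have l1 := hlow m k (by omega)
  have l2 := hup m k (by omega) hkδ
  simp only [hd] at l1 l2
  rw [show ((m:ℤ) - (k:ℤ)).toNat = n by omega] at l1 l2
  rw [show ((m:ℤ) - -(k:ℤ)).toNat = 2 * m - n by omega] at l1
  have p1 : 0 < g (2 * m) n := gpos (by omega)
  have p2 : 0 < g (2 * m) (2 * m - n) := gpos (by omega)
  set L := Real.log ‖sec n (TT ζ (2 * m) v)‖ with hL
  have L1 : Real.log (g (2 * m) n) ≤ L := Real.log_le_log p1 (gT _ _)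
  have L2 : L ≤ 2 * m * F - K * k + C' + Real.log 2 := by
    have e1 : g (2 * m) n ≤ Real.exp (2 * m * F - K * k + C') := by rw [← Real.log_le_iff_le_exp p1]; linarith
    have e2 : g (2 * m) (2 * m - n) ≤ Real.exp (2 * m * F - K * k + C') := by rw [← Real.log_le_iff_le_exp p2]; linarith
    rw [hL, Real.log_le_iff_le_exp (p1.trans_le (gT _ _)), Real.exp_add _ (Real.log 2), Real.exp_log two_pos]
    linarith [Tg (N := 2 * m) (n := n) (by omega)]
  rw [hx, show L / (2 * m : ℕ) - F + K / 2 * (k / m) = (L - 2 * m * F + K * k) / (2 * m) by push_cast; field_simp,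
    show ε * (k / m) + (C' + Real.log 2) / (2 * m : ℕ) = (2 * ε * k + C' + Real.log 2) / (2 * m) by push_cast; field_simp; ring,
    abs_div, abs_of_pos (by positivity : (0:ℝ) < 2 * m)]
  refine div_le_div_of_nonneg_right (abs_le.2 ⟨?_, ?_⟩) (by positivity)
  · linarith
  · have : 0 ≤ 2 * ε * k := by positivity
    linarith

end bulk

section partition
open Set

lemma sum_cons {D A : Type*} [Fintype D] [AddCommMonoid A] {N : ℕ} (f : (Fin (N + 1) → D) → A) :
    ∑ h, f h = ∑ s, ∑ h : Fin N → D, f (Fin.cons s h) := by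
  rw [← (Fin.consEquiv (fun _ : Fin (N+1) => D)).sum_comp, Fintype.sum_prod_type]
  rfl

lemma ofFn_entry {D : Type*} [Fintype D] [DecidableEq D] {N : ℕ} (A : Fin N → Matrix D D ℝ) : ∀ α β,
    (List.ofFn A).prod α β = ∑ h : Fin N → D, (∏ i, A i ((Fin.cons α h : Fin (N + 1) → D) i.castSucc) (h i)) *
      if (Fin.cons α h : Fin (N + 1) → D) (Fin.last N) = β then 1 else 0 := by
  induction N with
  | zero =>
    intro α β
    simp [Matrix.one_apply]
  | succ N ih =>
    intro α β
    rw [List.ofFn_succ, List.prod_cons, Matrix.mul_apply, sum_cons]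
    refine Finset.sum_congr rfl fun γ _ => ?_
    rw [ih, Finset.mul_sum]
    refine Finset.sum_congr rfl fun h _ => ?_
    rw [Fin.prod_univ_succ, cons_last, mul_assoc]
    simp only [Fin.castSucc_zero, Fin.cons_zero, Fin.cons_succ, ← Fin.succ_castSucc]

lemma trace_ofFn {D : Type*} [Fintype D] [DecidableEq D] {N : ℕ} (hN : 0 < N) (A : Fin N → Matrix D D ℝ) :
    (List.ofFn A).prod.trace = ∑ h : Fin N → D, ∏ i, A i (h (predF i)) (h i) := by
  obtain ⟨N, rfl⟩ : ∃ m, N = m + 1 := ⟨N - 1, by omega⟩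
  rw [Matrix.trace]
  simp only [Matrix.diag, ofFn_entry]
  rw [Finset.sum_comm]
  refine Finset.sum_congr rfl fun h _ => ?_
  rw [Finset.sum_eq_single (h (Fin.last N))]
  · rw [cons_last, if_pos rfl, mul_one]
    refine Finset.prod_congr rfl fun i _ => ?_
    congr 1
    refine Fin.cases ?_ (fun i => ?_) i
    · rw [Fin.castSucc_zero, Fin.cons_zero]
      congr 1
      apply Fin.ext; simp [predF]
    · rw [← Fin.succ_castSucc, Fin.cons_succ]
      congr 1
      apply Fin.ext; simp [predF]
      rw [show (i:ℕ) + 1 + N = i + (N + 1) by ring, Nat.add_mod_right, Nat.mod_eq_of_lt (by omega)]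
  · intro α _ hα
    rw [cons_last, if_neg (fun h => hα h.symm), mul_zero]
  · simp

def Tr (a b c : ℝ) (N : ℕ) : Matrix (Row N) (Row N) ℝ := tmat (wM a b c c) N

lemma vw_eq {a b c : ℝ} {N M : ℕ} (ω : Cfg N M) (v : Fin N × Fin M) : (if inArrows ω v = 2 then vWeight a b c ω v else 0) =
    wM a b c c (ω.2 (v.1, predF v.2)) (ω.2 v) (ω.1 (predF v.1, v.2)) (ω.1 v) := by
  unfold inArrows vWeight wM
  cases ω.2 (v.1, predF v.2) <;> cases ω.2 v <;> cases ω.1 (predF v.1, v.2) <;> cases ω.1 v <;> simp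

lemma part_eq {a b c : ℝ} {N M : ℕ} (hN : 0 < N) (hM : 0 < M) (S : Row N → Prop) [DecidablePred S] :
    (∑ ω : Cfg N M, if IsSixVertex ω ∧ (∀ j, S fun i => ω.2 (i, j)) then W a b c ω else 0) =
      ((Matrix.of fun η η' => if S η ∧ S η' then Tr a b c N η η' else 0) ^ M).trace := by
  have h1 := trace_ofFn hM (fun _ => (Matrix.of fun η η' => if S η ∧ S η' then Tr a b c N η η' else 0 : Matrix (Row N) (Row N) ℝ))
  rw [List.ofFn_const, List.prod_replicate] at h1
  rw [h1]
  let e : (Fin M → Row N) ≃ ((Fin N × Fin M) → Bool) :=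
    ⟨fun H v => H v.2 v.1, fun f j i => f (i, j), fun H => rfl, fun f => rfl⟩
  rw [← (Equiv.prodCongr e e).sum_comp, Fintype.sum_prod_type, Finset.sum_comm]
  refine Finset.sum_congr rfl fun H _ => ?_
  by_cases hS : ∀ j, S (H j)
  · have : ∀ j, (Matrix.of fun η η' => if S η ∧ S η' then Tr a b c N η η' else 0 : Matrix (Row N) (Row N) ℝ) (H (predF j)) (H j) =
        ∑ h : Row N, ∏ i, wM a b c c (H (predF j) i) (H j i) (h (predF i)) (h i) := by
      intro j
      rw [Matrix.of_apply, if_pos ⟨hS _, hS _⟩, Tr, tmat, mp, trace_ofFn hN]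
    simp only [this]
    rw [Finset.prod_univ_sum, Fintype.piFinset_univ]
    refine Finset.sum_congr rfl fun h _ => ?_
    have hp : ∏ j, ∏ i, wM a b c c (H (predF j) i) (H j i) (h j (predF i)) (h j i) =
        ∏ v : Fin N × Fin M, (if inArrows (e h, e H) v = 2 then vWeight a b c (e h, e H) v else 0) := by
      simp only [vw_eq]
      rw [Fintype.prod_prod_type, Finset.prod_comm]; rfl
    rw [hp]
    by_cases h6 : IsSixVertex (e h, e H)
    · rw [if_pos]
      · exact Finset.prod_congr rfl fun v _ => (if_pos (h6 v)).symm
      · exact ⟨h6, hS⟩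
    · rw [if_neg (fun h => h6 h.1)]
      unfold IsSixVertex at h6
      push Not at h6
      obtain ⟨v, hv⟩ := h6
      exact (Finset.prod_eq_zero (Finset.mem_univ v) (if_neg hv)).symm
  · have hS0 := hS
    push Not at hS
    obtain ⟨j, hj⟩ := hS
    rw [Finset.prod_eq_zero (Finset.mem_univ j)]
    · exact Finset.sum_eq_zero fun h _ => if_neg fun hh => hS0 hh.2
    · rw [Matrix.of_apply, if_neg fun hh => hj hh.2]

lemma Zn_eq {a b c : ℝ} {N M : ℕ} (hN : 0 < N) (hM : 0 < M) (n : ℕ) : Zn N M n a b c = (sec n (Tr a b c N) ^ M).trace :=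
  part_eq hN hM (fun η => cnt η = n)

lemma sec_pow {N : ℕ} (n : ℕ) {T : Matrix (Row N) (Row N) ℝ} (h : ∀ η η', T η η' ≠ 0 → cnt η = cnt η') (M : ℕ) :
    sec n T ^ (M + 1) = sec n (T ^ (M + 1)) := by
  induction M with
  | zero => simp
  | succ M ih => rw [pow_succ', ih, sec_mul _ _ _ h, ← pow_succ']

lemma Z_eq {a b c : ℝ} {N M : ℕ} (hN : 0 < N) (hM : 0 < M) : Z N M a b c = ∑ n ∈ Finset.range (N + 1), Zn N M n a b c := by
  have h1 := part_eq (a := a) (b := b) (c := c) hN hM (fun _ => True)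
  simp only [implies_true, and_true, if_true] at h1
  rw [Z, h1]
  rw [Finset.sum_congr rfl fun n _ => Zn_eq hN hM n]
  obtain ⟨M, rfl⟩ : ∃ m, M = m + 1 := ⟨M - 1, by omega⟩
  have hi : ∀ n, (sec n (Tr a b c N) ^ (M + 1)).trace = ∑ η : Row N, if n = cnt η then (Tr a b c N ^ (M + 1)) η η else 0 := fun n => by
    rw [sec_pow n (T := Tr a b c N) (fun η η' h => tmat_ice h)]
    refine Finset.sum_congr rfl fun η _ => ?_
    simp only [Matrix.diag, sec, and_self, eq_comm]
  rw [Finset.sum_congr rfl fun n _ => hi n, Finset.sum_comm]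
  refine Finset.sum_congr rfl fun η _ => ?_
  rw [Finset.sum_ite_eq' , if_pos (Finset.mem_range.2 (Nat.lt_succ_of_le (cnt_le η)))]
  rfl

end partition

section growth
open Set
open scoped Matrix Matrix.Norms.L2Operator

lemma nrm_pow_ge {n : Type*} [Fintype n] [DecidableEq n] {X : Matrix n n ℂ} (hX : X * Xᴴ = Xᴴ * X) {j : ℕ} (hj : j ≠ 0) : ‖X‖ ^ j ≤ ‖X ^ j‖ := by
  by_cases h0 : X = 0
  · rw [h0, norm_zero, zero_pow hj]; exact norm_nonneg _
  set Y : Bool → Matrix n n ℂ := fun s => if s then X else Xᴴ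
  have hY : ∀ s s', Commute (Y s) (Y s') := by
    intro s s'; cases s <;> cases s'
    exacts [Commute.refl _, hX.symm, hX, Commute.refl _]
  obtain ⟨ψ, h1, Λ, h2, h3, h4⟩ := norm_eig (fun p : Bool × ℕ => Y p.1 ^ p.2) (fun p q => (hY p.1 q.1).pow_pow p.2 q.2) (true, 1) (false, 1)
    (by simp [Y]) (by simpa [Y] using h0)
  simp only [pow_one] at h4
  have e : ∀ j : ℕ, (X ^ j).mulVec ψ = Λ (true, 1) ^ j • ψ := by
    intro j
    induction j with
    | zero => simp
    | succ j ih =>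
      have h5 := h2 (true, 1)
      simp only [Y, if_true, pow_one] at h5
      rw [pow_succ, ← Matrix.mulVec_mulVec, h5, Matrix.mulVec_smul, ih, smul_smul, pow_succ']
  have h6 := h2 (true, j)
  simp only [Y, if_true] at h6
  rw [e] at h6
  have h7 : Λ (true, 1) ^ j = Λ (true, j) := by
    have := congrArg (fun φ => star ψ ⬝ᵥ φ) h6
    simpa [dotProduct_smul, h1] using this
  have h8 := h3 (true, j)
  rw [← h7, norm_pow, h4] at h8
  simpa [Y] using h8

variable {a b c : ℝ}

lemma wM_pos (ha : 0 < a) (hb : 0 < b) (hc : 0 < c) {s s' α β : Bool} (h : α.toNat + s.toNat = β.toNat + s'.toNat) :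
    0 < wM a b c c s s' α β := by
  revert h; unfold wM; cases s <;> cases s' <;> cases α <;> cases β <;> simp [ha, hb, hc]

lemma Tr_pos (ha : 0 < a) (hb : 0 < b) (hc : 0 < c) {N : ℕ} (hN : 0 < N) {η η' : Row N} (h : Row N)
    (hi : ∀ i, (h (predF i)).toNat + (η i).toNat = (h i).toNat + (η' i).toNat) : 0 < Tr a b c N η η' := by
  rw [Tr, tmat, mp, trace_ofFn hN]
  exact Finset.sum_pos' (fun h _ => Finset.prod_nonneg fun i _ => wM_nn ha.le hb.le hc.le _ _ _ _)
    ⟨h, Finset.mem_univ _, Finset.prod_pos fun i _ => wM_pos ha hb hc (hi i)⟩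

lemma Tr_nn (ha : 0 < a) (hb : 0 < b) (hc : 0 < c) (N : ℕ) (η η' : Row N) : 0 ≤ Tr a b c N η η' := by
  unfold Tr tmat Matrix.trace; exact Finset.sum_nonneg fun i _ => mp_nn ha.le hb.le hc.le _ _ _ _

lemma pos_mul {ι : Type*} [Fintype ι] [DecidableEq ι] {B C : Matrix ι ι ℝ} (hB : ∀ i j, 0 ≤ B i j) (hC : ∀ i j, 0 ≤ C i j) {i j k : ι}
    (h : 0 < B i j) (h' : 0 < C j k) : 0 < (B * C) i k := by
  rw [Matrix.mul_apply]
  exact Finset.sum_pos' (fun x _ => mul_nonneg (hB _ _) (hC _ _)) ⟨j, Finset.mem_univ _, mul_pos h h'⟩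

lemma Tr_swap (ha : 0 < a) (hb : 0 < b) (hc : 0 < c) {m : ℕ} (i : Fin m) (η : Row (m + 1)) :
    0 < Tr a b c (m + 1) η (η ∘ Equiv.swap i.castSucc i.succ) := by
  by_cases h : η i.castSucc = η i.succ
  · have : η ∘ Equiv.swap i.castSucc i.succ = η := by
      funext j
      simp only [Function.comp]
      by_cases h1 : j = i.castSucc
      · rw [h1, Equiv.swap_apply_left, h]
      by_cases h2 : j = i.succ
      · rw [h2, Equiv.swap_apply_right, h]
      rw [Equiv.swap_apply_of_ne_of_ne h1 h2]
    rw [this]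
    exact Tr_pos ha hb hc (Nat.succ_pos _) (fun _ => true) fun i => rfl
  · have pf : ∀ j : Fin (m + 1), predF j = i.castSucc ↔ j = i.succ := by
      intro j
      rw [Fin.ext_iff, Fin.ext_iff]
      simp only [predF, Fin.val_castSucc, Fin.val_succ, Nat.add_sub_cancel]
      have := j.2
      have := i.2
      rcases Nat.eq_zero_or_pos (j:ℕ) with h0 | h0
      · rw [h0, Nat.zero_add, Nat.mod_eq_of_lt (by omega)]; omega
      · rw [show (j:ℕ) + m = (j - 1) + (m + 1) by omega, Nat.add_mod_right, Nat.mod_eq_of_lt (by omega)]; omega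
    have ne : i.castSucc ≠ i.succ := (Fin.castSucc_lt_succ).ne
    refine Tr_pos ha hb hc (Nat.succ_pos _) (fun j => if j = i.castSucc then !η i.succ else η i.succ) fun j => ?_
    simp only [pf, Function.comp]
    by_cases h1 : j = i.castSucc
    · subst h1
      rw [Equiv.swap_apply_left, if_neg ne, if_pos rfl]
      revert h; cases η i.castSucc <;> cases η i.succ <;> simp
    by_cases h2 : j = i.succ
    · subst h2
      rw [Equiv.swap_apply_right, if_neg ne.symm, if_pos rfl]
      revert h; cases η i.castSucc <;> cases η i.succ <;> simp
    rw [Equiv.swap_apply_of_ne_of_ne h1 h2, if_neg h1, if_neg h2]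

lemma Tr_reach (ha : 0 < a) (hb : 0 < b) (hc : 0 < c) {m : ℕ} (σ : Equiv.Perm (Fin (m + 1))) : ∀ η : Row (m + 1), ∃ k, 0 < (Tr a b c (m + 1) ^ k) η (η ∘ σ) := by
  have nn := Tr_nn ha hb hc (m + 1)
  have h : σ ∈ Submonoid.closure (Set.range fun i : Fin m ↦ Equiv.swap i.castSucc i.succ) := by
    rw [Equiv.Perm.mclosure_swap_castSucc_succ]; trivial
  induction h using Submonoid.closure_induction with
  | mem σ h =>
    obtain ⟨i, rfl⟩ := h
    intro η; exact ⟨1, by rw [pow_one]; exact Tr_swap ha hb hc i η⟩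
  | one => intro η; exact ⟨0, by simp⟩
  | mul σ τ _ _ h1 h2 =>
    intro η
    obtain ⟨k, hk⟩ := h1 η
    obtain ⟨k', hk'⟩ := h2 (η ∘ σ)
    exact ⟨k + k', by rw [pow_add]; exact pos_mul (pow_nn nn _) (pow_nn nn _) hk hk'⟩

lemma exists_perm {N : ℕ} {η η' : Row N} (h : cnt η = cnt η') : ∃ σ : Equiv.Perm (Fin N), η' = η ∘ σ := by
  have e : {i // η' i = true} ≃ {i // η i = true} := Fintype.equivOfCardEq (by
    rw [Fintype.card_subtype, Fintype.card_subtype]; exact h.symm)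
  refine ⟨e.extendSubtype, ?_⟩
  funext i
  by_cases hi : η' i = true
  · rw [hi]; exact (e.extendSubtype_mem i hi).symm
  · have := e.extendSubtype_not_mem i hi
    simp only [Bool.not_eq_true] at hi this
    rw [hi]; exact this.symm

lemma Tr_irr (ha : 0 < a) (hb : 0 < b) (hc : 0 < c) {N : ℕ} (hN : 0 < N) : ∃ R, ∃ c0 > 0, ∀ η η' : Row N, cnt η = cnt η' → c0 ≤ (Tr a b c N ^ R) η η' := by
  obtain ⟨m, rfl⟩ : ∃ m, N = m + 1 := ⟨N - 1, by omega⟩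
  have nn := Tr_nn ha hb hc (m + 1)
  have dg : ∀ (k : ℕ) (η : Row (m + 1)), 0 < (Tr a b c (m + 1) ^ k) η η := by
    intro k η
    induction k with
    | zero => simp
    | succ k ih =>
      rw [pow_succ]
      exact pos_mul (pow_nn nn _) nn ih (Tr_pos ha hb hc (Nat.succ_pos _) (fun _ => true) fun i => rfl)
  have h1 : ∀ p : Row (m + 1) × Row (m + 1), ∃ k, cnt p.1 = cnt p.2 → 0 < (Tr a b c (m + 1) ^ k) p.1 p.2 := by
    rintro ⟨η, η'⟩
    by_cases h : cnt η = cnt η'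
    · obtain ⟨σ, rfl⟩ := exists_perm h
      obtain ⟨k, hk⟩ := Tr_reach ha hb hc σ η
      exact ⟨k, fun _ => hk⟩
    · exact ⟨0, fun h' => absurd h' h⟩
  choose k hk using h1
  set R := ∑ p, k p
  have hR : ∀ p : Row (m + 1) × Row (m + 1), cnt p.1 = cnt p.2 → 0 < (Tr a b c (m + 1) ^ R) p.1 p.2 := by
    intro p hp
    have : k p ≤ R := Finset.single_le_sum (fun _ _ => Nat.zero_le _) (Finset.mem_univ p)
    rw [← Nat.add_sub_cancel' this, pow_add]
    exact pos_mul (pow_nn nn _) (pow_nn nn _) (hk p hp) (dg _ _)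
  haveI : Nonempty {p : Row (m + 1) × Row (m + 1) // cnt p.1 = cnt p.2} := ⟨⟨(fun _ => true, fun _ => true), rfl⟩⟩
  obtain ⟨p0, hp0⟩ := Finite.exists_min fun p : {p : Row (m + 1) × Row (m + 1) // cnt p.1 = cnt p.2} => (Tr a b c (m + 1) ^ R) p.1.1 p.1.2
  exact ⟨R, _, hR p0.1 p0.2, fun η η' h => hp0 ⟨(η, η'), h⟩⟩

lemma Tr_growth (ha : 0 < a) (hb : 0 < b) (hc : 0 < c) {N : ℕ} (hN : 0 < N) {n : ℕ} (hn : n ≤ N)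
    (hnorm : Commute ((sec n (Tr a b c N)).map Complex.ofRealHom) ((sec n (Tr a b c N)).map Complex.ofRealHom)ᴴ) :
    0 < nrm (sec n (Tr a b c N)) ∧ ∃ c1 > 0, ∃ D > 0, ∀ᶠ M in atTop, c1 * nrm (sec n (Tr a b c N)) ^ M ≤ Zn N M n a b c ∧
      Zn N M n a b c ≤ D * nrm (sec n (Tr a b c N)) ^ M := by
  have ρ0 : 0 < nrm (sec n (Tr a b c N)) := (AB_pos ha hb hc hn).trans_le (le_tm ha.le hb.le hc.le)
  refine ⟨ρ0, ?_⟩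
  obtain ⟨R, c0, hc0, hR⟩ := Tr_irr ha hb hc hN
  set B := sec n (Tr a b c N) with hB
  set ρ := nrm B
  have Bnn : ∀ η η', 0 ≤ B η η' := tm_nn ha.le hb.le hc.le N n
  have hmap : ∀ M : ℕ, (B ^ M).map Complex.ofRealHom = (B.map Complex.ofRealHom) ^ M := fun M => Matrix.map_pow B Complex.ofRealHom M
  have ice : ∀ η η', Tr a b c N η η' ≠ 0 → cnt η = cnt η' := fun η η' h => tmat_ice h
  refine ⟨c0 / ρ ^ R, by positivity, (Fintype.card (Row N) : ℝ), by
    have : 0 < Fintype.card (Row N) := Fintype.card_pos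
    exact_mod_cast this, ?_⟩
  filter_upwards [eventually_ge_atTop (R + 1)] with M hM
  obtain ⟨j, rfl⟩ : ∃ j, M = (j + 1) + R := ⟨M - (R + 1), by omega⟩
  rw [Zn_eq hN (by omega)]
  constructor
  · have h1 : ρ ^ (j + 1) ≤ ent (B ^ (j + 1)) := by
      refine le_trans ?_ (nrm_le_ent (pow_nn Bnn _))
      have := nrm_pow_ge hnorm (Nat.succ_ne_zero j)
      rw [← hmap] at this; exact this
    have h2 : c0 * ent (B ^ (j + 1)) ≤ (B ^ (j + 1 + R)).trace := by
      rw [show j + 1 + R = j + R + 1 by ring, hB, sec_pow n ice, sec_pow n ice, ent, Finset.mul_sum]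
      refine Finset.sum_le_sum fun η _ => ?_
      rw [Matrix.diag_apply, Finset.mul_sum]
      simp only [sec]
      by_cases h : cnt η = n
      · rw [if_pos ⟨h, h⟩, show j + R + 1 = j + 1 + R by ring, pow_add _ (j + 1) R, Matrix.mul_apply]
        refine Finset.sum_le_sum fun η' _ => ?_
        have nn := pow_nn (Tr_nn ha hb hc N)
        split_ifs with h'
        · rw [mul_comm]; exact mul_le_mul_of_nonneg_left (hR _ _ (h'.2.trans h.symm)) (nn _ _ _)
        · rw [mul_zero]; exact mul_nonneg (nn _ _ _) (nn _ _ _)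
      · rw [if_neg (fun h' => h h'.1)]
        refine (Finset.sum_eq_zero fun η' _ => ?_).le
        rw [if_neg (fun h' => h h'.1), mul_zero]
    calc c0 / ρ ^ R * ρ ^ (j + 1 + R) = c0 * ρ ^ (j + 1) := by rw [pow_add]; field_simp
      _ ≤ c0 * ent (B ^ (j + 1)) := mul_le_mul_of_nonneg_left h1 hc0.le
      _ ≤ _ := h2
  · have h1 : ∀ η, (B ^ (j + 1 + R)) η η ≤ ρ ^ (j + 1 + R) := fun η => by
      have := entry_le ((B ^ (j + 1 + R)).map Complex.ofRealHom) η η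
      rw [Matrix.map_apply, Complex.ofRealHom_eq_coe, Complex.norm_real, hmap] at this
      exact (le_abs_self _).trans (this.trans (norm_pow_le' _ (by omega)))
    refine (Finset.sum_le_sum fun η _ => h1 η).trans ?_
    rw [Finset.sum_const, nsmul_eq_mul, Finset.card_univ]

lemma log_growth {x : ℕ → ℝ} {ρ c1 D : ℝ} (hρ : 0 < ρ) (hc : 0 < c1) (hD : 0 < D) (h : ∀ᶠ M in atTop, c1 * ρ ^ M ≤ x M ∧ x M ≤ D * ρ ^ M) :
    Tendsto (fun M : ℕ => Real.log (x M) / M) atTop (nhds (Real.log ρ)) := by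
  have lim : ∀ C : ℝ, Tendsto (fun M : ℕ => Real.log C / M + Real.log ρ) atTop (nhds (Real.log ρ)) := fun C => by
    simpa using (tendsto_const_div_atTop_nhds_zero_nat (Real.log C)).add_const (Real.log ρ)
  refine tendsto_of_tendsto_of_tendsto_of_le_of_le' (lim c1) (lim D) ?_ ?_
  all_goals
    filter_upwards [h, eventually_gt_atTop 0] with M hM hM0
    have hM0 : (0:ℝ) < M := by exact_mod_cast hM0
    have e : ∀ C, 0 < C → Real.log C / M + Real.log ρ = Real.log (C * ρ ^ M) / M := fun C hC => by
      rw [Real.log_mul hC.ne' (by positivity), Real.log_pow]; field_simp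
  · rw [e _ hc]; exact div_le_div_of_nonneg_right (Real.log_le_log (by positivity) hM.1) hM0.le
  · rw [e _ hD]; exact div_le_div_of_nonneg_right (Real.log_le_log ((by positivity : 0 < c1 * ρ ^ M).trans_le hM.1) hM.2) hM0.le

end growth

section final
open scoped Matrix.Norms.L2Operator
open Matrix

lemma TT_map (ζ v : ℝ) (N n : ℕ) : (sec n (Tr (Real.sinh (ζ - v)) (Real.sinh v) (Real.sinh ζ) N)).map Complex.ofRealHom = sec n (TT ζ N v) := by
  unfold Tr TT
  have : ∀ s s', wM (Complex.sinh (ζ - v)) (Complex.sinh v) (Complex.sinh ζ) (Complex.sinh ζ) s s' =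
      (wM (Real.sinh (ζ - v)) (Real.sinh v) (Real.sinh ζ) (Real.sinh ζ) s s').map Complex.ofRealHom := by
    intro s s'; ext α β
    rw [Matrix.map_apply]
    simp only [wM]
    split_ifs <;> simp
  rw [show wM (Complex.sinh (ζ - v)) (Complex.sinh v) (Complex.sinh ζ) (Complex.sinh ζ) = _ from funext fun s => funext fun s' => this s s', tmat_map]
  ext η η'
  simp only [sec, Matrix.map_apply]
  split_ifs <;> simp

lemma Tr_smul (l a b c : ℝ) (N n : ℕ) : sec n (Tr (l * a) (l * b) (l * c) N) = l ^ N • sec n (Tr a b c N) := by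
  unfold Tr
  have : wM (l * a) (l * b) (l * c) (l * c) = fun s s' => l • wM a b c c s s' := by
    funext s s'; ext α β
    simp only [wM, Matrix.smul_apply, smul_eq_mul]
    split_ifs <;> simp
  rw [this, tmat_smul]
  ext η η'
  simp only [sec, Matrix.smul_apply, smul_eq_mul]
  split_ifs <;> simp

lemma sector_growth {ζ v l : ℝ} (hv : 0 < v) (hv1 : v < ζ) (hl : 0 < l) {N n : ℕ} (hN : 0 < N) (hn : n ≤ N) :
    0 < ‖sec n (TT ζ N v)‖ ∧ ∃ c1 > 0, ∃ D > 0, ∀ᶠ M in atTop,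
      c1 * (l ^ N * ‖sec n (TT ζ N v)‖) ^ M ≤ Zn N M n (l * Real.sinh (ζ - v)) (l * Real.sinh v) (l * Real.sinh ζ) ∧
      Zn N M n (l * Real.sinh (ζ - v)) (l * Real.sinh v) (l * Real.sinh ζ) ≤ D * (l ^ N * ‖sec n (TT ζ N v)‖) ^ M := by
  have hζ : 0 < ζ := hv.trans hv1
  have ha : 0 < l * Real.sinh (ζ - v) := mul_pos hl (Real.sinh_pos_iff.2 (by linarith))
  have hb : 0 < l * Real.sinh v := mul_pos hl (Real.sinh_pos_iff.2 hv)
  have hc : 0 < l * Real.sinh ζ := mul_pos hl (Real.sinh_pos_iff.2 hζ)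
  have hm : (sec n (Tr (l * Real.sinh (ζ - v)) (l * Real.sinh v) (l * Real.sinh ζ) N)).map Complex.ofRealHom =
      ((l ^ N : ℝ) : ℂ) • sec n (TT ζ N v) := by
    rw [Tr_smul, ← TT_map]
    ext η η'
    simp
  have hnr : nrm (sec n (Tr (l * Real.sinh (ζ - v)) (l * Real.sinh v) (l * Real.sinh ζ) N)) = l ^ N * ‖sec n (TT ζ N v)‖ := by
    rw [nrm, hm, norm_smul, Complex.norm_real, Real.norm_of_nonneg (by positivity)]
  have hadj : (sec n (TT ζ N v))ᴴ = sec n (TT ζ N (ζ - star (v:ℂ))) := by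
    rw [← TT_adj]
    ext η η'
    simp only [conjTranspose_apply, sec, and_comm]
    split_ifs <;> simp
  have hice : ∀ u η η', TT ζ N u η η' ≠ 0 → cnt η = cnt η' := fun u η η' h => tmat_ice h
  have hcm : Commute (sec n (TT ζ N v)) (sec n (TT ζ N v))ᴴ := by
    rw [hadj, Commute, SemiconjBy, sec_mul _ _ _ (hice _), sec_mul _ _ _ (hice _), TT_comm hζ.ne']
  have := Tr_growth ha hb hc hN hn (by
    rw [hm, conjTranspose_smul]; exact (hcm.smul_left _).smul_right _)
  rw [hnr] at this
  exact ⟨pos_of_mul_pos_right this.1 (by positivity), this.2⟩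

lemma sector_lim {ζ v l : ℝ} (hv : 0 < v) (hv1 : v < ζ) (hl : 0 < l) {N n : ℕ} (hN : 0 < N) (hn : n ≤ N) :
    SectorFE N n (l * Real.sinh (ζ - v)) (l * Real.sinh v) (l * Real.sinh ζ) (Real.log l + Real.log ‖sec n (TT ζ N v)‖ / N) := by
  obtain ⟨h0, c1, hc1, D, hD, h⟩ := sector_growth hv hv1 hl hN hn
  have := (log_growth (by positivity) hc1 hD h).div_const (N:ℝ)
  have hN' : (0:ℝ) < N := by exact_mod_cast hN
  rw [Real.log_mul (by positivity) h0.ne', Real.log_pow, add_div, mul_div_cancel_left₀ _ hN'.ne'] at this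
  refine this.congr fun M => ?_
  rw [div_div, mul_comm (N:ℝ)]

lemma free_energy {ζ v l : ℝ} (hv : 0 < v) (hv1 : v < ζ) (hl : 0 < l) :
    FreeEnergyIs (l * Real.sinh (ζ - v)) (l * Real.sinh v) (l * Real.sinh ζ) (Real.log l + Real.log ‖EE ζ v‖) := by
  have hζ : 0 < ζ := hv.trans hv1
  have hmax : ∀ N : ℕ, ∃ n0 ∈ Finset.range (N + 1), ∀ n ∈ Finset.range (N + 1), ‖sec n (TT ζ N v)‖ ≤ ‖sec n0 (TT ζ N v)‖ := fun N =>
    Finset.exists_max_image _ (fun n => ‖sec n (TT ζ N v)‖) ⟨0, by simp⟩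
  choose n0 hn0 hm using hmax
  simp only [Finset.mem_range, Nat.lt_succ_iff] at hn0 hm
  refine ⟨fun N => Real.log l + Real.log ‖sec (n0 N) (TT ζ N v)‖ / N, fun N _ hN2 => ?_, ?_⟩
  · have hN : 0 < N := by omega
    have hN' : (0:ℝ) < N := by exact_mod_cast hN
    have hg : ∀ n : Fin (N + 1), _ := fun n => sector_growth hv hv1 hl hN (Nat.lt_succ_iff.1 n.2)
    choose h0 c1 hc1 D hD h using hg
    set z : Fin (N + 1) := ⟨n0 N, Nat.lt_succ_iff.2 (hn0 N)⟩ with hz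
    have r0 : 0 < ‖sec (n0 N) (TT ζ N v)‖ := h0 z
    have hall := Filter.eventually_all.2 h
    have := (log_growth (x := fun M => Z N M (l * Real.sinh (ζ - v)) (l * Real.sinh v) (l * Real.sinh ζ))
      (ρ := l ^ N * ‖sec (n0 N) (TT ζ N v)‖) (by positivity) (hc1 z) (D := ∑ n, D n)
      (Finset.sum_pos (fun n _ => hD n) ⟨z, Finset.mem_univ _⟩) (by
        filter_upwards [hall, eventually_gt_atTop 0] with M hM hM0
        rw [Z_eq hN hM0, Finset.sum_range]
        constructor
        · refine (hM z).1.trans (Finset.single_le_sum (f := fun n : Fin (N + 1) => Zn N M n _ _ _) (fun n _ => ?_) (Finset.mem_univ z))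
          have h1 := h0 n
          have h2 := hc1 n
          exact le_trans (by positivity) (hM n).1
        · rw [Finset.sum_mul]
          refine Finset.sum_le_sum fun n _ => (hM n).2.trans ?_
          have h2 := hm N n (Nat.lt_succ_iff.1 n.2)
          exact mul_le_mul_of_nonneg_left (pow_le_pow_left₀ (mul_nonneg (pow_pos hl _).le (norm_nonneg _)) (mul_le_mul_of_nonneg_left h2 (pow_pos hl _).le) M) (hD n).le)).div_const (N:ℝ)
    rw [Real.log_mul (by positivity) r0.ne', Real.log_pow, add_div, mul_div_cancel_left₀ _ hN'.ne'] at this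
    refine this.congr fun M => ?_
    rw [div_div]
  · obtain ⟨κ, hκ, C, hC, h2⟩ := E2 hv hv1
    obtain ⟨K, h1⟩ := E1 hζ
    have hE : 0 < ‖EE ζ v‖ := norm_pos_iff.2 (EE_ne ζ v)
    have lim : ∀ C : ℝ, Tendsto (fun N : ℕ => Real.log l + (Real.log C / N + Real.log ‖EE ζ v‖)) (atTop ⊓ Filter.principal {N | Even N}) (nhds (Real.log l + Real.log ‖EE ζ v‖)) := fun C => by
      refine Tendsto.mono_left ?_ inf_le_left
      simpa using ((tendsto_const_div_atTop_nhds_zero_nat (Real.log C)).add_const (Real.log ‖EE ζ v‖)).const_add (Real.log l)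
    have e : ∀ (N : ℕ) (C : ℝ), 0 < N → 0 < C → Real.log C / N + Real.log ‖EE ζ v‖ = Real.log (C * ‖EE ζ v‖ ^ N) / N := fun N C hN hC => by
      have : (0:ℝ) < N := by exact_mod_cast hN
      rw [Real.log_mul hC.ne' (by positivity), Real.log_pow]; field_simp
    have low : ∀ N : ℕ, Even N → 2 * K + 1 ≤ N → 1 / 2 * ‖EE ζ v‖ ^ N ≤ ‖sec (n0 N) (TT ζ N v)‖ := by
      rintro N ⟨k, rfl⟩ hk
      rw [← two_mul]
      refine le_trans ?_ (hm (2 * k) k (by omega))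
      have := h1 k (by omega) v hv.le hv1.le
      linarith
    refine tendsto_of_tendsto_of_tendsto_of_le_of_le' (lim (1 / 2)) (lim C) ?_ ?_
    all_goals
      refine Filter.eventually_inf_principal.2 ?_
      filter_upwards [eventually_ge_atTop (2 * K + 1)] with N hN hev
      have hN0 : 0 < N := by omega
      refine add_le_add le_rfl ?_
      have lw := low N hev hN
      have lp : 0 < 1 / 2 * ‖EE ζ v‖ ^ N := by positivity
    · rw [e N _ hN0 (by norm_num)]
      exact div_le_div_of_nonneg_right (Real.log_le_log lp lw) (Nat.cast_nonneg _)
    · rw [e N _ hN0 hC]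
      refine div_le_div_of_nonneg_right (Real.log_le_log (lp.trans_le lw) ((h2 N (n0 N) hev hN0 (hn0 N)).trans ?_)) (Nat.cast_nonneg _)
      have : Real.exp (-κ * |(N:ℝ) - 2 * (n0 N : ℕ)|) ≤ 1 := Real.exp_le_one_iff.2 (by nlinarith [abs_nonneg ((N:ℝ) - 2 * (n0 N : ℕ))])
      calc _ ≤ C * 1 * ‖EE ζ v‖ ^ N := by gcongr
        _ = _ := by ring

lemma param {a b c ζ v : ℝ} (hb : 0 < b) (ha : 0 < a) (hc : 0 < c) (hv : 0 < v) (hv1 : v < ζ)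
    (hD : (a ^ 2 + b ^ 2 - c ^ 2) / (2 * a * b) = -Real.cosh ζ) (h : a * Real.sinh v = b * Real.sinh (ζ - v)) :
    ∃ l > 0, a = l * Real.sinh (ζ - v) ∧ b = l * Real.sinh v ∧ c = l * Real.sinh ζ := by
  have sv : 0 < Real.sinh v := Real.sinh_pos_iff.2 hv
  have sz : 0 < Real.sinh ζ := Real.sinh_pos_iff.2 (hv.trans hv1)
  have h1 : a = b / Real.sinh v * Real.sinh (ζ - v) := by field_simp; linarith
  have h2 : b = b / Real.sinh v * Real.sinh v := by field_simp
  have hl : 0 < b / Real.sinh v := by positivity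
  refine ⟨b / Real.sinh v, hl, h1, h2, ?_⟩
  generalize b / Real.sinh v = l at *
  have hc2 : c ^ 2 = a ^ 2 + b ^ 2 + 2 * a * b * Real.cosh ζ := by
    rw [div_eq_iff (by positivity)] at hD; linarith
  have key : Real.sinh (ζ - v) ^ 2 + Real.sinh v ^ 2 + 2 * Real.sinh (ζ - v) * Real.sinh v * Real.cosh ζ = Real.sinh ζ ^ 2 := by
    rw [Real.sinh_sub]
    have e1 := Real.cosh_sq v
    have e2 := Real.cosh_sq ζ
    have : (Real.sinh ζ * Real.cosh v - Real.cosh ζ * Real.sinh v) ^ 2 + Real.sinh v ^ 2 + 2 * (Real.sinh ζ * Real.cosh v - Real.cosh ζ * Real.sinh v) * Real.sinh v * Real.cosh ζ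
      = Real.sinh ζ ^ 2 * Real.cosh v ^ 2 - Real.cosh ζ ^ 2 * Real.sinh v ^ 2 + Real.sinh v ^ 2 := by ring
    rw [this, e1, e2]; ring
  have : c ^ 2 = (l * Real.sinh ζ) ^ 2 := by rw [hc2, mul_pow, ← key, h1, h2]; ring
  exact (pow_left_inj₀ hc.le (by positivity) two_ne_zero).1 this

end final

section tnn
open scoped Matrix.Norms.L2Operator
/-- sector norm -/
def tn (ζ : ℝ) (N n : ℕ) (v : ℝ) : ℝ := ‖sec n (TT ζ N v)‖
end tnn

/-- **Asymptotic expansion of the sector free energies near density 1/2, regime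
`Δ < -1`** (Theorem 1.2, massive case). There are an absolute constant `C > 0`,
a constant `K ζ θ > 0`, and a constant `C' ζ θ` such that for all admissible weights:
(a) all sector free energies exist; (b) for every `ε > 0` there is `δ > 0` such that
for every even `N` and `n ≤ N/2 - C·min(ζ⁻², (log N)²)` with `1/2 - n/N ≤ δ`,
`|f_N^{(n)} - f + K(ζ,θ)(1 - 2n/N)| ≤ ε (1 - 2n/N) + C'(ζ,θ)/N`. -/
theorem sector_free_energy_expansion_massive :
    ∃ C : ℝ, 0 < C ∧ ∃ K : ℝ → ℝ → ℝ, ∃ C' : ℝ → ℝ → ℝ,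
      ∀ a b c ζ θ : ℝ, 0 < b → b ≤ a → 0 < c →
        (a ^ 2 + b ^ 2 - c ^ 2) / (2 * a * b) < -1 →
        0 < ζ →
        (a ^ 2 + b ^ 2 - c ^ 2) / (2 * a * b) = -Real.cosh ζ →
        0 < θ → θ < π →
        a * Real.sinh (θ * ζ / π) = b * Real.sinh ((1 - θ / π) * ζ) →
        0 < K ζ θ ∧
        (∀ N n : ℕ, Even N → 2 ≤ N → 2 * n ≤ N → ∃ L : ℝ, SectorFE N n a b c L) ∧
        ∃ F : ℝ, FreeEnergyIs a b c F ∧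
          ∀ ε : ℝ, 0 < ε → ∃ δ : ℝ, 0 < δ ∧
            ∀ (N n : ℕ) (L : ℝ), Even N →
              (n : ℝ) ≤ (N : ℝ) / 2 - C * min (1 / ζ ^ 2) (Real.log N ^ 2) →
              1 / 2 - (n : ℝ) / N ≤ δ →
              SectorFE N n a b c L →
              |L - F + K ζ θ * (1 - 2 * (n : ℝ) / N)| ≤
                ε * (1 - 2 * (n : ℝ) / N) + C' ζ θ / N := by
  classical
  have hB : ∀ ζ θ : ℝ, ∃ K C' : ℝ, 0 < θ * ζ / π → θ * ζ / π < ζ → 0 < K ∧ 0 ≤ C' ∧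
      ∀ ε > 0, ∃ δ > 0, ∀ N n : ℕ, Even N → 0 < N → 2 * n ≤ N → (1:ℝ) / 2 - n / N ≤ δ →
      |Real.log (tn ζ N n (θ * ζ / π)) / N - Real.log ‖EE ζ (θ * ζ / π : ℝ)‖ + K * (1 - 2 * n / N)| ≤ ε * (1 - 2 * n / N) + C' / N := by
    intro ζ θ
    by_cases h : 0 < θ * ζ / π ∧ θ * ζ / π < ζ
    · obtain ⟨K, hK, C', hC', h'⟩ := bulk h.1 h.2
      exact ⟨K, C', fun _ _ => ⟨hK, hC', h'⟩⟩
    · exact ⟨0, 0, fun h1 h2 => absurd ⟨h1, h2⟩ h⟩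
  choose K C' hB using hB
  refine ⟨1, one_pos, K, C', ?_⟩
  intro a b c ζ θ hb hba hc _ hζ hD hθ hθπ hs
  have hv : 0 < θ * ζ / π := by have := Real.pi_pos; positivity
  have hv1 : θ * ζ / π < ζ := by
    rw [div_lt_iff₀ Real.pi_pos]; nlinarith
  rw [show (1 - θ / π) * ζ = ζ - θ * ζ / π by ring] at hs
  obtain ⟨l, hl, rfl, rfl, rfl⟩ := param hb (hb.trans_le hba) hc hv hv1 hD hs
  obtain ⟨hK, hC', hbulk⟩ := hB ζ θ hv hv1
  refine ⟨hK, fun N n _ hN hn => ⟨_, sector_lim hv hv1 hl (by omega) (by omega)⟩, _, free_energy hv hv1 hl, ?_⟩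
  intro ε hε
  obtain ⟨δ, hδ, h⟩ := hbulk ε hε
  refine ⟨min δ (1 / 4), by positivity, fun N n L hev hn hd hL => ?_⟩
  rcases Nat.eq_zero_or_pos N with rfl | hN
  · exfalso
    have := hd.trans (min_le_right _ _)
    norm_num at this
  have hn2 : 2 * n ≤ N := by
    have h1 : 0 ≤ min (1 / ζ ^ 2) (Real.log N ^ 2) := le_min (by positivity) (by positivity)
    have : (2 * n : ℝ) ≤ N := by linarith
    exact_mod_cast this
  rw [tendsto_nhds_unique hL (sector_lim hv hv1 hl hN (by omega))]
  have := h N n hev hN hn2 (hd.trans (min_le_left _ _))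
  simp only [tn] at this
  rwa [add_sub_add_left_eq_sub]

end SixVertexFE
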